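/- Let D be a non-commutative division ring whose center F contains at least five elements, and let G be a subnormal subgroup of GL_n(D) with n ≥ 2. Then every solvable maximal subgroup of G is abelian. -/

import Mathlib

/-- A subgroup `H` of a group is subnormal if there is a finite chain of subgroups
from `H` up to the whole group, each normal in the next. -/
def IsSubnormal {Γ : Type*} [Group Γ] (H : Subgroup Γ) : Prop :=
  ∃ (k : ℕ) (s : ℕ → Subgroup Γ), s 0 = H ∧ s k = ⊤ ∧
    ∀ i < k, s i ≤ s (i + 1) ∧ ((s i).subgroupOf (s (i + 1))).Normal


set_option linter.all false

namespace SMA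

open scoped commutatorElement

/-! ### SL2-type identities -/
section SL2
variable {K S : Type*} [CommRing K] [Ring S] [Algebra K S]

/-- The unit `1 + c u` for `u² = 0`. -/
def xu (u : S) (hu : u * u = 0) (c : K) : Sˣ where
  val := 1 + c • u
  inv := 1 - c • u
  val_inv := by
    simp [mul_sub, add_mul, smul_mul_assoc, mul_smul_comm, hu]
  inv_val := by
    simp [mul_add, sub_mul, smul_mul_assoc, mul_smul_comm, hu]

theorem xu_val (u : S) (hu : u * u = 0) (c : K) : ((xu u hu c : Sˣ) : S) = 1 + c • u := rfl

theorem w_eq (u v : S) (hu : u * u = 0) (hv : v * v = 0) (h1 : u * v * u = u)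
    (a b : K) (hab : a * b = 1) :
    ((xu u hu a * xu v hv (-b) * xu u hu a : Sˣ) : S)
      = 1 - u * v - v * u + a • u - b • v := by
  have h2 : u * (v * u) = u := by rw [← mul_assoc, h1]
  have hba : b * a = 1 := by rw [mul_comm, hab]
  have e : a * (b * a) = a := by rw [hba, mul_one]
  simp only [Units.val_mul, xu_val, mul_add, add_mul, mul_one, one_mul, smul_mul_assoc,
    mul_smul_comm, hu, h1, smul_zero, neg_smul, smul_neg, smul_smul, neg_mul, mul_neg, mul_assoc, smul_add]
  simp only [hab, hba, one_smul, e, h2, mul_one]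
  abel

theorem h_eq (u v : S) (hu : u * u = 0) (hv : v * v = 0) (h1 : u * v * u = u)
    (h2 : v * u * v = v) (a b : K) (hab : a * b = 1) :
    (((xu u hu a * xu v hv (-b) * xu u hu a) * (xu u hu (-1 : K) * xu v hv (-(-1 : K)) * xu u hu (-1 : K)) : Sˣ) : S)
      = 1 - u * v - v * u + a • (u * v) + b • (v * u) := by
  rw [Units.val_mul, w_eq u v hu hv h1 a b hab,
    w_eq u v hu hv h1 (-1 : K) (-1) (by ring)]
  have h1' : u * (v * u) = u := by rw [← mul_assoc, h1]
  have h2' : v * (u * v) = v := by rw [← mul_assoc, h2]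
  simp only [neg_smul, one_smul, mul_add, mul_sub, add_mul, sub_mul, mul_one, one_mul, smul_mul_assoc,
    mul_assoc, hu, hv, h1', h2', smul_zero, mul_zero, sub_neg_eq_add, mul_neg, smul_neg]
  have h3 : u * (u * v) = 0 := by rw [← mul_assoc, hu, zero_mul]
  have h4 : v * (v * u) = 0 := by rw [← mul_assoc, hv, zero_mul]
  have h5 : u * (v * (u * v)) = u * v := by rw [h2']
  have h6 : v * (u * (v * u)) = v * u := by rw [h1']
  simp only [h3, h4, smul_zero, mul_zero]
  abel

theorem comm_eq (u v : S) (hu : u * u = 0) (hv : v * v = 0) (h1 : u * v * u = u)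
    (h2 : v * u * v = v) (a b : K) (hab : a * b = 1) (c : K) :
    ⁅((xu u hu a * xu v hv (-b) * xu u hu a) * (xu u hu (-1 : K) * xu v hv (-(-1 : K)) * xu u hu (-1 : K)) : Sˣ),
      xu u hu c⁆ = xu u hu ((a ^ 2 - 1) * c) := by
  set h := ((xu u hu a * xu v hv (-b) * xu u hu a) * (xu u hu (-1 : K) * xu v hv (-(-1 : K)) * xu u hu (-1 : K)) : Sˣ) with hh
  have hval := h_eq u v hu hv h1 h2 a b hab
  rw [← hh] at hval
  have hu1 : (h : S) * u = a • u := by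
    rw [hval]
    have h3 : v * u * u = 0 := by rw [mul_assoc, hu, mul_zero]
    simp only [add_mul, sub_mul, one_mul, h1, h3, smul_mul_assoc, smul_zero]
    abel
  have hu2 : u * (h : S) = b • u := by
    rw [hval]
    have h3 : u * (u * v) = 0 := by rw [← mul_assoc, hu, zero_mul]
    have h4 : u * (v * u) = u := by rw [← mul_assoc, h1]
    simp only [mul_add, mul_sub, mul_one, h3, h4, mul_smul_comm, smul_zero]
    abel
  have hkey : h * xu u hu c = xu u hu ((a ^ 2 - 1) * c) * xu u hu c * h := by
    ext
    simp only [Units.val_mul, xu_val, mul_add, add_mul, mul_one, one_mul, smul_mul_assoc,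
      mul_smul_comm, hu, smul_zero, hu1, hu2, smul_smul, add_zero]
    rw [add_assoc, ← add_smul]
    congr 2
    have : b * a = 1 := by rw [mul_comm, hab]
    linear_combination (-a * c) * hab
  rw [commutatorElement_def, hkey]; group

theorem xu_mem_comm (H : Subgroup Sˣ) (u v : S) (hu : u * u = 0) (hv : v * v = 0)
    (h1 : u * v * u = u) (h2 : v * u * v = v) (a b d : K) (hab : a * b = 1)
    (hd : (a ^ 2 - 1) * d = 1)
    (hx : ∀ c : K, xu u hu c ∈ H) (hy : ∀ c : K, xu v hv c ∈ H) (c : K) :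
    xu u hu c ∈ ⁅H, H⁆ := by
  have := comm_eq u v hu hv h1 h2 a b hab (d * c)
  rw [show (a ^ 2 - 1) * (d * c) = c by rw [← mul_assoc, hd, one_mul]] at this
  rw [← this]
  apply Subgroup.commutator_mem_commutator
  · exact H.mul_mem (H.mul_mem (H.mul_mem (hx _) (hy _)) (hx _))
      (H.mul_mem (H.mul_mem (hx _) (hy _)) (hx _))
  · exact hx _

theorem not_solvable_of_perfect {G : Type*} [Group G] (H : Subgroup G) (hH : H ≤ ⁅H, H⁆)
    (hne : H ≠ ⊥) : ¬ Group.IsSolvable G := by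
  intro hs
  obtain ⟨n, hn⟩ := hs.solvable
  have : ∀ n, H ≤ derivedSeries G n := by
    intro n
    induction n with
    | zero => simp
    | succ k ih =>
      rw [derivedSeries_succ]
      exact hH.trans (Subgroup.commutator_mono ih ih)
  exact hne (le_bot_iff.mp (hn ▸ this n))

/-- `SL2` inside `S` prevents solvability of the units. -/
theorem not_solvable_sl2 (u v : S) (hu : u * u = 0) (hv : v * v = 0)
    (h1 : u * v * u = u) (h2 : v * u * v = v) (a b d : K) (hab : a * b = 1)
    (hd : (a ^ 2 - 1) * d = 1) (hu0 : u ≠ 0) : ¬ Group.IsSolvable Sˣ := by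
  let T : Set Sˣ := {g | ∃ c : K, g = xu u hu c ∨ g = xu v hv c}
  have hx : ∀ c : K, xu u hu c ∈ Subgroup.closure T := fun c =>
    Subgroup.subset_closure ⟨c, Or.inl rfl⟩
  have hy : ∀ c : K, xu v hv c ∈ Subgroup.closure T := fun c =>
    Subgroup.subset_closure ⟨c, Or.inr rfl⟩
  apply not_solvable_of_perfect (Subgroup.closure T)
  · rw [Subgroup.closure_le]
    rintro g ⟨c, rfl | rfl⟩
    · exact xu_mem_comm _ u v hu hv h1 h2 a b d hab hd hx hy c
    · exact xu_mem_comm _ v u hv hu h2 h1 a b d hab hd hy hx c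
  · intro h
    have := hx 1
    rw [h, Subgroup.mem_bot] at this
    have h3 := congrArg (Units.val) this
    rw [xu_val] at h3
    simp at h3
    exact hu0 h3

end SL2

/-! ### Hua-type lemma -/
section Hua
variable {D : Type*} [DivisionRing D]

theorem hua_abelian (N : Subgroup Dˣ) [N.Normal] (hab : ∀ x ∈ N, ∀ y ∈ N, x * y = y * x)
    (x : Dˣ) (hx : x ∈ N) (d : D) : (x : D) * d = d * x := by
  by_contra hne
  have hd0 : d ≠ 0 := by rintro rfl; simp at hne
  have hd1 : d + 1 ≠ 0 := by
    intro h
    have : d = -1 := eq_neg_of_add_eq_zero_left h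
    subst this; simp at hne
  set c : Dˣ := x * (Units.mk0 d hd0) * x⁻¹ * (Units.mk0 d hd0)⁻¹ with hc
  set c' : Dˣ := x * (Units.mk0 (d+1) hd1) * x⁻¹ * (Units.mk0 (d+1) hd1)⁻¹ with hc'
  have hcN : ∀ g : Dˣ, x * g * x⁻¹ * g⁻¹ ∈ N := fun g => by
    have h1 : g * x⁻¹ * g⁻¹ ∈ N := Subgroup.Normal.conj_mem ‹_› _ (N.inv_mem hx) g
    have := N.mul_mem hx h1
    simpa [mul_assoc] using this
  have e1 : (c : D) * d = x * d * (x⁻¹ : Dˣ) := by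
    have : c * Units.mk0 d hd0 = x * (Units.mk0 d hd0) * x⁻¹ := by rw [hc]; group
    simpa using congrArg Units.val this
  have e2 : (c' : D) * (d + 1) = x * (d + 1) * (x⁻¹ : Dˣ) := by
    have : c' * Units.mk0 (d+1) hd1 = x * (Units.mk0 (d+1) hd1) * x⁻¹ := by rw [hc']; group
    simpa using congrArg Units.val this
  have e3 : ((c : D) - c') * d = c' - 1 := by
    have : (x : D) * (d + 1) * (x⁻¹ : Dˣ) = x * d * (x⁻¹ : Dˣ) + 1 := by
      rw [mul_add, add_mul]; simp
    rw [this, ← e1, mul_add, mul_one] at e2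
    rw [sub_mul, sub_eq_sub_iff_add_eq_add, add_comm, ← sub_eq_zero]
    rw [← sub_eq_zero] at e2
    rw [← neg_eq_zero, ← e2]; abel
  have k1 : (x : D) * c = c * x := by
    simpa using congrArg Units.val (hab x hx c (hcN _))
  have k2 : (x : D) * c' = c' * x := by
    simpa using congrArg Units.val (hab x hx c' (hcN _))
  by_cases h : (c : D) - c' = 0
  · rw [h, zero_mul] at e3
    have hc1 : (c' : D) = 1 := (sub_eq_zero.mp e3.symm)
    rw [sub_eq_zero.mp h, hc1, one_mul] at e1
    apply hne
    conv_rhs => rw [e1]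
    simp [mul_assoc]
  · have : d = ((c : D) - c')⁻¹ * (c' - 1) := by
      rw [← e3, ← mul_assoc, inv_mul_cancel₀ h, one_mul]
    apply hne
    have s1 : Commute (x : D) ((c : D) - c') := Commute.sub_right k1 k2
    have s2 : Commute (x : D) ((c' : D) - 1) := Commute.sub_right k2 (Commute.one_right _)
    rw [this]
    exact (s1.inv_right₀).mul_right s2

end Hua
end SMA

set_option linter.all false
namespace SMA
open scoped commutatorElement

theorem exists_derived {Γ : Type*} [Group Γ] (M K : Subgroup Γ) (hs : Group.IsSolvable M)
    (h : ¬ M ≤ K) : ∃ B ≤ M, (∀ m ∈ M, ∀ b ∈ B, m * b * m⁻¹ ∈ B) ∧ ¬ B ≤ K ∧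
      ∀ x ∈ B, ∀ y ∈ B, x * y * x⁻¹ * y⁻¹ ∈ K := by
  classical
  let B : ℕ → Subgroup Γ := fun i => (derivedSeries M i).map M.subtype
  have hex : ∃ i, B i ≤ K := by
    obtain ⟨n, hn⟩ := hs.solvable
    refine ⟨n, ?_⟩
    simp [B, hn]
  have hpos : Nat.find hex ≠ 0 := by
    intro h0
    have := Nat.find_spec hex
    rw [h0] at this
    apply h
    intro m hm
    exact this ⟨⟨m, hm⟩, by simp, rfl⟩
  obtain ⟨i, hi⟩ := Nat.exists_eq_succ_of_ne_zero hpos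
  have hnot : ¬ B i ≤ K := Nat.find_min hex (by omega)
  have hle : B (i+1) ≤ K := by have := Nat.find_spec hex; rwa [hi] at this
  refine ⟨B i, ?_, ?_, hnot, ?_⟩
  · rintro _ ⟨x, -, rfl⟩; exact x.2
  · rintro m hm _ ⟨x, hx, rfl⟩
    exact ⟨⟨m, hm⟩ * x * ⟨m, hm⟩⁻¹, (derivedSeries_normal M i).conj_mem _ hx _, rfl⟩
  · rintro _ ⟨x, hx, rfl⟩ _ ⟨y, hy, rfl⟩
    apply hle
    refine ⟨⁅x, y⁆, ?_, ?_⟩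
    · rw [derivedSeries_succ]
      exact Subgroup.commutator_mem_commutator hx hy
    · simp [commutatorElement_def]

section Hua
variable {D : Type*} [DivisionRing D]

theorem hua_aux (N : Subgroup Dˣ) (hn : ∀ g : Dˣ, ∀ x ∈ N, g * x * g⁻¹ ∈ N)
    (hz : ∀ x ∈ N, ∀ y ∈ N, ((x * y * x⁻¹ * y⁻¹ : Dˣ) : D) ∈ Subring.center D)
    (x y : Dˣ) (hx : x ∈ N) (hy : y ∈ N) (hxy : (x : D) * y ≠ y * x)
    (g : D) (hg : g ∈ Subring.center D) (hg0 : g ≠ 0) : (y : D) * y = - (g * g) := by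
  let K := Subring.center D
  obtain ⟨l, hl⟩ : ∃ l : K, (l : D) = ((x * y * x⁻¹ * y⁻¹ : Dˣ) : D) := ⟨⟨_, hz x hx y hy⟩, rfl⟩
  let γ : K := ⟨g, hg⟩
  have hγ0 : γ ≠ 0 := fun h => hg0 (congrArg Subtype.val h)
  have sm : ∀ (k : K) (d : D), k • d = (k : D) * d := fun k d => rfl
  have hcom : ∀ (k : K) (d : D), (k : D) * d = d * k := fun k d =>
    (Subring.mem_center_iff.mp k.2 d).symm
  have hxyl : (x : D) * y = l • ((y : D) * x) := by
    rw [sm, hl]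
    have : x * y = (x * y * x⁻¹ * y⁻¹) * (y * x) := by group
    exact_mod_cast congrArg Units.val this
  have hnc : ∀ k : K, (y : D) ≠ k • (1 : D) := by
    intro k h
    apply hxy
    rw [h, sm, mul_one, hcom]
  have hl0 : l ≠ 0 := by
    rintro rfl
    rw [zero_smul] at hxyl
    simp at hxyl
  have hl1 : l ≠ 1 := by
    rintro rfl
    rw [one_smul] at hxyl
    exact hxy hxyl
  have hyg : (y : D) + γ • (1 : D) ≠ 0 := by
    intro h
    apply hnc (-γ)
    rw [neg_smul]; exact eq_neg_of_add_eq_zero_left h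
  have conjx : (x : D) * y * (x⁻¹ : Dˣ) = l • (y : D) := by
    rw [hxyl, smul_mul_assoc, mul_assoc]; simp
  have conjk : ∀ k : K, (x : D) * (k • (1 : D)) * (x⁻¹ : Dˣ) = k • (1 : D) := by
    intro k; rw [mul_smul_comm, mul_one, smul_mul_assoc]; simp
  -- c
  let z : Dˣ := Units.mk0 ((y : D) + γ • (1 : D)) hyg
  have hcN : x * z * x⁻¹ * z⁻¹ ∈ N := by
    have h1 : z * x⁻¹ * z⁻¹ ∈ N := hn z _ (N.inv_mem hx)
    have := N.mul_mem hx h1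
    simpa [mul_assoc] using this
  set c := x * z * x⁻¹ * z⁻¹ with hc
  obtain ⟨l', hl'⟩ : ∃ l' : K, (l' : D) = ((x * c * x⁻¹ * c⁻¹ : Dˣ) : D) := ⟨⟨_, hz x hx _ hcN⟩, rfl⟩
  have e1 : (c : D) * z = l • (y : D) + γ • (1 : D) := by
    have : c * z = x * z * x⁻¹ := by rw [hc]; group
    have := congrArg Units.val this
    rw [Units.val_mul] at this
    rw [this, Units.val_mul, Units.val_mul]
    show (x : D) * (y + γ • (1:D)) * _ = _
    rw [mul_add, add_mul, conjx, conjk]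
  have e2 : (x : D) * c = l' • ((c : D) * x) := by
    rw [sm, hl']
    have : x * c = (x * c * x⁻¹ * c⁻¹) * (c * x) := by group
    exact_mod_cast congrArg Units.val this
  -- conjugate e1 by x
  have conjc : (x : D) * c * (x⁻¹ : Dˣ) = l' • (c : D) := by
    rw [e2, smul_mul_assoc, mul_assoc]; simp
  have cm : ∀ a b : D, (x : D) * (a * b) * (x⁻¹ : Dˣ) = (x * a * (x⁻¹ : Dˣ)) * (x * b * (x⁻¹ : Dˣ)) := by
    intro a b; simp [mul_assoc]
  have cz : (x : D) * z * (x⁻¹ : Dˣ) = l • (y : D) + γ • (1 : D) := by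
    show (x : D) * (y + γ • (1:D)) * _ = _
    rw [mul_add, add_mul, conjx, conjk]
  have csm : ∀ (k : K) (d : D), (x : D) * (k • d) * (x⁻¹ : Dˣ) = k • (x * d * (x⁻¹ : Dˣ)) := by
    intro k d; rw [mul_smul_comm, smul_mul_assoc]
  have e3 : (l' • (c : D)) * (l • (y : D) + γ • (1 : D)) = (l * l) • (y : D) + γ • (1 : D) := by
    have := congrArg (fun t => (x : D) * t * (x⁻¹ : Dˣ)) e1
    simp only [cm, cz, conjc, mul_add, add_mul, csm, conjx, conjk] at this
    rw [mul_add, this, smul_smul]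
    simp [mul_add, add_mul, csm, conjx, smul_smul]
  -- multiply by z
  have hzval : (z : D) = y + γ • (1 : D) := rfl
  have yz : (l • (y : D) + γ • (1 : D)) * z = z * (l • (y : D) + γ • (1 : D)) := by
    rw [hzval]; simp only [add_mul, mul_add, smul_mul_assoc, mul_smul_comm, mul_one, one_mul, smul_add, smul_smul, mul_comm]
    abel
  have e4 : l' • ((l • (y : D) + γ • (1 : D)) * (l • (y : D) + γ • (1 : D)))
      = ((l * l) • (y : D) + γ • (1 : D)) * z := by
    rw [← e3, mul_assoc, yz, ← mul_assoc, smul_mul_assoc, smul_mul_assoc, e1]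
  rw [hzval] at e4
  simp only [add_mul, mul_add, smul_mul_assoc, mul_smul_comm, mul_one, one_mul, smul_add, smul_smul] at e4
  have hl'1 : l' ≠ 1 := by
    rintro rfl
    have : (γ * (l - 1) ^ 2) • (y : D) = 0 := by
      linear_combination (norm := module) (-1 : K) • e4
    rw [smul_eq_zero] at this
    rcases this with h | h
    · rcases mul_eq_zero.mp h with h | h
      · exact hγ0 h
      · exact hl1 (sub_eq_zero.mp (pow_eq_zero_iff (two_ne_zero) |>.mp h))
    · exact y.ne_zero h
  have hl1' : (1 - l') ≠ 0 := fun h => hl'1 (sub_eq_zero.mp h).symm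
  set α : K := γ * (l * l + 1 - 2 * l * l') with hα
  have e5 : (l * l * (1 - l')) • ((y : D) * y) + α • (y : D) + (γ * γ * (1 - l')) • (1 : D) = 0 := by
    rw [hα]
    linear_combination (norm := module) (-1 : K) • e4
  have e6 : (l * l * (1 - l') * (l * l)) • ((y : D) * y) + (α * l) • (y : D) + (γ * γ * (1 - l')) • (1 : D) = 0 := by
    have := congrArg (fun t => (x : D) * t * (x⁻¹ : Dˣ)) e5
    simp only [mul_add, add_mul, csm, cm, conjx] at this
    simpa [smul_smul, smul_mul_assoc, mul_smul_comm, mul_assoc] using this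
  have e7 : (α * (l - l * l)) • (y : D) + (γ * γ * (1 - l') * (1 - l * l)) • (1 : D) = 0 := by
    linear_combination (norm := module) e6 - (l * l) • e5
  have hll : l - l * l ≠ 0 := by
    have : l - l * l = l * (1 - l) := by ring
    rw [this]
    exact mul_ne_zero hl0 (fun h => hl1 (sub_eq_zero.mp h).symm)
  have hα0 : α = 0 := by
    by_contra h
    have h' := mul_ne_zero h hll
    apply hnc (-((α * (l - l * l))⁻¹ * (γ * γ * (1 - l') * (1 - l * l))))
    have := congrArg (fun t => (α * (l - l * l))⁻¹ • t) e7
    simp only [smul_add, smul_smul, smul_zero, inv_mul_cancel₀ h', one_smul] at this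
    rw [neg_smul]
    exact eq_neg_of_add_eq_zero_left this
  have hll1 : l * l = 1 := by
    rw [hα0, zero_mul, zero_smul, zero_add, smul_eq_zero] at e7
    rcases e7 with h | h
    · rcases mul_eq_zero.mp h with h | h
      · exact absurd h (mul_ne_zero (mul_ne_zero hγ0 hγ0) hl1')
      · exact (sub_eq_zero.mp h).symm
    · exact absurd h one_ne_zero
  rw [hα0, hll1, zero_smul, one_mul, add_zero, mul_comm, mul_smul, ← smul_add, smul_eq_zero] at e5
  rcases e5 with h | h
  · exact absurd h hl1'
  · rw [sm] at h
    have : (y : D) * y = - (((γ * γ : K) : D) * 1) := by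
      rw [← sm]; exact eq_neg_of_add_eq_zero_left (by rw [sm]; exact h)
    rw [this, mul_one]; rfl

theorem hua (f : D) (hf : f ∈ Subring.center D) (hf0 : f ≠ 0) (hf1 : f * f ≠ 1)
    (hs : Group.IsSolvable Dˣ) (a b : D) : a * b = b * a := by
  by_contra hab
  have ha0 : a ≠ 0 := by rintro rfl; simp at hab
  haveI := hs
  let K : Subgroup Dˣ := Subgroup.center Dˣ
  have memK : ∀ x : Dˣ, x ∈ K → (x : D) ∈ Subring.center D := by
    intro x hx
    rw [Subring.mem_center_iff]
    intro d
    by_cases hd : d = 0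
    · simp [hd]
    · have := Subgroup.mem_center_iff.mp hx (Units.mk0 d hd)
      simpa using congrArg Units.val this
  have hK : ¬ (⊤ : Subgroup Dˣ) ≤ K := by
    intro h
    have := memK (Units.mk0 a ha0) (h trivial)
    exact hab (Subring.mem_center_iff.mp this b).symm
  obtain ⟨N, -, hN, hNK, hc⟩ := exists_derived ⊤ K inferInstance hK
  obtain ⟨x, hx, hxK⟩ := SetLike.not_le_iff_exists.mp hNK
  by_cases hcomm : ∀ x ∈ N, ∀ y ∈ N, x * y = y * x
  · haveI : N.Normal := ⟨fun n hn g => hN g trivial n hn⟩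
    apply hxK
    rw [Subgroup.mem_center_iff]
    intro g
    ext
    exact (hua_abelian N hcomm x hx g).symm
  · push Not at hcomm
    obtain ⟨x, hx, y, hy, hxy⟩ := hcomm
    have hxy' : (x : D) * y ≠ y * x := fun h => hxy (Units.ext h)
    have hz : ∀ x ∈ N, ∀ y ∈ N, ((x * y * x⁻¹ * y⁻¹ : Dˣ) : D) ∈ Subring.center D :=
      fun x hx y hy => memK _ (hc x hx y hy)
    have h1 := hua_aux N (fun g x hx => hN g trivial x hx) hz x y hx hy hxy' 1 (Subring.one_mem _) one_ne_zero
    have h2 := hua_aux N (fun g x hx => hN g trivial x hx) hz x y hx hy hxy' f hf hf0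
    rw [h1] at h2
    apply hf1
    simpa using (neg_injective h2).symm

end Hua
end SMA

set_option linter.all false
namespace SMA
open scoped commutatorElement
open Module

section Transv
variable {D V : Type*} [DivisionRing D] [AddCommGroup V] [Module D V]

/-- Rank one endomorphism. -/
def rk (φ : V →ₗ[D] D) (v : V) : End D V := φ.smulRight v

@[simp] theorem rk_apply (φ : V →ₗ[D] D) (v x : V) : rk φ v x = φ x • v := rfl

theorem rk_zero_right (φ : V →ₗ[D] D) : rk φ (0 : V) = 0 := by ext; simp

theorem mul_rk (g : End D V) (φ : V →ₗ[D] D) (v : V) : g * rk φ v = rk φ (g v) := by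
  ext x; simp [Module.End.mul_apply]

theorem rk_mul (g : End D V) (φ : V →ₗ[D] D) (v : V) : rk φ v * g = rk (φ ∘ₗ g) v := by
  ext x; simp [Module.End.mul_apply]

theorem rk_mul_rk (φ ψ : V →ₗ[D] D) (v w : V) : rk φ v * rk ψ w = rk ψ (φ w • v) := by
  ext x; simp [Module.End.mul_apply]

/-- Transvection. -/
def tv (φ : V →ₗ[D] D) (v : V) (h : φ v = 0) : (End D V)ˣ where
  val := 1 + rk φ v
  inv := 1 - rk φ v
  val_inv := by simp [mul_sub, add_mul, rk_mul_rk, h, rk_zero_right]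
  inv_val := by simp [mul_add, sub_mul, rk_mul_rk, h, rk_zero_right]

theorem tv_val (φ : V →ₗ[D] D) (v : V) (h : φ v = 0) : (tv φ v h : End D V) = 1 + rk φ v := rfl
theorem tv_apply (φ : V →ₗ[D] D) (v : V) (h : φ v = 0) (x : V) :
    (tv φ v h : End D V) x = x + φ x • v := rfl

variable (D V) in
/-- The elementary subgroup. -/
def EE : Subgroup (End D V)ˣ := Subgroup.closure {g | ∃ φ v, ∃ h : φ v = 0, g = tv φ v h}

theorem tv_mem (φ : V →ₗ[D] D) (v : V) (h : φ v = 0) : tv φ v h ∈ EE D V :=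
  Subgroup.subset_closure ⟨φ, v, h, rfl⟩

theorem EE_conj_tv (g : (End D V)ˣ) (φ : V →ₗ[D] D) (v : V) (h : φ v = 0) :
    ∃ h', g * tv φ v h * g⁻¹ = tv (φ ∘ₗ ((g⁻¹ : (End D V)ˣ) : End D V)) ((g : End D V) v) h' := by
  have gi : ∀ x, ((g⁻¹ : (End D V)ˣ) : End D V) ((g : End D V) x) = x := by
    intro x; rw [← Module.End.mul_apply, Units.inv_mul]; rfl
  refine ⟨by simp [gi, h], ?_⟩
  ext1
  simp only [Units.val_mul, tv_val, mul_add, add_mul, mul_one, mul_rk, rk_mul]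
  rw [Units.mul_inv]

instance EE_normal : (EE D V).Normal := by
  refine ⟨fun e he g => ?_⟩
  induction he using Subgroup.closure_induction with
  | mem x hx =>
    obtain ⟨φ, v, h, rfl⟩ := hx
    obtain ⟨h', e⟩ := EE_conj_tv g φ v h
    rw [e]; exact tv_mem _ _ _
  | one => simp [Subgroup.one_mem]
  | mul x y _ _ hx hy =>
    have := (EE D V).mul_mem hx hy
    simpa [mul_assoc] using this
  | inv x _ hx =>
    have := (EE D V).inv_mem hx
    simpa [mul_assoc] using this

theorem dual_exists (W : Submodule D V) (z : V) (hz : z ∉ W) :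
    ∃ φ : V →ₗ[D] D, φ z = 1 ∧ ∀ w ∈ W, φ w = 0 := by
  obtain ⟨f, hf, hW⟩ := Submodule.exists_le_ker_of_notMem hz
  refine ⟨LinearMap.smulRight f (f z)⁻¹, ?_, ?_⟩
  · simp [mul_inv_cancel₀ hf]
  · intro w hw
    have : f w = 0 := hW hw
    simp [this]

theorem dual_exists' (z : V) (hz : z ≠ 0) : ∃ φ : V →ₗ[D] D, φ z = 1 := by
  obtain ⟨φ, h, -⟩ := dual_exists (⊥ : Submodule D V) z (by simpa using hz)
  exact ⟨φ, h⟩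

theorem step1 (W : Submodule D V) (x y : V) (hx : x ∉ W) (hy : y ∉ W ⊔ D ∙ x) :
    ∃ e ∈ EE D V, (∀ w ∈ W, (e : End D V) w = w) ∧ (e : End D V) y = x := by
  have h : y ∉ W ⊔ D ∙ (x - y) := by
    intro h
    obtain ⟨w, hw, t, ht, e⟩ := Submodule.mem_sup.mp h
    obtain ⟨c, rfl⟩ := Submodule.mem_span_singleton.mp ht
    by_cases hc : 1 + c = 0
    · have hc' : c = -1 := (eq_neg_of_add_eq_zero_right hc)
      subst hc'
      apply hx
      have : x = w := by
        rw [neg_smul, one_smul] at e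
        rw [← sub_eq_zero, ← sub_eq_zero.mpr e.symm]; abel
      rw [this]; exact hw
    · apply hy
      have h3 : (1 + c) • y = w + c • x := by
        rw [add_smul, one_smul]
        nth_rewrite 1 [← e]
        rw [smul_sub]; abel
      have h4 : y = (1 + c)⁻¹ • (w + c • x) := by
        rw [← h3, smul_smul, inv_mul_cancel₀ hc, one_smul]
      rw [h4]
      apply Submodule.smul_mem
      exact Submodule.add_mem_sup hw (Submodule.smul_mem _ _ (Submodule.mem_span_singleton_self x))
  obtain ⟨φ, h1, h2⟩ := dual_exists _ y h
  have h3 : φ (x - y) = 0 := h2 _ (Submodule.mem_sup_right (Submodule.mem_span_singleton_self _))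
  refine ⟨tv φ (x - y) h3, tv_mem _ _ _, ?_, ?_⟩
  · intro w hw
    rw [tv_apply, h2 w (Submodule.mem_sup_left hw)]; simp
  · rw [tv_apply, h1]; simp

theorem exch (W : Submodule D V) (x y : V) (hy : y ∉ W) (h : y ∈ W ⊔ D ∙ x) : x ∈ W ⊔ D ∙ y := by
  obtain ⟨w, hw, t, ht, e⟩ := Submodule.mem_sup.mp h
  obtain ⟨c, rfl⟩ := Submodule.mem_span_singleton.mp ht
  have hc : c ≠ 0 := by rintro rfl; apply hy; rw [← e]; simpa using hw
  have : x = c⁻¹ • (y - w) := by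
    rw [← e]; simp [smul_smul, inv_mul_cancel₀ hc]
  rw [this]
  apply Submodule.smul_mem
  rw [sub_eq_neg_add]
  exact Submodule.add_mem_sup (Submodule.neg_mem _ hw) (Submodule.mem_span_singleton_self y)

theorem step2 (W : Submodule D V) (x y z : V) (hx : x ∉ W) (hy : y ∉ W) (hz : z ∉ W ⊔ D ∙ x) :
    ∃ e ∈ EE D V, (∀ w ∈ W, (e : End D V) w = w) ∧ (e : End D V) y = x := by
  by_cases h : y ∈ W ⊔ D ∙ x
  · have hzW : z ∉ W := fun h => hz (Submodule.mem_sup_left h)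
    have h1 : y ∉ W ⊔ D ∙ z := by
      intro h'
      have := exch W z y hy h'
      apply hz
      refine (sup_le le_sup_left ?_ : W ⊔ D ∙ y ≤ W ⊔ D ∙ x) this
      rw [Submodule.span_singleton_le_iff_mem]; exact h
    obtain ⟨e1, he1, h11, h12⟩ := step1 W z y hzW h1
    obtain ⟨e2, he2, h21, h22⟩ := step1 W x z hx hz
    refine ⟨e2 * e1, Subgroup.mul_mem _ he2 he1, ?_, ?_⟩
    · intro w hw; rw [Units.val_mul, Module.End.mul_apply, h11 w hw, h21 w hw]
    · rw [Units.val_mul, Module.End.mul_apply, h12, h22]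
  · exact step1 W x y hx h

/-- dilation -/
def dl (φ : V →ₗ[D] D) (v : V) (h : φ v = 1) (d : Dˣ) : (End D V)ˣ where
  val := 1 + rk φ (((d : D) - 1) • v)
  inv := 1 + rk φ ((((d⁻¹ : Dˣ) : D) - 1) • v)
  val_inv := by
    ext x
    simp [Module.End.mul_apply, h, smul_smul, sub_smul, smul_sub]
    abel
  inv_val := by
    ext x
    simp [Module.End.mul_apply, h, smul_smul, sub_smul, smul_sub]
    abel

theorem dl_apply (φ : V →ₗ[D] D) (v : V) (h : φ v = 1) (d : Dˣ) (x : V) :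
    (dl φ v h d : End D V) x = x + φ x • (((d : D) - 1) • v) := rfl

theorem dl_mul (φ : V →ₗ[D] D) (v : V) (h : φ v = 1) (d d' : Dˣ) :
    dl φ v h d * dl φ v h d' = dl φ v h (d' * d) := by
  ext x
  simp [dl_apply, Module.End.mul_apply, h, smul_smul, sub_smul, smul_sub, mul_assoc]
  abel

theorem dl_inj (φ : V →ₗ[D] D) (v : V) (h : φ v = 1) (d d' : Dˣ) (e : dl φ v h d = dl φ v h d') :
    d = d' := by
  have := congrArg (fun g : (End D V)ˣ => φ ((g : End D V) v)) e
  simp [dl_apply, h] at this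
  exact Units.ext this

theorem T3' [Module.Finite D V] (φ : V →ₗ[D] D) (v : V) (h : φ v = 1) (g : (End D V)ˣ) :
    ∃ e ∈ EE D V, ∃ d : Dˣ, e * g = dl φ v h d := by
  classical
  have inj : ∀ (k : (End D V)ˣ) (x y : V), (k : End D V) x = (k : End D V) y → x = y := by
    intro k x y hxy
    have := congrArg ((k⁻¹ : (End D V)ˣ) : End D V) hxy
    rw [← Module.End.mul_apply, ← Module.End.mul_apply, Units.inv_mul] at this
    exact this
  have key : ∀ s : Finset V, (∀ t ∈ s, φ t = 0) → ∃ e ∈ EE D V, ∀ t ∈ s, ((e * g : (End D V)ˣ) : End D V) t = t := by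
    intro s
    induction s using Finset.induction with
    | empty => intro _; exact ⟨1, Subgroup.one_mem _, by simp⟩
    | insert t s ht ih =>
      intro hs
      obtain ⟨e, he, hfix⟩ := ih (fun u hu => hs u (Finset.mem_insert_of_mem hu))
      let W := Submodule.span D (s : Set V)
      have hW : ∀ w ∈ W, ((e * g : (End D V)ˣ) : End D V) w = w := by
        intro w hw
        induction hw using Submodule.span_induction with
        | mem x hx => exact hfix x hx
        | zero => simp
        | add x y _ _ hx hy => rw [map_add, hx, hy]
        | smul a x _ hx => rw [map_smul, hx]
      have hWk : W ≤ LinearMap.ker φ := by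
        rw [Submodule.span_le]; intro u hu
        exact hs u (Finset.mem_insert_of_mem hu)
      by_cases htW : t ∈ W
      · refine ⟨e, he, ?_⟩
        intro u hu
        rcases Finset.mem_insert.mp hu with rfl | hu
        · exact hW _ htW
        · exact hfix u hu
      · have hy : ((e * g : (End D V)ˣ) : End D V) t ∉ W := by
          intro h'
          have := inj _ _ _ (hW _ h')
          rw [this] at h'
          exact htW h'
        have hz : v ∉ W ⊔ D ∙ t := by
          intro h'
          have h2 : W ⊔ D ∙ t ≤ LinearMap.ker φ := by
            apply sup_le hWk
            rw [Submodule.span_singleton_le_iff_mem]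
            exact hs t (Finset.mem_insert_self _ _)
          have : φ v = 0 := h2 h'
          rw [h] at this; exact one_ne_zero this
        obtain ⟨e', he', h1, h2⟩ := step2 W t _ v htW hy hz
        refine ⟨e' * e, Subgroup.mul_mem _ he' he, ?_⟩
        intro u hu
        rw [mul_assoc, Units.val_mul, Module.End.mul_apply]
        rcases Finset.mem_insert.mp hu with rfl | hu
        · exact h2
        · rw [hfix u hu]; exact h1 u (Submodule.subset_span hu)
  obtain ⟨s, hs⟩ := (IsNoetherian.noetherian (LinearMap.ker φ) : (LinearMap.ker φ).FG)
  obtain ⟨e, he, hfix⟩ := key s (fun t ht => by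
    have : t ∈ LinearMap.ker φ := by rw [← hs]; exact Submodule.subset_span ht
    exact this)
  set k := e * g with hk
  have hW : ∀ w, φ w = 0 → (k : End D V) w = w := by
    intro w hw
    have hw : w ∈ Submodule.span D (s : Set V) := by rw [hs]; exact hw
    induction hw using Submodule.span_induction with
    | mem x hx => exact hfix x hx
    | zero => simp
    | add x y _ _ hx hy =>
      rw [map_add, hx (by rw [← LinearMap.mem_ker, ← hs]; assumption), hy (by rw [← LinearMap.mem_ker, ← hs]; assumption)]
    | smul a x _ hx => rw [map_smul, hx (by rw [← LinearMap.mem_ker, ← hs]; assumption)]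
  set d := φ ((k : End D V) v) with hd
  have hd0 : d ≠ 0 := by
    intro h0
    have := inj _ _ _ (hW _ h0)
    have h1 : φ ((k : End D V) v) = 0 := h0
    rw [this, h] at h1
    exact one_ne_zero h1
  have hdd : φ (-(d⁻¹ • ((k : End D V) v - d • v))) = 0 := by
    simp [h, ← hd]
  refine ⟨tv φ _ hdd * e, Subgroup.mul_mem _ (tv_mem _ _ _) he, Units.mk0 d hd0, ?_⟩
  rw [mul_assoc, ← hk]
  ext x
  have hx : x = φ x • v + (x - φ x • v) := by abel
  have hx0 : φ (x - φ x • v) = 0 := by simp [h]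
  have hkx : (k : End D V) x = φ x • (k : End D V) v + (x - φ x • v) := by
    conv_lhs => rw [hx]
    rw [map_add, map_smul, hW _ hx0]
  rw [Units.val_mul, Module.End.mul_apply, tv_apply, dl_apply, hkx]
  have : φ (φ x • (k : End D V) v + (x - φ x • v)) = φ x * d := by
    rw [map_add, hx0, map_smul, ← hd]; simp
  rw [this]
  simp only [smul_neg, smul_smul, mul_assoc, mul_inv_cancel₀ hd0, inv_mul_cancel₀ hd0, mul_one, smul_sub, Units.val_mk0, sub_smul, mul_sub, one_smul]
  abel

end Transv
end SMA

set_option linter.all false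
namespace SMA
open scoped commutatorElement
open Module

section Transv
variable {D V : Type*} [DivisionRing D] [AddCommGroup V] [Module D V]

theorem xu_rk_mem (φ : V →ₗ[D] D) (v w : V) (h : φ v = 0) (hw : φ w = 1)
    (hu : rk φ v * rk φ v = 0) (c : Subring.center (End D V)) :
    xu (rk φ v) hu c ∈ EE D V := by
  have hc : rk φ v * (c : End D V) = (c : End D V) * rk φ v := Subring.mem_center_iff.mp c.2 _
  have h1 : φ ((c : End D V) w) • v = (c : End D V) v := by
    have := LinearMap.congr_fun hc w
    simpa [Module.End.mul_apply, hw] using this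
  have h2 : φ ((c : End D V) v) = 0 := by rw [← h1, map_smul, h, smul_zero]
  have : xu (rk φ v) hu c = tv φ ((c : End D V) v) h2 := by
    ext1
    rw [xu_val, tv_val, ← mul_rk]; rfl
  rw [this]; exact tv_mem _ _ _

theorem T2 (hK : ∃ a b d : Subring.center (End D V), a * b = 1 ∧ (a ^ 2 - 1) * d = 1) :
    EE D V ≤ ⁅EE D V, EE D V⁆ := by
  obtain ⟨a, b, d, hab, hd⟩ := hK
  conv_lhs => rw [EE]
  rw [Subgroup.closure_le]
  rintro _ ⟨φ, v, h, rfl⟩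
  by_cases hv : v = 0
  · have : tv φ v h = 1 := by ext1; rw [tv_val, hv, rk_zero_right]; simp
    rw [this]; exact Subgroup.one_mem _
  by_cases hφ : φ = 0
  · have : tv φ v h = 1 := by ext x; rw [tv_apply, hφ]; simp
    rw [this]; exact Subgroup.one_mem _
  obtain ⟨x, hx⟩ : ∃ x, φ x ≠ 0 := by
    by_contra hh; push Not at hh; exact hφ (LinearMap.ext hh)
  obtain ⟨w, hw⟩ : ∃ w, φ w = 1 := ⟨(φ x)⁻¹ • x, by simp [inv_mul_cancel₀ hx]⟩
  obtain ⟨ψ, h1, h2⟩ := dual_exists (D ∙ w) v (by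
    intro hh
    obtain ⟨c, rfl⟩ := Submodule.mem_span_singleton.mp hh
    rw [map_smul, hw, smul_eq_mul, mul_one] at h
    rw [h] at hv; simp at hv)
  have h2 : ψ w = 0 := h2 w (Submodule.mem_span_singleton_self w)
  have hu : rk φ v * rk φ v = 0 := by rw [rk_mul_rk, h, zero_smul, rk_zero_right]
  have hu' : rk ψ w * rk ψ w = 0 := by rw [rk_mul_rk, h2, zero_smul, rk_zero_right]
  have key := xu_mem_comm (EE D V) (rk φ v) (rk ψ w) hu hu'
    (by simp [rk_mul_rk, hw, h1]) (by simp [rk_mul_rk, hw, h1]) a b d hab hd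
    (fun c => xu_rk_mem φ v w h hw hu c) (fun c => xu_rk_mem ψ w v h2 h1 hu' c) 1
  have : xu (rk φ v) hu (1 : Subring.center (End D V)) = tv φ v h := by
    ext1; rw [xu_val, tv_val, one_smul]
  rwa [this] at key

theorem exists_pair (h2 : ∀ x : V, ∃ z, z ∉ D ∙ x) :
    ∃ (φ₁ φ₂ : V →ₗ[D] D) (v₁ v₂ : V), φ₁ v₁ = 1 ∧ φ₁ v₂ = 0 ∧ φ₂ v₁ = 0 ∧ φ₂ v₂ = 1 := by
  obtain ⟨v₁, hv₁⟩ := h2 0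
  have hv₁ : v₁ ≠ 0 := by rintro rfl; simp at hv₁
  obtain ⟨v₂, hv₂⟩ := h2 v₁
  have h12 : v₁ ∉ D ∙ v₂ := by
    intro h
    apply hv₂
    have := exch (⊥ : Submodule D V) v₂ v₁ (by simpa using hv₁) (by simpa using h)
    simpa using this
  obtain ⟨φ₁, a1, a2⟩ := dual_exists _ _ h12
  obtain ⟨φ₂, b1, b2⟩ := dual_exists _ _ hv₂
  exact ⟨φ₁, φ₂, v₁, v₂, a1, a2 _ (Submodule.mem_span_singleton_self _),
    b2 _ (Submodule.mem_span_singleton_self _), b1⟩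

theorem T3 [Module.Finite D V] (h2 : ∀ x : V, ∃ z, z ∉ D ∙ x) (g₁ g₂ : (End D V)ˣ) :
    g₁ * g₂ * g₁⁻¹ * g₂⁻¹ ∈ EE D V := by
  obtain ⟨φ₁, φ₂, v₁, v₂, h11, h12, h21, h22⟩ := exists_pair h2
  obtain ⟨e₁, he₁, d₁, hd₁⟩ := T3' φ₁ v₁ h11 g₁
  obtain ⟨e₂, he₂, d₂, hd₂⟩ := T3' φ₂ v₂ h22 g₂
  have hc : dl φ₁ v₁ h11 d₁ * dl φ₂ v₂ h22 d₂ = dl φ₂ v₂ h22 d₂ * dl φ₁ v₁ h11 d₁ := by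
    ext x
    simp [dl_apply, Module.End.mul_apply, h12, h21]
    abel
  rw [← QuotientGroup.eq_one_iff]
  have q1 : ((g₁ : (End D V)ˣ) : (End D V)ˣ ⧸ EE D V) = (dl φ₁ v₁ h11 d₁ : (End D V)ˣ) := by
    rw [← hd₁, QuotientGroup.mk_mul, (QuotientGroup.eq_one_iff e₁).mpr he₁, one_mul]
  have q2 : ((g₂ : (End D V)ˣ) : (End D V)ˣ ⧸ EE D V) = (dl φ₂ v₂ h22 d₂ : (End D V)ˣ) := by
    rw [← hd₂, QuotientGroup.mk_mul, (QuotientGroup.eq_one_iff e₂).mpr he₂, one_mul]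
  rw [QuotientGroup.mk_mul, QuotientGroup.mk_mul, QuotientGroup.mk_mul, QuotientGroup.mk_inv,
    QuotientGroup.mk_inv, q1, q2, ← QuotientGroup.mk_mul, hc, QuotientGroup.mk_mul]
  group

theorem central_of_lines [Module.Finite D V] (h2 : ∀ x : V, ∃ z, z ∉ D ∙ x) (g : End D V)
    (h : ∀ v, g v ∈ D ∙ v) : g ∈ Subring.center (End D V) := by
  have h1 : finrank D V ≠ 1 := by
    intro h1
    obtain ⟨v, hv, hw⟩ := finrank_eq_one_iff'.mp h1
    obtain ⟨z, hz⟩ := h2 v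
    obtain ⟨c, hc⟩ := hw z
    exact hz (Submodule.mem_span_singleton.mpr ⟨c, hc⟩)
  obtain ⟨a, ha⟩ := LinearMap.exists_mem_center_apply_eq_smul_of_forall_notLinearIndependent (f := g) h1
    (by
      intro v hli
      obtain ⟨c, hc⟩ := Submodule.mem_span_singleton.mp (h v)
      rw [LinearIndependent.pair_iff] at hli
      have := (hli c (-1) (by rw [hc]; simp)).2
      simp at this)
  rw [Subring.mem_center_iff]
  intro k
  rw [ha]
  ext x
  simp only [Module.End.mul_apply, LinearMap.smul_apply, Module.End.one_apply]
  exact map_smul k (a : D) x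

theorem step3 (W : Submodule D V) (x y : V) (hx : x ∉ W) (hy : y ∉ W) :
    ∃ e ∈ EE D V, (∀ w ∈ W, (e : End D V) w = w) ∧ (e : End D V) y ∈ D ∙ x := by
  by_cases h : y ∈ W ⊔ D ∙ x
  · obtain ⟨w, hw, t, ht, e⟩ := Submodule.mem_sup.mp h
    obtain ⟨φ, h1, h2⟩ := dual_exists W y hy
    refine ⟨tv φ (-w) (by simp [h2 w hw]), tv_mem _ _ _, ?_, ?_⟩
    · intro w hw
      rw [tv_apply, h2 w hw]; simp
    · rw [tv_apply, h1, ← e]; simpa using ht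
  · obtain ⟨e, he, h1, h2⟩ := step1 W x y hx h
    exact ⟨e, he, h1, by rw [h2]; exact Submodule.mem_span_singleton_self _⟩

theorem unit_inj (k : (End D V)ˣ) {x y : V} (hxy : (k : End D V) x = (k : End D V) y) : x = y := by
  have := congrArg ((k⁻¹ : (End D V)ˣ) : End D V) hxy
  rw [← Module.End.mul_apply, ← Module.End.mul_apply, Units.inv_mul] at this
  exact this

theorem unit_inv_apply (k : (End D V)ˣ) (x : V) :
    ((k⁻¹ : (End D V)ˣ) : End D V) ((k : End D V) x) = x := by
  rw [← Module.End.mul_apply, Units.inv_mul]; rfl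

theorem unit_apply_inv (k : (End D V)ˣ) (x : V) :
    (k : End D V) (((k⁻¹ : (End D V)ˣ) : End D V) x) = x := by
  rw [← Module.End.mul_apply, Units.mul_inv]; rfl

theorem T4 [Module.Finite D V] (h2 : ∀ x : V, ∃ z, z ∉ D ∙ x)
    (hK : ∃ a b d : Subring.center (End D V), a * b = 1 ∧ (a ^ 2 - 1) * d = 1)
    (H : Subgroup (End D V)ˣ) (hH : ∀ e ∈ EE D V, ∀ h ∈ H, e * h * e⁻¹ ∈ H) :
    (∀ h ∈ H, (h : End D V) ∈ Subring.center (End D V)) ∨ EE D V ≤ H := by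
  by_cases hcen : ∀ h ∈ H, (h : End D V) ∈ Subring.center (End D V)
  · exact Or.inl hcen
  right
  push Not at hcen
  obtain ⟨h₀, hh₀, hnc⟩ := hcen
  obtain ⟨v, hv⟩ : ∃ v, (h₀ : End D V) v ∉ D ∙ v := by
    by_contra hcon; push Not at hcon; exact hnc (central_of_lines h2 _ hcon)
  have hv0 : v ≠ 0 := by rintro rfl; simp at hv
  have ind : ∀ v' w' : V, v' ≠ 0 → w' ∉ D ∙ v' → ∃ h ∈ H, (h : End D V) v' ∈ D ∙ w' := by
    intro v' w' hv' hw'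
    obtain ⟨z, hz⟩ := h2 v'
    obtain ⟨e₁, he₁, -, h1⟩ := step2 (⊥ : Submodule D V) v' v z (by simpa using hv') (by simpa using hv0)
      (by simpa using hz)
    have hn : (e₁ : End D V) ((h₀ : End D V) v) ∉ D ∙ v' := by
      intro hh
      obtain ⟨c, hc⟩ := Submodule.mem_span_singleton.mp hh
      rw [← h1, ← map_smul] at hc
      have := unit_inj _ hc
      exact hv (Submodule.mem_span_singleton.mpr ⟨c, this⟩)
    obtain ⟨e₂, he₂, h3, h4⟩ := step3 (D ∙ v') w' _ hw' hn
    refine ⟨(e₂ * e₁) * h₀ * (e₂ * e₁)⁻¹, hH _ (Subgroup.mul_mem _ he₂ he₁) _ hh₀, ?_⟩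
    have : (((e₂ * e₁)⁻¹ : (End D V)ˣ) : End D V) v' = v := by
      apply unit_inj (e₂ * e₁)
      rw [unit_apply_inv, Units.val_mul, Module.End.mul_apply, h1,
        h3 v' (Submodule.mem_span_singleton_self _)]
    rw [Units.val_mul, Module.End.mul_apply, this, Units.val_mul, Module.End.mul_apply,
      Units.val_mul, Module.End.mul_apply]
    exact h4
  have trans : ∀ p q : V, p ≠ 0 → q ≠ 0 → ∃ h ∈ H, (h : End D V) p ∈ D ∙ q := by
    intro p q hp hq
    by_cases hpq : q ∈ D ∙ p
    · refine ⟨1, H.one_mem, ?_⟩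
      have := exch (⊥ : Submodule D V) p q (by simpa using hq) (by simpa using hpq)
      simpa using this
    · exact ind p q hp hpq
  -- generators mod H
  have gen : ∀ φ w (hw : φ w = 0), ∃ φ' : V →ₗ[D] D, ∃ hφ' : φ' v = 0, ∃ h ∈ H,
      (tv φ w hw : (End D V)ˣ) = tv φ' v hφ' * h := by
    intro φ w hw
    by_cases hw0 : w = 0
    · refine ⟨0, by simp, 1, H.one_mem, ?_⟩
      ext x; simp [tv_apply, hw0]
    obtain ⟨h, hh, hc⟩ := trans v w hv0 hw0
    obtain ⟨c, hc⟩ := Submodule.mem_span_singleton.mp hc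
    have hc0 : c ≠ 0 := by
      rintro rfl
      rw [zero_smul] at hc
      apply hv0; apply unit_inj h; rw [← hc]; simp
    have hiw : ((h⁻¹ : (End D V)ˣ) : End D V) w = c⁻¹ • v := by
      apply unit_inj h
      rw [unit_apply_inv, map_smul, ← hc, smul_smul, inv_mul_cancel₀ hc0, one_smul]
    have hφ' : ((φ ∘ₗ (h : End D V)).smulRight c⁻¹ : V →ₗ[D] D) v = 0 := by
      simp [← hc, hw]
    have heq : h⁻¹ * tv φ w hw * h = tv ((φ ∘ₗ (h : End D V)).smulRight c⁻¹) v hφ' := by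
      ext x
      simp only [Units.val_mul, Module.End.mul_apply, tv_apply, map_add, unit_inv_apply, map_smul, hiw]
      simp [smul_smul]
    refine ⟨_, hφ', (tv _ v hφ')⁻¹ * h * (tv _ v hφ')⁻¹⁻¹ * h⁻¹, ?_, ?_⟩
    · exact H.mul_mem (hH _ (Subgroup.inv_mem _ (tv_mem _ _ _)) _ hh) (H.inv_mem hh)
    · rw [← heq]; group
  -- quotient
  let Nn := Subgroup.normalizer (H : Set (End D V)ˣ)
  have hEN : EE D V ≤ Nn := by
    intro e he
    rw [Subgroup.mem_normalizer_iff]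
    intro h
    refine ⟨hH e he h, fun hh => ?_⟩
    have := hH _ (Subgroup.inv_mem _ he) _ hh
    simpa [mul_assoc] using this
  have com : ∀ x ∈ EE D V, ∀ y ∈ EE D V, x * y * x⁻¹ * y⁻¹ ∈ H := by
    haveI : (H.subgroupOf Nn).Normal := Subgroup.normal_in_normalizer
    let π := QuotientGroup.mk' (H.subgroupOf Nn)
    have hπ : ∀ x : Nn, π x = 1 ↔ (x : (End D V)ˣ) ∈ H := by
      intro x
      show ((x : Nn) : Nn ⧸ H.subgroupOf Nn) = 1 ↔ _
      rw [QuotientGroup.eq_one_iff, Subgroup.mem_subgroupOf]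
    have gg : ∀ φ w (hw : φ w = 0) ψ u (hu : ψ u = 0),
        Commute (π ⟨tv φ w hw, hEN (tv_mem _ _ _)⟩) (π ⟨tv ψ u hu, hEN (tv_mem _ _ _)⟩) := by
      have gg' : ∀ φ w (hw : φ w = 0), ∃ φ' : V →ₗ[D] D, ∃ hφ' : φ' v = 0,
          π ⟨tv φ w hw, hEN (tv_mem _ _ _)⟩ = π ⟨tv φ' v hφ', hEN (tv_mem _ _ _)⟩ := by
        intro φ w hw
        obtain ⟨φ', hφ', h, hh, e⟩ := gen φ w hw
        refine ⟨φ', hφ', ?_⟩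
        rw [← inv_mul_eq_one, ← map_inv, ← map_mul, hπ]
        have : (tv φ w hw)⁻¹ * tv φ' v hφ' = h⁻¹ := by rw [e]; group
        show (tv φ w hw)⁻¹ * tv φ' v hφ' ∈ H
        rw [this]; exact H.inv_mem hh
      intro φ w hw ψ u hu
      obtain ⟨φ', hφ', e1⟩ := gg' φ w hw
      obtain ⟨ψ', hψ', e2⟩ := gg' ψ u hu
      rw [e1, e2, commute_iff_eq, ← map_mul, ← map_mul]
      congr 1
      ext x
      simp [tv_apply, Module.End.mul_apply, hφ', hψ']
      abel
    have cc : ∀ x (hx : x ∈ EE D V), ∀ y (hy : y ∈ EE D V), Commute (π ⟨x, hEN hx⟩) (π ⟨y, hEN hy⟩) := by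
      intro x hx y hy
      induction hx, hy using Subgroup.closure_induction₂ with
      | mem x y hx hy =>
        obtain ⟨φ, w, hw, rfl⟩ := hx
        obtain ⟨ψ, u, hu, rfl⟩ := hy
        exact gg _ _ _ _ _ _
      | one_left x hx => exact (map_one π).symm ▸ Commute.one_left _
      | one_right x hx => exact (map_one π).symm ▸ Commute.one_right _
      | mul_left x y z hx hy hz h1 h2 =>
        have : π ⟨x * y, hEN (Subgroup.mul_mem _ hx hy)⟩ = π ⟨x, hEN hx⟩ * π ⟨y, hEN hy⟩ := by
          rw [← map_mul]; rfl
        rw [this]; exact Commute.mul_left h1 h2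
      | mul_right y z x hy hz hx h1 h2 =>
        have : π ⟨y * z, hEN (Subgroup.mul_mem _ hy hz)⟩ = π ⟨y, hEN hy⟩ * π ⟨z, hEN hz⟩ := by
          rw [← map_mul]; rfl
        rw [this]; exact Commute.mul_right h1 h2
      | inv_left x y hx hy h =>
        have : π ⟨x⁻¹, hEN (Subgroup.inv_mem _ hx)⟩ = (π ⟨x, hEN hx⟩)⁻¹ := by
          rw [← map_inv]; rfl
        rw [this]; exact Commute.inv_left h
      | inv_right x y hx hy h =>
        have : π ⟨y⁻¹, hEN (Subgroup.inv_mem _ hy)⟩ = (π ⟨y, hEN hy⟩)⁻¹ := by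
          rw [← map_inv]; rfl
        rw [this]; exact Commute.inv_right h
    intro x hx y hy
    have := cc x hx y hy
    have h3 : π (⟨x, hEN hx⟩ * ⟨y, hEN hy⟩ * ⟨x, hEN hx⟩⁻¹ * ⟨y, hEN hy⟩⁻¹) = 1 := by
      rw [map_mul, map_mul, map_mul, map_inv, map_inv, this.eq]; group
    rw [hπ] at h3
    exact h3
  refine (T2 hK).trans ?_
  rw [Subgroup.commutator_le]
  intro x hx y hy
  exact com x hx y hy

end Transv
end SMA

set_option linter.all false
namespace SMA
open scoped commutatorElement
open Module

theorem perfect_bot {Γ : Type*} [Group Γ] (E X : Subgroup Γ) (hE : E ≤ ⁅E, E⁆) (hX : E ≤ X)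
    (hs : Group.IsSolvable X) : E = ⊥ := by
  obtain ⟨n, hn⟩ := hs.solvable
  have : ∀ n, E ≤ (derivedSeries X n).map X.subtype := by
    intro n
    induction n with
    | zero => intro e he; exact ⟨⟨e, hX he⟩, by simp, rfl⟩
    | succ k ih =>
      rw [derivedSeries_succ, Subgroup.map_commutator]
      exact hE.trans (Subgroup.commutator_mono ih ih)
  have h := this n
  rw [hn, Subgroup.map_bot] at h
  exact le_bot_iff.mp h

theorem solvable_of_le {Γ : Type*} [Group Γ] {X Y : Subgroup Γ} (h : X ≤ Y)
    (hs : Group.IsSolvable Y) : Group.IsSolvable X :=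
  Group.isSolvable_of_isSolvable_injective (f := Subgroup.inclusion h) (Subgroup.inclusion_injective h)

theorem solvable_of_comm_le {Γ : Type*} [Group Γ] {N M : Subgroup Γ}
    (hs : Group.IsSolvable M) (h : ∀ x ∈ N, ∀ y ∈ N, x * y * x⁻¹ * y⁻¹ ∈ M) :
    Group.IsSolvable N := by
  have hc : (commutator N).map N.subtype ≤ M := by
    rw [commutator_def, Subgroup.map_commutator, Subgroup.commutator_le]
    rintro _ ⟨x, -, rfl⟩ _ ⟨y, -, rfl⟩
    exact h x x.2 y y.2
  haveI : Group.IsSolvable (commutator N) := by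
    let f : commutator N →* M :=
      { toFun := fun x => ⟨(x : N), hc ⟨x, x.2, rfl⟩⟩
        map_one' := rfl
        map_mul' := fun _ _ => rfl }
    refine Group.isSolvable_of_isSolvable_injective (f := f) ?_
    intro x y hxy
    have : ((x : N) : Γ) = ((y : N) : Γ) := congrArg (fun z : M => (z : Γ)) hxy
    exact Subtype.ext (Subtype.ext this)
  exact Group.isSolvable_of_ker_le_range (commutator N).subtype (Abelianization.of (G := N))
    (by rw [Abelianization.ker_of]; simp)

/-- units of a subring inherit solvability -/
theorem solvable_units {R : Type*} [Ring R] (S : Subring R) (N : Subgroup Rˣ)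
    (hN : Group.IsSolvable N) (h : ∀ u : Rˣ, (u : R) ∈ S → ((u⁻¹ : Rˣ) : R) ∈ S → u ∈ N) :
    Group.IsSolvable (S)ˣ := by
  let f : (S)ˣ →* N :=
    { toFun := fun u => ⟨Units.map (S.subtype : S →* R) u, h _ (u : S).2 ((u⁻¹ : Sˣ) : S).2⟩
      map_one' := by ext; rfl
      map_mul' := fun _ _ => by ext; rfl }
  refine Group.isSolvable_of_isSolvable_injective (f := f) ?_
  intro x y hxy
  have := congrArg (fun z : N => ((z : Rˣ) : R)) hxy
  exact Units.ext (Subtype.ext this)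

/-- No `SL2` inside a solvable group. -/
theorem no_sl2 {R K : Type*} [Ring R] [CommRing K] [Algebra K R] (N : Subgroup Rˣ) (hN : Group.IsSolvable N)
    (u v : R) (hu : u * u = 0) (hv : v * v = 0)
    (h1 : u * v * u = u) (h2 : v * u * v = v) (a b d : K) (hab : a * b = 1)
    (hd : (a ^ 2 - 1) * d = 1) (hx' : ∀ c : K, xu u hu c ∈ N) (hy' : ∀ c : K, xu v hv c ∈ N) : u = 0 := by
  let T : Set Rˣ := {g | ∃ c : K, g = xu u hu c ∨ g = xu v hv c}
  have hx : ∀ c : K, xu u hu c ∈ Subgroup.closure T := fun c =>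
    Subgroup.subset_closure ⟨c, Or.inl rfl⟩
  have hy : ∀ c : K, xu v hv c ∈ Subgroup.closure T := fun c =>
    Subgroup.subset_closure ⟨c, Or.inr rfl⟩
  have hb := perfect_bot (Subgroup.closure T) N
    (by
      rw [Subgroup.closure_le]
      rintro g ⟨c, rfl | rfl⟩
      · exact xu_mem_comm _ u v hu hv h1 h2 a b d hab hd hx hy c
      · exact xu_mem_comm _ v u hv hu h2 h1 a b d hab hd hy hx c)
    (by
      rw [Subgroup.closure_le]
      rintro g ⟨c, rfl | rfl⟩
      · exact hx' c
      · exact hy' c) hN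
  have := hx 1
  rw [hb, Subgroup.mem_bot] at this
  have h3 := congrArg (Units.val) this
  rw [xu_val] at h3
  simpa using h3

section Transv
variable {D V : Type*} [DivisionRing D] [AddCommGroup V] [Module D V]

theorem exists_K (hF : ∃ f ∈ Subring.center D, f ≠ 0 ∧ f * f ≠ 1) :
    ∃ a b d : Subring.center (End D V), a * b = 1 ∧ (a ^ 2 - 1) * d = 1 := by
  obtain ⟨f, hf, hf0, hf1⟩ := hF
  let i : Subring.center D → Subring.center (End D V) := fun c =>
    ⟨{ toFun := fun x => (c : D) • x
       map_add' := fun x y => smul_add _ _ _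
       map_smul' := fun r x => by
        rw [RingHom.id_apply, smul_smul, smul_smul, Subring.mem_center_iff.mp c.2 r] }, by
      rw [Subring.mem_center_iff]
      intro g; ext x
      exact map_smul g _ _⟩
  let F : Subring.center D := ⟨f, hf⟩
  have hF0 : F ≠ 0 := fun h => hf0 (congrArg Subtype.val h)
  have hF1 : F ^ 2 - 1 ≠ 0 := fun h => hf1 (by
    have := congrArg Subtype.val (sub_eq_zero.mp h)
    simpa [F, pow_two] using this)
  have im : ∀ x y, i x * i y = i (x * y) := by
    intro x y; ext v; exact smul_smul _ _ _
  have i1 : i 1 = 1 := by ext v; exact one_smul _ _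
  have is : ∀ x y, i x - i y = i (x - y) := by
    intro x y; ext v; exact (sub_smul _ _ _).symm
  refine ⟨i F, i F⁻¹, i (F ^ 2 - 1)⁻¹, ?_, ?_⟩
  · rw [im, mul_inv_cancel₀ hF0, i1]
  · rw [pow_two, im, ← i1, is, im, ← pow_two, mul_inv_cancel₀ hF1]

theorem center_unit [Module.Finite D V] (c : End D V) (hc : c ∈ Subring.center (End D V)) (hc0 : c ≠ 0) :
    ∃ c' ∈ Subring.center (End D V), c * c' = 1 ∧ c' * c = 1 := by
  obtain ⟨v, hv⟩ : ∃ v, c v ≠ 0 := by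
    by_contra h; push Not at h; exact hc0 (LinearMap.ext h)
  have inj : Function.Injective c := by
    rw [injective_iff_map_eq_zero]
    intro w hw
    by_contra hw0
    obtain ⟨φ, hφ⟩ := dual_exists' (D := D) w hw0
    have := LinearMap.congr_fun (Subring.mem_center_iff.mp hc (rk φ v)) w
    simp [Module.End.mul_apply, hw, hφ] at this
    exact hv this.symm
  have hu : IsUnit c := (Module.End.isUnit_iff _).mpr ⟨inj, LinearMap.injective_iff_surjective.mp inj⟩
  obtain ⟨u, rfl⟩ := hu
  refine ⟨(u⁻¹ : (End D V)ˣ), ?_, u.mul_inv, u.inv_mul⟩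
  rw [Subring.mem_center_iff] at hc ⊢
  intro g
  have : Commute g (u : End D V) := hc g
  exact this.units_inv_right

theorem T5 [Module.Finite D V] (h2 : ∀ x : V, ∃ z, z ∉ D ∙ x) (S : Subring (End D V))
    (hS : ∀ e ∈ EE D V, (e : End D V) ∈ S) : S = ⊤ := by
  have h0 : ∀ φ v, φ v = 0 → rk φ v ∈ S := by
    intro φ v h
    have := S.sub_mem (hS _ (tv_mem φ v h)) S.one_mem
    simpa [tv_val] using this
  have h1 : ∀ φ v, rk φ v ∈ S := by
    intro φ v
    by_cases h : φ v = 0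
    · exact h0 φ v h
    obtain ⟨z, hz⟩ := h2 v
    set w := z - (φ z * (φ v)⁻¹) • v with hw
    have hwv : w ∉ D ∙ v := by
      intro h
      apply hz
      have := Submodule.add_mem _ h (Submodule.smul_mem _ (φ z * (φ v)⁻¹) (Submodule.mem_span_singleton_self v))
      simpa [hw] using this
    have hφw : φ w = 0 := by simp [hw, mul_assoc, inv_mul_cancel₀ h]
    obtain ⟨ψ, hψ1, hψ2⟩ := dual_exists _ _ hwv
    have := S.mul_mem (h0 ψ v (hψ2 v (Submodule.mem_span_singleton_self v))) (h0 φ w hφw)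
    simpa [rk_mul_rk, hψ1] using this
  rw [eq_top_iff]
  intro g _
  let b := Module.finBasis D V
  have : g = ∑ i, rk (b.coord i) (g (b i)) := by
    apply LinearMap.ext
    intro x
    rw [LinearMap.sum_apply]
    conv_lhs => rw [← b.sum_repr x]
    rw [map_sum]
    simp only [map_smul, rk_apply, Basis.coord_apply]
  rw [this]
  exact S.sum_mem (fun i _ => h1 _ _)

/-- The standing hypotheses. -/
structure Ctx (G M : Subgroup (End D V)ˣ) : Prop where
  h2 : ∀ x : V, ∃ z, z ∉ D ∙ x
  hF : ∃ f ∈ Subring.center D, f ≠ 0 ∧ f * f ≠ 1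
  hnc : ∃ a b : D, a * b ≠ b * a
  hE : EE D V ≤ G
  hlt : M < G
  hmax : ∀ H : Subgroup (End D V)ˣ, M ≤ H → H ≤ G → H = M ∨ H = G
  hsol : Group.IsSolvable M

def MN {R : Type*} [Ring R] (M X : Subgroup Rˣ) : Prop := ∀ m ∈ M, ∀ x ∈ X, m * x * m⁻¹ ∈ X
def Cen {R : Type*} [Ring R] (X : Subgroup Rˣ) : Prop := ∀ x ∈ X, (x : R) ∈ Subring.center R

theorem MN.le_normalizer {R : Type*} [Ring R] {M X : Subgroup Rˣ} (h : MN M X) :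
    M ≤ Subgroup.normalizer (X : Set Rˣ) := by
  intro m hm
  rw [Subgroup.mem_normalizer_iff]
  intro x
  refine ⟨h m hm x, fun hx => ?_⟩
  have := h _ (M.inv_mem hm) _ hx
  simpa [mul_assoc] using this

variable {G M : Subgroup (End D V)ˣ}

theorem Ctx.E_not_le [Module.Finite D V] (c : Ctx G M) (X : Subgroup (End D V)ˣ)
    (hs : Group.IsSolvable X) : ¬ EE D V ≤ X := by
  intro h
  have hb := perfect_bot _ X (T2 (exists_K c.hF)) h hs
  have : (⊥ : Subring (End D V)) = ⊤ := T5 c.h2 ⊥ (by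
    intro e he; rw [hb, Subgroup.mem_bot] at he; rw [he]; exact Subring.one_mem _)
  -- ⊥ commutative
  obtain ⟨φ₁, φ₂, v₁, v₂, h11, h12, h21, h22⟩ := exists_pair c.h2
  have hv₁ : v₁ ≠ 0 := by rintro rfl; simp at h11
  have : tv φ₁ v₂ h12 = 1 := by
    have := tv_mem φ₁ v₂ h12
    rwa [hb, Subgroup.mem_bot] at this
  have h3 := congrArg (fun g : (End D V)ˣ => φ₂ ((g : End D V) v₁)) this
  simp [tv_apply, h11, h21, h22] at h3

theorem Ctx.solv [Module.Finite D V] (c : Ctx G M) (N : Subgroup (End D V)ˣ) (h : N ⊓ G ≤ M) :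
    Group.IsSolvable N := by
  apply solvable_of_comm_le c.hsol
  intro x hx y hy
  apply h
  exact ⟨N.mul_mem (N.mul_mem (N.mul_mem hx hy) (N.inv_mem hx)) (N.inv_mem hy),
    c.hE (T3 c.h2 x y)⟩

/-- The basic maximality dichotomy. -/
theorem Ctx.inf_le (c : Ctx G M) (N : Subgroup (End D V)ˣ) (h : M ≤ N) (hE : ¬ EE D V ≤ N) :
    N ⊓ G ≤ M := by
  rcases c.hmax (N ⊓ G) (le_inf h c.hlt.le) inf_le_right with h' | h'
  · exact h'.le
  · exact absurd ((c.hE.trans h'.ge).trans inf_le_left) hE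

theorem Ctx.A [Module.Finite D V] (c : Ctx G M) (X : Subgroup (End D V)ˣ) (hX : MN M X) (hnc : ¬ Cen X)
    (hE : ¬ EE D V ≤ X) : Subgroup.normalizer (X : Set (End D V)ˣ) ⊓ G ≤ M := by
  apply c.inf_le _ hX.le_normalizer
  intro h
  rcases T4 c.h2 (exists_K c.hF) X (fun e he x hx => (Subgroup.mem_normalizer_iff.mp (h he) x).mp hx) with h1 | h1
  · exact hnc h1
  · exact hE h1

theorem Ctx.A' [Module.Finite D V] (c : Ctx G M) (X : Subgroup (End D V)ˣ) (hX : MN M X) (hnc : ¬ Cen X)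
    (hE : ¬ EE D V ≤ X) : Group.IsSolvable (Subgroup.normalizer (X : Set (End D V)ˣ)) :=
  c.solv _ (c.A X hX hnc hE)

theorem Ctx.DD [Module.Finite D V] (c : Ctx G M) (N : Subgroup (End D V)ˣ) (hN : Group.IsSolvable N)
    (φ : V →ₗ[D] D) (v : V) (h : φ v = 1) (hd : ∀ d, dl φ v h d ∈ N) : False := by
  let f : Dˣ →* N :=
    { toFun := fun d => ⟨dl φ v h d⁻¹, hd _⟩
      map_one' := by ext x; simp [dl_apply]
      map_mul' := fun x y => by
        apply Subtype.ext
        show _ = dl φ v h _ * dl φ v h _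
        rw [dl_mul, mul_inv_rev] }
  have : Group.IsSolvable Dˣ := Group.isSolvable_of_isSolvable_injective (f := f) (by
    intro x y hxy
    have := dl_inj φ v h _ _ (congrArg Subtype.val hxy)
    exact inv_injective this)
  obtain ⟨f, hf, hf0, hf1⟩ := c.hF
  obtain ⟨a, b, hab⟩ := c.hnc
  exact hab (hua f hf hf0 hf1 this a b)

/-- stabiliser of a submodule -/
def stab (W : Submodule D V) : Subgroup (End D V)ˣ where
  carrier := {g | (∀ w ∈ W, (g : End D V) w ∈ W) ∧ ∀ w ∈ W, ((g⁻¹ : (End D V)ˣ) : End D V) w ∈ W}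
  one_mem' := by simp
  mul_mem' := by
    rintro a b ⟨ha, ha'⟩ ⟨hb, hb'⟩
    refine ⟨fun w hw => ?_, fun w hw => ?_⟩
    · rw [Units.val_mul]; exact ha _ (hb _ hw)
    · rw [mul_inv_rev, Units.val_mul]; exact hb' _ (ha' _ hw)
  inv_mem' := by
    rintro a ⟨ha, ha'⟩
    exact ⟨ha', by simpa using ha⟩

theorem Ctx.irred [Module.Finite D V] (c : Ctx G M) (W : Submodule D V)
    (hW : ∀ m ∈ M, ∀ w ∈ W, (m : End D V) w ∈ W) (h0 : W ≠ ⊥) : W = ⊤ := by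
  by_contra h1
  obtain ⟨w, hw, hw0⟩ := Submodule.exists_mem_ne_zero_of_ne_bot h0
  obtain ⟨x, hx⟩ : ∃ x, x ∉ W := by
    by_contra h; push Not at h; exact h1 (eq_top_iff.mpr fun x _ => h x)
  have hx0 : x ≠ 0 := by rintro rfl; exact hx W.zero_mem
  have hle : stab W ⊓ G ≤ M := by
    apply c.inf_le
    · intro m hm
      exact ⟨hW m hm, hW _ (M.inv_mem hm)⟩
    · intro hE
      obtain ⟨z, hz⟩ := c.h2 x
      obtain ⟨e, he, -, h3⟩ := step2 (⊥ : Submodule D V) x w z (by simpa using hx0) (by simpa using hw0)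
        (by simpa using hz)
      apply hx; rw [← h3]; exact (hE he).1 w hw
  obtain ⟨φ, hφ⟩ := dual_exists' (D := D) w hw0
  refine c.DD _ (c.solv _ hle) φ w hφ ?_
  have hdl : ∀ d, ∀ u ∈ W, (dl φ w hφ d : End D V) u ∈ W := by
    intro d u hu
    rw [dl_apply]
    exact W.add_mem hu (W.smul_mem _ (W.smul_mem _ hw))
  intro d
  refine ⟨hdl d, ?_⟩
  have : (dl φ w hφ d)⁻¹ = dl φ w hφ d⁻¹ := by
    rw [inv_eq_iff_mul_eq_one, dl_mul]; ext x; simp [dl_apply]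
  rw [this]; exact hdl d⁻¹

end Transv
end SMA

set_option linter.all false
namespace SMA
open scoped commutatorElement
open Module

/-- centraliser subring of a group of units -/
def CX {R : Type*} [Ring R] (X : Subgroup Rˣ) : Subring R :=
  Subring.centralizer ((fun x : Rˣ => (x : R)) '' (X : Set Rˣ))

theorem mem_CX {R : Type*} [Ring R] {X : Subgroup Rˣ} {c : R} :
    c ∈ CX X ↔ ∀ x ∈ X, (x : R) * c = c * x := by
  simp [CX, Subring.mem_centralizer_iff]

theorem center_le_CX {R : Type*} [Ring R] {X : Subgroup Rˣ} {c : R} (hc : c ∈ Subring.center R) : c ∈ CX X :=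
  mem_CX.mpr fun x _ => Subring.mem_center_iff.mp hc x

theorem CX_conj {R : Type*} [Ring R] {M X : Subgroup Rˣ} (hX : MN M X) {c : R} (hc : c ∈ CX X)
    {m : Rˣ} (hm : m ∈ M) : (m : R) * c * ((m⁻¹ : Rˣ) : R) ∈ CX X := by
  rw [mem_CX] at hc ⊢
  intro x hx
  have h1 := hX _ (M.inv_mem hm) x hx
  have h2 := hc _ h1
  have h3 := congrArg (fun t => (m : R) * t * ((m⁻¹ : Rˣ) : R)) h2
  simp [mul_assoc] at h3
  simpa [mul_assoc] using h3

theorem CX_unit_normalizer {R : Type*} [Ring R] {X : Subgroup Rˣ} {u : Rˣ} (hc : (u : R) ∈ CX X) :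
    u ∈ Subgroup.normalizer (X : Set Rˣ) := by
  rw [mem_CX] at hc
  have hinv : ∀ x ∈ X, u * x * u⁻¹ = x := by
    intro x hx
    have : x * u = u * x := Units.ext (hc x hx)
    rw [← this]; group
  rw [Subgroup.mem_normalizer_iff]
  intro x
  refine ⟨fun hx => by rw [hinv x hx]; exact hx, fun hx => ?_⟩
  have h1 := hinv _ hx
  have : u * x * u⁻¹ = x := by
    have := congrArg (fun t => u⁻¹ * t * u) h1
    simpa [mul_assoc] using this
  rwa [this] at hx

/-- From a nilpotent with von Neumann inverse, make an SL2 pair. -/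
theorem sl2_pair {R : Type*} [Ring R] (u v : R) (hu : u * u = 0) (h1 : u * v * u = u) :
    ∃ w ∈ Subring.closure {u, v}, w * w = 0 ∧ u * w * u = u ∧ w * u * w = w := by
  have hmu : u ∈ Subring.closure {u, v} := Subring.subset_closure (by simp)
  have hmv : v ∈ Subring.closure {u, v} := Subring.subset_closure (by simp)
  set S := Subring.closure {u, v}
  obtain ⟨v, hv, h1, h2⟩ : ∃ v' ∈ S, u * v' * u = u ∧ v' * u * v' = v' := by
    refine ⟨v * u * v, S.mul_mem (S.mul_mem hmv hmu) hmv, ?_, ?_⟩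
    · calc u * (v * u * v) * u = (u * v * u) * v * u := by noncomm_ring
        _ = u := by rw [h1, h1]
    · calc v * u * v * u * (v * u * v) = v * (u * v * u) * (v * u * v) := by noncomm_ring
        _ = v * u * v * u * v := by rw [h1]; simp only [mul_assoc]
        _ = v * (u * v * u) * v := by simp only [mul_assoc]
        _ = v * u * v := by rw [h1]
  refine ⟨v - v * v * u, S.sub_mem hv (S.mul_mem (S.mul_mem hv hv) hmu), ?_, ?_, ?_⟩
  · calc (v - v * v * u) * (v - v * v * u)
        = v * v - v * v * v * u - v * (v * u * v) + v * (v * u * v) * v * u := by noncomm_ring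
      _ = 0 := by rw [h2]; noncomm_ring
  · calc u * (v - v * v * u) * u = u * v * u - u * v * v * (u * u) := by noncomm_ring
      _ = u := by rw [hu, h1]; simp
  · calc (v - v * v * u) * u * (v - v * v * u)
        = v * u * v - v * u * v * v * u - v * v * (u * u) * (v - v * v * u) := by noncomm_ring
      _ = v - v * v * u := by rw [hu, h2]; simp

section Transv
variable {D V : Type*} [DivisionRing D] [AddCommGroup V] [Module D V] {G M : Subgroup (End D V)ˣ}

def XS (X : Subgroup (End D V)ˣ) (W : Submodule D V) : Prop := ∀ x ∈ X, ∀ w ∈ W, (x : End D V) w ∈ W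

theorem XS.sup {X : Subgroup (End D V)ˣ} {W W' : Submodule D V} (h : XS X W) (h' : XS X W') : XS X (W ⊔ W') := by
  intro x hx w hw
  obtain ⟨a, ha, b, hb, rfl⟩ := Submodule.mem_sup.mp hw
  rw [map_add]; exact Submodule.add_mem_sup (h x hx a ha) (h' x hx b hb)

theorem XS.inf {X : Subgroup (End D V)ˣ} {W W' : Submodule D V} (h : XS X W) (h' : XS X W') : XS X (W ⊓ W') := by
  intro x hx w hw
  exact ⟨h x hx w hw.1, h' x hx w hw.2⟩

theorem XS.map {X : Subgroup (End D V)ˣ} {W : Submodule D V} (h : XS X W) (hX : MN M X) {m : (End D V)ˣ} (hm : m ∈ M) :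
    XS X (W.map (m : End D V)) := by
  rintro x hx _ ⟨w, hw, rfl⟩
  have h1 := hX _ (M.inv_mem hm) x hx
  refine ⟨((m⁻¹ * x * m⁻¹⁻¹ : (End D V)ˣ) : End D V) w, h _ h1 w hw, ?_⟩
  simp only [inv_inv, Units.val_mul, Module.End.mul_apply, unit_apply_inv]

theorem Ctx.compl [Module.Finite D V] (c : Ctx G M) (X : Subgroup (End D V)ˣ) (hX : MN M X)
    (W : Submodule D V) (hW : XS X W) : ∃ Y, XS X Y ∧ IsCompl W Y := by
  -- minimal U
  obtain ⟨U, ⟨hU0, hUX⟩, hUmin⟩ := (wellFounded_lt (α := Submodule D V)).has_min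
    {U : Submodule D V | U ≠ ⊥ ∧ XS X U} ⟨⊤, by
      obtain ⟨z, hz⟩ := c.h2 0
      refine ⟨?_, fun _ _ _ _ => trivial⟩
      intro h
      have : z ∈ (⊤ : Submodule D V) := trivial
      rw [h, Submodule.mem_bot] at this
      subst this; exact hz (Submodule.zero_mem _)⟩
  obtain ⟨Y, ⟨hYW, hYX⟩, hYmax⟩ := (wellFounded_gt (α := Submodule D V)).has_min
    {Y : Submodule D V | Disjoint W Y ∧ XS X Y} ⟨⊥, disjoint_bot_right, fun x _ w hw => by
      rw [Submodule.mem_bot] at hw; rw [hw]; simp⟩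
  refine ⟨Y, hYX, hYW, ?_⟩
  rw [codisjoint_iff]
  by_contra hne
  have hall : ¬ ∀ m ∈ M, U.map (m : End D V) ≤ W ⊔ Y := by
    intro hall
    apply hne
    have htop : (⨆ m : M, U.map ((m : (End D V)ˣ) : End D V)) = ⊤ := by
      apply c.irred
      · intro m hm w hw
        have : (⨆ m : M, U.map ((m : (End D V)ˣ) : End D V)).map (m : End D V)
            ≤ ⨆ m : M, U.map ((m : (End D V)ˣ) : End D V) := by
          rw [Submodule.map_iSup]
          apply iSup_le
          intro k
          refine le_trans ?_ (le_iSup _ (⟨m, hm⟩ * k : M))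
          rintro _ ⟨_, ⟨u, hu, rfl⟩, rfl⟩
          exact ⟨u, hu, rfl⟩
        exact this ⟨w, hw, rfl⟩
      · intro hb
        apply hU0
        rw [eq_bot_iff, ← hb]
        refine le_trans ?_ (le_iSup _ (1 : M))
        intro u hu; exact ⟨u, hu, rfl⟩
    rw [eq_top_iff, ← htop]
    exact iSup_le fun m => hall m m.2
  push Not at hall
  obtain ⟨m, hm, hmU⟩ := hall
  have hmX : XS X (U.map (m : End D V)) := hUX.map hX hm
  -- intersection trivial
  have hdis : U.map (m : End D V) ⊓ (W ⊔ Y) = ⊥ := by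
    by_contra hb
    set Z := U.map (m : End D V) ⊓ (W ⊔ Y) with hZ
    have hZX : XS X Z := hmX.inf (hW.sup hYX)
    have hZ' : XS X (Z.map ((m⁻¹ : (End D V)ˣ) : End D V)) := hZX.map hX (M.inv_mem hm)
    have hle : Z.map ((m⁻¹ : (End D V)ˣ) : End D V) ≤ U := by
      rintro _ ⟨z, hz, rfl⟩
      obtain ⟨u, hu, rfl⟩ := hz.1
      rw [unit_inv_apply]; exact hu
    have hne' : Z.map ((m⁻¹ : (End D V)ˣ) : End D V) ≠ ⊥ := by
      intro h0
      apply hb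
      rw [eq_bot_iff]
      intro z hz
      have : ((m⁻¹ : (End D V)ˣ) : End D V) z ∈ Z.map ((m⁻¹ : (End D V)ˣ) : End D V) := ⟨z, hz, rfl⟩
      rw [h0, Submodule.mem_bot] at this
      rw [Submodule.mem_bot]
      apply unit_inj m⁻¹; rw [this]; simp
    have heq : Z.map ((m⁻¹ : (End D V)ˣ) : End D V) = U := by
      by_contra hne2
      exact hUmin _ ⟨hne', hZ'⟩ (lt_of_le_of_ne hle hne2)
    apply hmU
    rintro _ ⟨u, hu, rfl⟩
    rw [← heq] at hu
    obtain ⟨z, hz, rfl⟩ := hu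
    rw [unit_apply_inv]; exact hz.2
  have hdd : Disjoint W (Y ⊔ U.map (m : End D V)) := by
    apply Disjoint.disjoint_sup_right_of_disjoint_sup_left hYW
    rw [disjoint_iff, inf_comm]; exact hdis
  refine hYmax _ ⟨hdd, hYX.sup hmX⟩ ?_
  show Y < Y ⊔ U.map (m : End D V)
  refine lt_of_le_of_ne le_sup_left ?_
  intro h
  apply hmU
  have : U.map (m : End D V) ≤ Y := by rw [h]; exact le_sup_right
  exact this.trans le_sup_right

theorem Ctx.regular [Module.Finite D V] (c : Ctx G M) (X : Subgroup (End D V)ˣ) (hX : MN M X)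
    (r : End D V) (hr : r ∈ CX X) : ∃ r' ∈ CX X, r * r' * r = r := by
  rw [mem_CX] at hr
  have hr' : ∀ x ∈ X, ∀ v, (x : End D V) (r v) = r ((x : End D V) v) := fun x hx v =>
    LinearMap.congr_fun (hr x hx) v
  obtain ⟨Y, hYX, hY⟩ := c.compl X hX (LinearMap.ker r) (by
    intro x hx w hw
    rw [LinearMap.mem_ker] at hw ⊢
    rw [← hr' x hx, hw, map_zero])
  obtain ⟨Z, hZX, hZ⟩ := c.compl X hX (LinearMap.range r) (by
    rintro x hx _ ⟨v, rfl⟩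
    exact ⟨_, (hr' x hx v).symm⟩)
  have ex : ∀ v, ∃ y, y ∈ Y ∧ v - r y ∈ Z := by
    intro v
    have hv : v ∈ LinearMap.range r ⊔ Z := by rw [hZ.sup_eq_top]; trivial
    obtain ⟨_, ⟨u, rfl⟩, z, hz, rfl⟩ := Submodule.mem_sup.mp hv
    have hu : u ∈ LinearMap.ker r ⊔ Y := by rw [hY.sup_eq_top]; trivial
    obtain ⟨k, hk, y, hy, rfl⟩ := Submodule.mem_sup.mp hu
    rw [LinearMap.mem_ker] at hk
    refine ⟨y, hy, ?_⟩
    rw [map_add, hk]; simpa using hz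
  have uniq : ∀ y, y ∈ Y → r y ∈ Z → y = 0 := by
    intro y hy hz
    have h1 : r y ∈ LinearMap.range r ⊓ Z := ⟨⟨y, rfl⟩, hz⟩
    rw [hZ.inf_eq_bot, Submodule.mem_bot] at h1
    have h2 : y ∈ LinearMap.ker r ⊓ Y := ⟨h1, hy⟩
    rwa [hY.inf_eq_bot, Submodule.mem_bot] at h2
  choose f hf1 hf2 using ex
  have huniq : ∀ v y, y ∈ Y → v - r y ∈ Z → f v = y := by
    intro v y hy hz
    rw [← sub_eq_zero]
    apply uniq _ (Y.sub_mem (hf1 v) hy)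
    have := Z.sub_mem hz (hf2 v)
    rw [map_sub]
    have e : v - r y - (v - r (f v)) = r (f v) - r y := by abel
    rwa [e] at this
  let r' : End D V :=
    { toFun := f
      map_add' := fun a b => huniq _ _ (Y.add_mem (hf1 a) (hf1 b)) (by
        have := Z.add_mem (hf2 a) (hf2 b)
        rw [map_add]
        have e : a - r (f a) + (b - r (f b)) = a + b - (r (f a) + r (f b)) := by abel
        rwa [e] at this)
      map_smul' := fun k a => huniq _ _ (Y.smul_mem k (hf1 a)) (by
        have := Z.smul_mem k (hf2 a)
        rwa [smul_sub, ← map_smul] at this) }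
  refine ⟨r', ?_, ?_⟩
  · rw [mem_CX]
    intro x hx
    ext v
    show (x : End D V) (f v) = f ((x : End D V) v)
    symm
    apply huniq _ _ (hYX x hx _ (hf1 v))
    have := hZX x hx _ (hf2 v)
    rwa [map_sub, hr' x hx] at this
  · ext v
    show r (f (r v)) = r v
    have h1 : r v - r (f (r v)) ∈ LinearMap.range r ⊓ Z := ⟨⟨v - f (r v), by simp⟩, hf2 _⟩
    rw [hZ.inf_eq_bot, Submodule.mem_bot] at h1
    exact (sub_eq_zero.mp h1).symm

theorem Ctx.CX_reduced [Module.Finite D V] (c : Ctx G M) (X : Subgroup (End D V)ˣ) (hX : MN M X) (hnc : ¬ Cen X)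
    (hE : ¬ EE D V ≤ X) (u : End D V) (hu : u ∈ CX X) (h0 : u * u = 0) : u = 0 := by
  obtain ⟨v, hv, h1⟩ := c.regular X hX u hu
  obtain ⟨w, hw, hww, h1, h2⟩ := sl2_pair u v h0 h1
  have hw : w ∈ CX X := (Subring.closure_le.mpr (by
    rintro x (rfl | rfl)
    · exact hu
    · exact hv) : Subring.closure {u, v} ≤ CX X) hw
  obtain ⟨a, b, d, hab, hd⟩ := exists_K (V := V) c.hF
  have mem : ∀ (t : End D V) (ht : t * t = 0), t ∈ CX X → ∀ k : Subring.center (End D V),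
      xu t ht k ∈ Subgroup.normalizer (X : Set (End D V)ˣ) := by
    intro t ht htX k
    apply CX_unit_normalizer
    rw [xu_val]
    exact Subring.add_mem _ (Subring.one_mem _) (Subring.mul_mem _ (center_le_CX k.2) htX)
  exact no_sl2 _ (c.A' X hX hnc hE) u w h0 hww h1 h2 a b d hab hd (mem u h0 hu) (mem w hww hw)

theorem Ctx.idem_comm [Module.Finite D V] (c : Ctx G M) (X : Subgroup (End D V)ˣ) (hX : MN M X) (hnc : ¬ Cen X)
    (hE : ¬ EE D V ≤ X) (e : End D V) (he : e ∈ CX X) (hee : e * e = e) (r : End D V) (hr : r ∈ CX X) :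
    e * r = r * e := by
  have hmul := fun {a b} => (CX X).mul_mem (x := a) (y := b)
  have h1 : e * r - e * r * e = 0 := by
    apply c.CX_reduced X hX hnc hE
    · exact Subring.sub_mem _ (hmul he hr) (hmul (hmul he hr) he)
    · calc (e * r - e * r * e) * (e * r - e * r * e)
          = e * r * e * r - e * r * e * r * e - e * r * (e * e) * r + e * r * (e * e) * r * e := by noncomm_ring
        _ = 0 := by rw [hee]; noncomm_ring
  have h2 : r * e - e * r * e = 0 := by
    apply c.CX_reduced X hX hnc hE
    · exact Subring.sub_mem _ (hmul hr he) (hmul (hmul he hr) he)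
    · calc (r * e - e * r * e) * (r * e - e * r * e)
          = r * e * r * e - r * (e * e) * r * e - e * r * e * r * e + e * r * (e * e) * r * e := by noncomm_ring
        _ = 0 := by rw [hee]; noncomm_ring
  rw [sub_eq_zero.mp h1, ← sub_eq_zero.mp h2]

end Transv
end SMA

set_option linter.all false
namespace SMA
open scoped commutatorElement
open Module

theorem closure_comm {Γ : Type*} [Group Γ] {T : Set Γ} (h : ∀ x ∈ T, ∀ y ∈ T, x * y = y * x) :
    ∀ x ∈ Subgroup.closure T, ∀ y ∈ Subgroup.closure T, x * y = y * x := by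
  have h1 : Subgroup.closure T ≤ Subgroup.centralizer T := by
    rw [Subgroup.closure_le]
    intro x hx
    rw [SetLike.mem_coe, Subgroup.mem_centralizer_iff]
    intro y hy; exact h y hy x hx
  intro x hx y hy
  have h2 : Subgroup.closure T ≤ Subgroup.centralizer {x} := by
    rw [Subgroup.closure_le]
    intro t ht
    rw [SetLike.mem_coe, Subgroup.mem_centralizer_iff]
    rintro _ rfl
    exact (Subgroup.mem_centralizer_iff.mp (h1 hx) t ht).symm
  exact Subgroup.mem_centralizer_iff.mp (h2 hy) x rfl

theorem solvable_of_comm' {Γ : Type*} [Group Γ] {X : Subgroup Γ} (h : ∀ x ∈ X, ∀ y ∈ X, x * y = y * x) :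
    Group.IsSolvable X :=
  Group.isSolvable_of_comm fun x y => Subtype.ext (h x x.2 y y.2)

theorem MN_closure {R : Type*} [Ring R] {M : Subgroup Rˣ} {T : Set Rˣ}
    (h : ∀ m ∈ M, ∀ x ∈ T, m * x * m⁻¹ ∈ Subgroup.closure T) : MN M (Subgroup.closure T) := by
  intro m hm x hx
  have : Subgroup.closure T ≤ (Subgroup.closure T).comap (MulAut.conj m).toMonoidHom := by
    rw [Subgroup.closure_le]
    intro t ht
    exact h m hm t ht
  exact this hx

theorem mem_CX_closure {R : Type*} [Ring R] {T : Set Rˣ} {c : R} (h : ∀ x ∈ T, (x : R) * c = c * x) :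
    c ∈ CX (Subgroup.closure T) := by
  rw [mem_CX]
  intro x hx
  induction hx using Subgroup.closure_induction with
  | mem x hx => exact h x hx
  | one => simp
  | mul x y _ _ hx hy => rw [Units.val_mul, mul_assoc, hy, ← mul_assoc, hx, mul_assoc]
  | inv x _ hx =>
    have := congrArg (fun t => ((x⁻¹ : Rˣ) : R) * t * ((x⁻¹ : Rˣ) : R)) hx
    simp [mul_assoc] at this
    simpa using this.symm

theorem idem_unit {R : Type*} [Ring R] (a b : R) (ha : a ∈ Subring.center R) (hb : b ∈ Subring.center R)
    (hab : a * b = 1) (e : R) (he : e * e = e) : ∃ u : Rˣ, (u : R) = 1 + (a - 1) * e := by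
  have ce : e * b = b * e := Subring.mem_center_iff.mp hb e
  have cae : e * a = a * e := Subring.mem_center_iff.mp ha e
  have hba : b * a = 1 := by rw [← hab]; exact (Subring.mem_center_iff.mp ha b)
  refine ⟨⟨1 + (a - 1) * e, 1 + (b - 1) * e, ?_, ?_⟩, rfl⟩
  · calc (1 + (a - 1) * e) * (1 + (b - 1) * e)
        = 1 + (a-1) * e + (b-1)*e + (a-1) * (e * b) * e - (a-1) * (e * e) := by noncomm_ring
      _ = 1 + (a-1) * e + (b-1)*e + (a * b) * (e * e) - b * (e * e) - (a-1) * (e * e) := by rw [ce]; noncomm_ring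
      _ = 1 := by rw [he, hab]; noncomm_ring
  · calc (1 + (b - 1) * e) * (1 + (a - 1) * e)
        = 1 + (a-1) * e + (b-1)*e + (b-1) * (e * a) * e - (b-1) * (e * e) := by noncomm_ring
      _ = 1 + (a-1) * e + (b-1)*e + (b * a) * (e * e) - a * (e * e) - (b-1) * (e * e) := by rw [cae]; noncomm_ring
      _ = 1 := by rw [he, hba]; noncomm_ring

section Transv
variable {D V : Type*} [DivisionRing D] [AddCommGroup V] [Module D V] {G M : Subgroup (End D V)ˣ}

theorem Ctx.no_idem [Module.Finite D V] (c : Ctx G M) (X : Subgroup (End D V)ˣ) (hX : MN M X) (hnc : ¬ Cen X)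
    (hE : ¬ EE D V ≤ X) (e : End D V) (he : e ∈ CX X) (hee : e * e = e) : e = 0 ∨ e = 1 := by
  by_contra hcon
  push Not at hcon
  obtain ⟨he0, he1⟩ := hcon
  obtain ⟨⟨a, ha⟩, ⟨b, hb⟩, ⟨d, hd⟩, hab, hdd⟩ := exists_K (V := V) c.hF
  replace hab : a * b = 1 := congrArg Subtype.val hab
  replace hdd : (a ^ 2 - 1) * d = 1 := congrArg Subtype.val hdd
  let T : Set (End D V)ˣ := {u | ∃ e ∈ CX X, e * e = e ∧ (u : End D V) = 1 + (a - 1) * e}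
  have hTc : ∀ x ∈ T, ∀ y ∈ T, x * y = y * x := by
    rintro x ⟨e, he, hee, hx⟩ y ⟨f, hf, hff, hy⟩
    apply Units.ext
    rw [Units.val_mul, Units.val_mul, hx, hy]
    have h1 := c.idem_comm X hX hnc hE e he hee f hf
    have h2 : e * a = a * e := Subring.mem_center_iff.mp ha e
    have h3 : f * a = a * f := Subring.mem_center_iff.mp ha f
    have h4 : (a - 1) * e * ((a - 1) * f) = (a - 1) * f * ((a - 1) * e) := by
      calc (a - 1) * e * ((a - 1) * f) = (a-1) * (e * a - e) * f := by noncomm_ring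
        _ = (a-1) * (a-1) * (e * f) := by rw [h2]; noncomm_ring
        _ = (a-1) * (a * f - f) * e := by rw [h1]; noncomm_ring
        _ = _ := by rw [← h3]; noncomm_ring
    have : (1 + (a - 1) * e) * (1 + (a - 1) * f) = 1 + (a - 1) * e + (a-1) * f + (a - 1) * e * ((a - 1) * f) := by
      noncomm_ring
    rw [this, h4]; noncomm_ring
  set X3 := Subgroup.closure T with hX3
  have hsol := solvable_of_comm' (closure_comm hTc)
  have hMN : MN M X3 := by
    apply MN_closure
    rintro m hm x ⟨e, he, hee, hx⟩
    apply Subgroup.subset_closure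
    refine ⟨(m : End D V) * e * ((m⁻¹ : (End D V)ˣ) : End D V), CX_conj hX he hm, ?_, ?_⟩
    · calc (m : End D V) * e * ((m⁻¹ : (End D V)ˣ) : End D V) * ((m : End D V) * e * ((m⁻¹ : (End D V)ˣ) : End D V))
          = (m : End D V) * (e * (((m⁻¹ : (End D V)ˣ) : End D V) * (m : End D V)) * e) * ((m⁻¹ : (End D V)ˣ) : End D V) := by
            simp only [mul_assoc]
        _ = _ := by rw [Units.inv_mul, mul_one, hee]
    · rw [Units.val_mul, Units.val_mul, hx]
      have h2 : (m : End D V) * a = a * m := Subring.mem_center_iff.mp ha m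
      calc (m : End D V) * (1 + (a - 1) * e) * ((m⁻¹ : (End D V)ˣ) : End D V)
          = (m : End D V) * ((m⁻¹ : (End D V)ˣ) : End D V) + ((m : End D V) * a - m) * e * ((m⁻¹ : (End D V)ˣ) : End D V) := by
            noncomm_ring
        _ = _ := by rw [Units.mul_inv, h2]; noncomm_ring
  have hnc3 : ¬ Cen X3 := by
    intro h
    obtain ⟨u, hu⟩ := idem_unit a b ha hb hab e hee
    have h1 := h u (Subgroup.subset_closure ⟨e, he, hee, hu⟩)
    rw [hu] at h1
    have h2 : (a - 1) * e ∈ Subring.center (End D V) := by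
      have := Subring.sub_mem _ h1 (Subring.one_mem _)
      simpa using this
    have h3 : e ∈ Subring.center (End D V) := by
      have h4 := Subring.mul_mem _ (Subring.mul_mem _ hd (Subring.add_mem _ ha (Subring.one_mem _))) h2
      have h5 : d * (a + 1) * ((a - 1) * e) = e := by
        calc d * (a + 1) * ((a - 1) * e) = d * (a ^ 2 - 1) * e := by noncomm_ring
          _ = (a ^ 2 - 1) * d * e := by rw [Subring.mem_center_iff.mp hd]
          _ = e := by rw [hdd, one_mul]
      rwa [h5] at h4
    obtain ⟨e', -, h6, h7⟩ := center_unit e h3 he0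
    apply he1
    calc e = e * (e * e') := by rw [h6, mul_one]
      _ = e * e * e' := by rw [mul_assoc]
      _ = 1 := by rw [hee, h6]
  have hN := c.A' X3 hMN hnc3 (c.E_not_le _ hsol)
  -- minimal idempotent
  obtain ⟨W, ⟨e0, h0C, h00, h0i, rfl⟩, hmin⟩ := (wellFounded_lt (α := Submodule D V)).has_min
    {W : Submodule D V | ∃ e ∈ CX X, e ≠ 0 ∧ e * e = e ∧ W = LinearMap.range e} ⟨_, e, he, he0, hee, rfl⟩
  have key : ∀ f ∈ CX X, f * f = f → f * e0 = 0 ∨ f * e0 = e0 := by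
    intro f hf hff
    by_cases h : f * e0 = 0
    · exact Or.inl h
    right
    have hcm := c.idem_comm X hX hnc hE f hf hff e0 h0C
    have hid : f * e0 * (f * e0) = f * e0 := by
      calc f * e0 * (f * e0) = f * (e0 * f) * e0 := by noncomm_ring
        _ = f * f * (e0 * e0) := by rw [← hcm]; noncomm_ring
        _ = _ := by rw [hff, h0i]
    have hle : LinearMap.range (f * e0) ≤ LinearMap.range e0 := by
      rw [hcm]; rintro _ ⟨x, rfl⟩; exact ⟨f x, rfl⟩
    have heq : LinearMap.range (f * e0) = LinearMap.range e0 := by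
      by_contra hne
      exact hmin _ ⟨f * e0, (CX X).mul_mem hf h0C, h, hid, rfl⟩ (lt_of_le_of_ne hle hne)
    ext v
    have : e0 v ∈ LinearMap.range (f * e0) := by rw [heq]; exact ⟨v, rfl⟩
    obtain ⟨w, hw⟩ := this
    rw [Module.End.mul_apply, ← hw, Module.End.mul_apply, ← Module.End.mul_apply, hff]
  obtain ⟨v0, hv0⟩ : ∃ v, e0 v ≠ 0 := by
    by_contra h; push Not at h; exact h00 (LinearMap.ext h)
  set v := e0 v0 with hv
  have hev : e0 v = v := by rw [hv, ← Module.End.mul_apply, h0i]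
  obtain ⟨φ', hφ'⟩ := dual_exists' (D := D) v hv0
  let φ : V →ₗ[D] D := φ'.comp e0
  have hφ : φ v = 1 := by show φ' (e0 v) = 1; rw [hev, hφ']
  refine c.DD _ hN φ v hφ ?_
  intro d
  apply CX_unit_normalizer
  apply mem_CX_closure
  rintro x ⟨f, hf, hff, hx⟩
  rw [hx]
  have hfd : f * (dl φ v hφ d : End D V) = (dl φ v hφ d : End D V) * f := by
    ext w
    have hcm := c.idem_comm X hX hnc hE f hf hff e0 h0C
    have e1 : φ (f w) = φ' ((f * e0) w) := by rw [hcm]; rfl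
    have e2 : f v = (f * e0) v := by rw [Module.End.mul_apply, hev]
    rw [Module.End.mul_apply, Module.End.mul_apply, dl_apply, dl_apply, map_add, map_smul, map_smul]
    rcases key f hf hff with h | h
    · rw [e1, e2, h]; simp
    · rw [e1, e2, h, hev]; rfl
  have hda := Subring.mem_center_iff.mp ha (dl φ v hφ d : End D V)
  set δ := (dl φ v hφ d : End D V)
  calc (1 + (a - 1) * f) * δ = δ + (a - 1) * (f * δ) := by noncomm_ring
    _ = δ + (a * δ - δ) * f := by rw [hfd]; noncomm_ring
    _ = δ * (1 + (a - 1) * f) := by rw [← hda]; noncomm_ring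

/-- The L-lemma. -/
theorem Ctx.CX_inv [Module.Finite D V] (c : Ctx G M) (X : Subgroup (End D V)ˣ) (hX : MN M X) (hnc : ¬ Cen X)
    (hE : ¬ EE D V ≤ X) (r : End D V) (hr : r ∈ CX X) (hr0 : r ≠ 0) :
    ∃ r' ∈ CX X, r * r' = 1 ∧ r' * r = 1 := by
  obtain ⟨r', hr', h⟩ := c.regular X hX r hr
  refine ⟨r', hr', ?_, ?_⟩
  · rcases c.no_idem X hX hnc hE (r * r') ((CX X).mul_mem hr hr') (by rw [← mul_assoc, h]) with h1 | h1
    · rw [h1, zero_mul] at h; exact absurd h.symm hr0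
    · exact h1
  · rcases c.no_idem X hX hnc hE (r' * r) ((CX X).mul_mem hr' hr) (by
      rw [mul_assoc, ← mul_assoc r, h]) with h1 | h1
    · rw [mul_assoc, h1, mul_zero] at h; exact absurd h.symm hr0
    · exact h1

/-- a division subring (in elementary terms) with solvable unit group is commutative -/
theorem comm_of_div {R : Type*} [Ring R] [Nontrivial R] (S : Subring R)
    (hinv : ∀ r ∈ S, r ≠ 0 → ∃ r' ∈ S, r * r' = 1 ∧ r' * r = 1)
    (f : R) (hf : f ∈ Subring.center R) (hfS : f ∈ S) (hf0 : f ≠ 0) (hf1 : f * f ≠ 1)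
    (hs : Group.IsSolvable Sˣ) : ∀ x ∈ S, ∀ y ∈ S, x * y = y * x := by
  letI : DivisionRing S := DivisionRing.ofIsUnitOrEqZero (by
    rintro ⟨r, hr⟩
    by_cases h : r = 0
    · right; exact Subtype.ext h
    · left
      obtain ⟨r', hr', h1, h2⟩ := hinv r hr h
      exact ⟨⟨⟨r, hr⟩, ⟨r', hr'⟩, Subtype.ext h1, Subtype.ext h2⟩, rfl⟩)
  intro x hx y hy
  have := hua (D := S) ⟨f, hfS⟩ (Subring.mem_center_iff.mpr fun g =>
    Subtype.ext (Subring.mem_center_iff.mp hf g)) (fun h => hf0 (congrArg Subtype.val h))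
    (fun h => hf1 (congrArg Subtype.val h)) hs ⟨x, hx⟩ ⟨y, hy⟩
  exact congrArg Subtype.val this

theorem Ctx.nontriv (c : Ctx G M) : Nontrivial V := by
  obtain ⟨z, hz⟩ := c.h2 0
  refine ⟨z, 0, ?_⟩
  rintro rfl; exact hz (Submodule.zero_mem _)

theorem Ctx.exists_f [Module.Finite D V] (c : Ctx G M) : ∃ f ∈ Subring.center (End D V), f ≠ 0 ∧ f * f ≠ 1 := by
  haveI := c.nontriv
  obtain ⟨⟨a, ha⟩, ⟨b, hb⟩, ⟨d, hd⟩, hab, hdd⟩ := exists_K (V := V) c.hF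
  replace hab : a * b = 1 := congrArg Subtype.val hab
  replace hdd : (a ^ 2 - 1) * d = 1 := congrArg Subtype.val hdd
  refine ⟨a, ha, ?_, ?_⟩
  · rintro rfl; simp at hab
  · intro h; rw [pow_two, h] at hdd; simp at hdd

theorem Ctx.CX_comm [Module.Finite D V] (c : Ctx G M) (X : Subgroup (End D V)ˣ) (hX : MN M X) (hnc : ¬ Cen X)
    (hE : ¬ EE D V ≤ X) : ∀ x ∈ CX X, ∀ y ∈ CX X, x * y = y * x := by
  haveI := c.nontriv
  obtain ⟨f, hf, hf0, hf1⟩ := c.exists_f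
  exact comm_of_div _ (c.CX_inv X hX hnc hE) f hf (center_le_CX hf) hf0 hf1
    (solvable_units _ _ (c.A' X hX hnc hE) fun u hu _ => CX_unit_normalizer hu)

end Transv
end SMA

set_option linter.all false
namespace SMA
open scoped commutatorElement
open Module

theorem U_comm {S : Type*} [Ring S] [IsSimpleRing S] [IsArtinianRing S]
    (a b d : Subring.center S) (hab : a * b = 1) (hd : (a ^ 2 - 1) * d = 1)
    (hs : Group.IsSolvable Sˣ) (x y : S) : x * y = y * x := by
  obtain ⟨n, hn, D', _, ⟨e⟩⟩ := IsSimpleRing.exists_ringEquiv_matrix_divisionRing S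
  by_cases h1 : n = 1
  · subst h1
    let e' : S ≃+* D' := e.trans Matrix.uniqueRingEquiv
    have ha : (a : S) * b = 1 := congrArg Subtype.val hab
    have hdd : ((a : S) ^ 2 - 1) * d = 1 := congrArg Subtype.val hd
    have key := hua (e' a) (Subring.mem_center_iff.mpr fun g => by
      obtain ⟨g, rfl⟩ := e'.surjective g
      rw [← map_mul, Subring.mem_center_iff.mp a.2, map_mul]) (by
      intro h
      have := congrArg e' ha
      rw [map_mul, h, zero_mul, map_one] at this
      exact zero_ne_one this) (by
      intro h
      have := congrArg e' hdd
      rw [map_mul, map_sub, pow_two, map_mul, h, map_one, sub_self, zero_mul] at this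
      exact zero_ne_one this) (by
      haveI : Group.IsSolvable Sˣ := hs
      exact Group.isSolvable_of_isSolvable_injective (f := (Units.mapEquiv e'.symm.toMulEquiv).toMonoidHom)
        (Units.mapEquiv e'.symm.toMulEquiv).injective) (e' x) (e' y)
    rw [← map_mul, ← map_mul] at key
    exact e'.injective key
  · exfalso
    have h2 : 2 ≤ n := by have := NeZero.ne n; omega
    let i : Fin n := ⟨0, by omega⟩
    let j : Fin n := ⟨1, by omega⟩
    have hij : i ≠ j := by simp [i, j]
    let u : Matrix (Fin n) (Fin n) D' := Matrix.single i j 1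
    let v : Matrix (Fin n) (Fin n) D' := Matrix.single j i 1
    refine not_solvable_sl2 (K := Subring.center S) (e.symm u) (e.symm v) ?_ ?_ ?_ ?_ a b d hab hd ?_ hs
    · rw [← map_mul]; simp [u, hij.symm]
    · rw [← map_mul]; simp [v, hij]
    · rw [← map_mul, ← map_mul]; simp [u, v]
    · rw [← map_mul, ← map_mul]; simp [u, v]
    · intro h
      have : u = 0 := by simpa using h
      have := congrFun (congrFun this i) j
      simp [u] at this

/-- crossed data -/
structure CD {R : Type*} [Ring R] (L : Subring R) (P B : Subgroup Rˣ) : Prop where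
  comm : ∀ x ∈ L, ∀ y ∈ L, x * y = y * x
  inv : ∀ x ∈ L, x ≠ 0 → ∃ y ∈ L, x * y = 1 ∧ y * x = 1
  conj : ∀ b ∈ B, ∀ x ∈ L, (b : R) * x * ((b⁻¹ : Rˣ) : R) ∈ L
  pc : ∀ c ∈ P, ∀ x ∈ L, (c : R) * x = x * c
  pb : ∀ c ∈ P, ∀ b ∈ B, ((c * b * c⁻¹ * b⁻¹ : Rˣ) : R) ∈ L
  bb : ∀ c ∈ B, ∀ b ∈ B, ((c * b * c⁻¹ * b⁻¹ : Rˣ) : R) ∈ L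
  cen : ∀ b ∈ B, (∀ c ∈ P, c * b = b * c) → (b : R) ∈ L

section
variable {R : Type*} [Ring R] [Nontrivial R] {L : Subring R} {P B : Subgroup Rˣ}

theorem CD.inv_mem (h : CD L P B) (u : Rˣ) (hu : (u : R) ∈ L) : ((u⁻¹ : Rˣ) : R) ∈ L := by
  obtain ⟨y, hy, h1, h2⟩ := h.inv _ hu u.ne_zero
  have : ((u⁻¹ : Rˣ) : R) = y := by
    rw [← mul_one ((u⁻¹ : Rˣ) : R), ← h1, Units.inv_mul_cancel_left]
  rwa [this]

theorem CD.min_support (h : CD L P B) (I : AddSubgroup R) (hLI : ∀ l ∈ L, ∀ x ∈ I, l * x ∈ I)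
    (hPI : ∀ c ∈ P, ∀ x ∈ I, (c : R) * x * ((c⁻¹ : Rˣ) : R) ∈ I) (k : ℕ) :
    ∀ (t : Finset Rˣ), t.card ≤ k → t.Nonempty → (∀ b ∈ t, b ∈ B) →
      (∀ b ∈ t, ∀ b' ∈ t, b ≠ b' → ((b⁻¹ * b' : Rˣ) : R) ∉ L) →
      ∀ l : Rˣ → R, (∀ b ∈ t, l b ∈ L ∧ l b ≠ 0) → ∑ b ∈ t, l b * (b : R) ∈ I → ∃ b ∈ B, (b : R) ∈ I := by
  classical
  induction k with
  | zero =>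
    intro t ht hne
    rw [Nat.le_zero, Finset.card_eq_zero] at ht
    exact absurd ht hne.ne_empty
  | succ k ih =>
    intro t ht hne hB hine l hl hI
    obtain ⟨b, hb⟩ := hne
    by_cases hone : t = {b}
    · subst hone
      rw [Finset.sum_singleton] at hI
      obtain ⟨y, hy, -, h2⟩ := h.inv _ (hl b hb).1 (hl b hb).2
      refine ⟨b, hB b hb, ?_⟩
      have := hLI y hy _ hI
      rwa [← mul_assoc, h2, one_mul] at this
    · obtain ⟨b', hb', hne⟩ : ∃ b' ∈ t, b' ≠ b := by
        by_contra hcon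
        push Not at hcon
        exact hone (Finset.eq_singleton_iff_unique_mem.mpr ⟨hb, hcon⟩)
      obtain ⟨c, hc, hcb⟩ : ∃ c ∈ P, c * (b⁻¹ * b') ≠ b⁻¹ * b' * c := by
        by_contra hcon
        push Not at hcon
        exact hine b hb b' hb' hne.symm (h.cen _ (B.mul_mem (B.inv_mem (hB b hb)) (hB b' hb')) hcon)
      let χ : Rˣ → R := fun x => ((c * x * c⁻¹ * x⁻¹ : Rˣ) : R)
      have hχ : ∀ x ∈ B, χ x ∈ L := fun x hx => h.pb c hc x hx
      have hχne : χ b' - χ b ≠ 0 := by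
        intro h0
        rw [sub_eq_zero] at h0
        have h0 : c * b' * c⁻¹ * b'⁻¹ = c * b * c⁻¹ * b⁻¹ := Units.ext h0
        apply hcb
        have h1 : b' * c⁻¹ * b'⁻¹ = b * c⁻¹ * b⁻¹ := by
          have := congrArg (fun t => c⁻¹ * t) h0
          simpa [mul_assoc] using this
        have h2 := congrArg (fun t => c * b⁻¹ * t * b' * c) h1
        simp [mul_assoc] at h2
        simpa [mul_assoc] using h2
      let l' : Rˣ → R := fun x => l x * (χ x - χ b)
      have hI' : ∑ x ∈ t, l' x * (x : R) ∈ I := by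
        have e1 := hPI c hc _ hI
        have e2 := hLI _ (hχ b (hB b hb)) _ hI
        have e3 := I.sub_mem e1 e2
        rw [Finset.mul_sum, Finset.sum_mul, Finset.mul_sum, ← Finset.sum_sub_distrib] at e3
        convert e3 using 1
        apply Finset.sum_congr rfl
        intro x hx
        have hlx := (hl x hx).1
        have e4 := h.comm _ (hχ b (hB b hb)) _ hlx
        have e5 := h.pc c hc _ hlx
        have e6 : (c : R) * (l x * x) * ((c⁻¹ : Rˣ) : R) = l x * (χ x * x) := by
          have : χ x * x = (c : R) * x * ((c⁻¹ : Rˣ) : R) := by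
            simp [χ, mul_assoc]
          rw [this, ← mul_assoc, e5]; simp only [mul_assoc]
        rw [e6, ← mul_assoc (χ b), e4]
        simp only [l']
        noncomm_ring
      refine ih (t.filter fun x => l' x ≠ 0) ?_ ⟨b', ?_⟩ ?_ ?_ l' ?_ ?_
      · have : (t.filter fun x => l' x ≠ 0) ⊆ t.erase b := by
          intro x hx
          rw [Finset.mem_filter] at hx
          rw [Finset.mem_erase]
          refine ⟨?_, hx.1⟩
          rintro rfl
          apply hx.2; simp [l']
        have := Finset.card_le_card this
        rw [Finset.card_erase_of_mem hb] at this
        omega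
      · rw [Finset.mem_filter]
        refine ⟨hb', ?_⟩
        intro h0
        obtain ⟨y, hy, -, h2⟩ := h.inv _ (hl b' hb').1 (hl b' hb').2
        apply hχne
        have := congrArg (fun t => y * t) h0
        simpa [l', ← mul_assoc, h2] using this
      · intro x hx; exact hB x (Finset.mem_filter.mp hx).1
      · intro x hx y hy; exact hine x (Finset.mem_filter.mp hx).1 y (Finset.mem_filter.mp hy).1
      · intro x hx
        rw [Finset.mem_filter] at hx
        exact ⟨L.mul_mem (hl x hx.1).1 (L.sub_mem (hχ x (hB x hx.1)) (hχ b (hB b hb))), hx.2⟩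
      · have : ∑ x ∈ t.filter (fun x => l' x ≠ 0), l' x * (x : R) = ∑ x ∈ t, l' x * (x : R) := by
          rw [Finset.sum_filter]
          apply Finset.sum_congr rfl
          intro x _
          split_ifs with h0
          · rfl
          · push Not at h0; rw [h0, zero_mul]
        rw [this]; exact hI'

/-- subgroup `B ∩ L` of B -/
def CD.N (h : CD L P B) : Subgroup B where
  carrier := {b | ((b : Rˣ) : R) ∈ L}
  one_mem' := L.one_mem
  mul_mem' := fun {a b} ha hb => by
    show (((a * b : B) : Rˣ) : R) ∈ L
    rw [Subgroup.coe_mul, Units.val_mul]; exact L.mul_mem ha hb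
  inv_mem' := fun {a} ha => h.inv_mem _ ha

theorem CD.mem_N (h : CD L P B) (b : B) : b ∈ h.N ↔ ((b : Rˣ) : R) ∈ L := Iff.rfl

instance CD.N_normal (h : CD L P B) : h.N.Normal := ⟨by
  rintro ⟨n, hn⟩ hnL ⟨b, hb⟩
  exact h.conj b hb n hnL⟩

/-- the quotient group -/
abbrev CD.Γ (h : CD L P B) : Type _ := B ⧸ h.N

noncomputable instance CD.ΓComm (h : CD L P B) : CommGroup h.Γ :=
  { (inferInstance : Group (B ⧸ h.N)) with
    mul_comm := by
      intro x y
      induction x using QuotientGroup.induction_on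
      induction y using QuotientGroup.induction_on
      rename_i x y
      rw [← QuotientGroup.mk_mul, ← QuotientGroup.mk_mul, QuotientGroup.eq, CD.mem_N]
      have := h.bb _ (B.inv_mem y.2) _ (B.inv_mem x.2)
      simpa [mul_assoc] using this }

/-- section -/
noncomputable def CD.s (h : CD L P B) (γ : h.Γ) : Rˣ := ((Quotient.out γ : B) : Rˣ)

theorem CD.s_mem (h : CD L P B) (γ : h.Γ) : h.s γ ∈ B := (Quotient.out γ : B).2

theorem CD.mk_s (h : CD L P B) (γ : h.Γ) : ((⟨h.s γ, h.s_mem γ⟩ : B) : h.Γ) = γ := Quotient.out_eq γ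

theorem CD.mk_eq (h : CD L P B) (b b' : B) : (b : h.Γ) = b' ↔ (((b⁻¹ * b' : B) : Rˣ) : R) ∈ L := by
  rw [QuotientGroup.eq]; rfl

/-- `b = l * s[b]` -/
theorem CD.eq_s (h : CD L P B) (b : Rˣ) (hb : b ∈ B) : ∃ l ∈ L, (b : R) = l * h.s ((⟨b, hb⟩ : B) : h.Γ) := by
  have h1 := h.mk_s ((⟨b, hb⟩ : B) : h.Γ)
  rw [CD.mk_eq] at h1
  have h2 := h.conj _ (h.s_mem ((⟨b, hb⟩ : B) : h.Γ)) _ h1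
  refine ⟨_, h2, ?_⟩
  simp

theorem CD.s_ne (h : CD L P B) (γ γ' : h.Γ) (hne : h.s γ ≠ h.s γ') : (((h.s γ)⁻¹ * h.s γ' : Rˣ) : R) ∉ L := by
  intro hL
  apply hne
  have := (h.mk_eq ⟨_, h.s_mem γ⟩ ⟨_, h.s_mem γ'⟩).mpr hL
  rw [h.mk_s, h.mk_s] at this
  rw [this]

theorem CD.s_inj (h : CD L P B) : Function.Injective h.s := by
  intro x y hxy
  rw [← h.mk_s x, ← h.mk_s y]; congr 1; exact Subtype.ext hxy

theorem CD.exists_mem (h : CD L P B) (I : AddSubgroup R) (hLI : ∀ l ∈ L, ∀ x ∈ I, l * x ∈ I)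
    (hPI : ∀ c ∈ P, ∀ x ∈ I, (c : R) * x * ((c⁻¹ : Rˣ) : R) ∈ I) (f : h.Γ →₀ L) (hf : f ≠ 0)
    (hI : Finsupp.linearCombination L (fun γ => (h.s γ : R)) f ∈ I) : ∃ b ∈ B, (b : R) ∈ I := by
  classical
  refine h.min_support I hLI hPI _ (f.support.map ⟨h.s, h.s_inj⟩) le_rfl ?_ ?_ ?_
    (fun b => if hb : b ∈ B then f ((⟨b, hb⟩ : B) : h.Γ) else 0) ?_ ?_
  · simpa using Finsupp.support_nonempty_iff.mpr hf
  · intro b hb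
    obtain ⟨γ, -, rfl⟩ := Finset.mem_map.mp hb
    exact h.s_mem γ
  · intro b hb b' hb' hne
    obtain ⟨γ, -, rfl⟩ := Finset.mem_map.mp hb
    obtain ⟨γ', -, rfl⟩ := Finset.mem_map.mp hb'
    exact h.s_ne γ γ' hne
  · intro b hb
    obtain ⟨γ, hγ, rfl⟩ := Finset.mem_map.mp hb
    have := h.s_mem γ
    simp only [Function.Embedding.coeFn_mk, this, dif_pos, h.mk_s]
    refine ⟨(f γ).2, ?_⟩
    rw [Finsupp.mem_support_iff] at hγ
    intro h0; exact hγ (Subtype.ext h0)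
  · rw [Finset.sum_map]
    convert hI using 1
    rw [Finsupp.linearCombination_apply, Finsupp.sum]
    apply Finset.sum_congr rfl
    intro γ _
    have := h.s_mem γ
    simp only [Function.Embedding.coeFn_mk, this, dif_pos, h.mk_s]
    rfl

theorem CD.indep (h : CD L P B) : LinearIndependent L (fun γ : h.Γ => (h.s γ : R)) := by
  rw [linearIndependent_iff]
  intro f hf
  by_contra hne
  obtain ⟨b, -, hb⟩ := h.exists_mem ⊥ (by rintro l - x hx; rw [AddSubgroup.mem_bot] at hx ⊢; simp [hx])
    (by rintro l - x hx; rw [AddSubgroup.mem_bot] at hx ⊢; simp [hx]) f hne (by rw [hf]; exact AddSubgroup.zero_mem _)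
  exact b.ne_zero hb

/-- the subring generated by L and B -/
def SB (L : Subring R) (B : Subgroup Rˣ) : Subring R :=
  Subring.closure ((L : Set R) ∪ (fun b : Rˣ => (b : R)) '' (B : Set Rˣ))

theorem L_le_SB : L ≤ SB L B := fun x hx => Subring.subset_closure (Or.inl hx)
theorem B_le_SB {b : Rˣ} (hb : b ∈ B) : (b : R) ∈ SB L B := Subring.subset_closure (Or.inr ⟨b, hb, rfl⟩)

/-- span over a subring `A` of a subgroup normalising it is closed under multiplication -/
theorem mem_span_iff_SB (A : Subring R) (hconj : ∀ b ∈ B, ∀ x ∈ A, (b : R) * x * ((b⁻¹ : Rˣ) : R) ∈ A) (x : R) :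
    x ∈ SB A B ↔ x ∈ Submodule.span A ((fun b : Rˣ => (b : R)) '' (B : Set Rˣ)) := by
  set W := Submodule.span A ((fun b : Rˣ => (b : R)) '' (B : Set Rˣ)) with hW
  have hB : ∀ b ∈ B, (b : R) ∈ W := fun b hb => Submodule.subset_span ⟨b, hb, rfl⟩
  have hA : ∀ a ∈ A, ∀ x ∈ W, a * x ∈ W := fun a ha x hx => W.smul_mem (⟨a, ha⟩ : A) hx
  have hbW : ∀ b ∈ B, ∀ x ∈ W, (b : R) * x ∈ W := by
    intro b hb x hx
    induction hx using Submodule.span_induction with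
    | mem x hx =>
      obtain ⟨b', hb', rfl⟩ := hx
      have := hB _ (B.mul_mem hb hb')
      rwa [Units.val_mul] at this
    | zero => rw [mul_zero]; exact W.zero_mem
    | add x y _ _ hx hy => rw [mul_add]; exact W.add_mem hx hy
    | smul a x _ hx =>
      have : (b : R) * (a • x) = ((b : R) * a * ((b⁻¹ : Rˣ) : R)) * (b * x) := by
        show (b : R) * ((a : R) * x) = _
        simp [mul_assoc]
      rw [this]; exact hA _ (hconj b hb a a.2) _ hx
  have hmul : ∀ x ∈ W, ∀ y ∈ W, x * y ∈ W := by
    intro x hx y hy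
    induction hx using Submodule.span_induction with
    | mem x hx =>
      obtain ⟨b', hb', rfl⟩ := hx
      exact hbW b' hb' y hy
    | zero => rw [zero_mul]; exact W.zero_mem
    | add x x' _ _ hx hx' => rw [add_mul]; exact W.add_mem hx hx'
    | smul a x _ hx =>
      have : (a • x) * y = (a : R) * (x * y) := mul_assoc _ _ _
      rw [this]; exact hA a a.2 _ hx
  constructor
  · intro hx
    induction hx using Subring.closure_induction with
    | mem x hx =>
      rcases hx with hx | ⟨b, hb, rfl⟩
      · have := hA x hx _ (hB 1 B.one_mem)
        simpa using this
      · exact hB b hb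
    | zero => exact W.zero_mem
    | one => exact hB 1 B.one_mem
    | add x y _ _ hx hy => exact W.add_mem hx hy
    | neg x _ hx => exact W.neg_mem hx
    | mul x y _ _ hx hy => exact hmul x hx y hy
  · intro hx
    induction hx using Submodule.span_induction with
    | mem x hx =>
      obtain ⟨b', hb', rfl⟩ := hx
      exact B_le_SB hb'
    | zero => exact Subring.zero_mem _
    | add x y _ _ hx hy => exact Subring.add_mem _ hx hy
    | smul a x _ hx => exact Subring.mul_mem _ (L_le_SB a.2) hx

theorem CD.mem_SB (h : CD L P B) (x : R) :
    x ∈ SB L B ↔ ∃ f : h.Γ →₀ L, Finsupp.linearCombination L (fun γ => (h.s γ : R)) f = x := by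
  rw [mem_span_iff_SB L h.conj]
  have : Submodule.span L ((fun b : Rˣ => (b : R)) '' (B : Set Rˣ)) = Submodule.span L (Set.range fun γ => (h.s γ : R)) := by
    apply le_antisymm
    · rw [Submodule.span_le]
      rintro _ ⟨b, hb, rfl⟩
      obtain ⟨l, hl, h1⟩ := h.eq_s b hb
      rw [SetLike.mem_coe]
      show (b : R) ∈ _
      rw [h1]
      exact Submodule.smul_mem _ (⟨l, hl⟩ : L) (Submodule.subset_span ⟨_, rfl⟩)
    · rw [Submodule.span_le]
      rintro _ ⟨γ, rfl⟩
      exact Submodule.subset_span ⟨_, h.s_mem γ, rfl⟩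
  rw [this, Finsupp.mem_span_range_iff_exists_finsupp]
  simp only [Finsupp.linearCombination_apply]

end
end SMA

set_option linter.all false
namespace SMA
open scoped commutatorElement
open Module

section
variable {R : Type*} [Ring R] [Nontrivial R] {L : Subring R} {P B : Subgroup Rˣ}

/-- field structure on L -/
@[reducible] noncomputable def CD.field (h : CD L P B) : Field L :=
  IsField.toField
    { exists_pair_ne := ⟨0, 1, zero_ne_one⟩
      mul_comm := fun x y => Subtype.ext (h.comm x x.2 y y.2)
      mul_inv_cancel := fun {x} hx => by
        obtain ⟨y, hy, h1, -⟩ := h.inv x x.2 (fun h0 => hx (Subtype.ext h0))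
        exact ⟨⟨y, hy⟩, Subtype.ext h1⟩ }

theorem CD.simple (h : CD L P B) (hP : ∀ c ∈ P, (c : R) ∈ SB L B) (hP' : ∀ c ∈ P, ((c⁻¹ : Rˣ) : R) ∈ SB L B) :
    IsSimpleRing (SB L B) := by
  refine ⟨⟨fun J => ?_⟩⟩
  by_cases hJ : J = ⊥
  · exact Or.inl hJ
  right
  let I : AddSubgroup R :=
    { carrier := {x | ∃ y : SB L B, y ∈ J ∧ (y : R) = x}
      zero_mem' := ⟨0, J.zero_mem, rfl⟩
      add_mem' := by
        rintro _ _ ⟨x, hx, rfl⟩ ⟨y, hy, rfl⟩; exact ⟨x + y, J.add_mem hx hy, rfl⟩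
      neg_mem' := by
        rintro _ ⟨x, hx, rfl⟩; exact ⟨-x, J.neg_mem hx, rfl⟩ }
  obtain ⟨y, hyJ, hy0⟩ : ∃ y ∈ J, y ≠ 0 := by
    by_contra hcon
    push Not at hcon
    apply hJ
    rw [eq_bot_iff]
    intro x hx
    rw [TwoSidedIdeal.mem_bot]; exact hcon x hx
  obtain ⟨f, hf⟩ := (h.mem_SB y).mp y.2
  have hf0 : f ≠ 0 := by
    rintro rfl
    apply hy0; apply Subtype.ext; rw [← hf]; simp
  obtain ⟨b, hb, ⟨z, hz, hzb⟩⟩ := h.exists_mem I (by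
    rintro l hl _ ⟨x, hx, rfl⟩
    exact ⟨⟨l, L_le_SB hl⟩ * x, J.mul_mem_left _ _ hx, rfl⟩) (by
    rintro c hc _ ⟨x, hx, rfl⟩
    exact ⟨⟨c, hP c hc⟩ * x * ⟨_, hP' c hc⟩, J.mul_mem_right _ _ (J.mul_mem_left _ _ hx), rfl⟩) f hf0 ⟨y, hyJ, hf.symm⟩
  have h1 : (1 : SB L B) ∈ J := by
    have := J.mul_mem_left ⟨_, B_le_SB (B.inv_mem hb)⟩ _ hz
    convert this using 1
    apply Subtype.ext
    show (1 : R) = ((b⁻¹ : Rˣ) : R) * (z : R)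
    rw [hzb, Units.inv_mul]
  rw [eq_top_iff]
  intro x _
  have := J.mul_mem_left x _ h1
  rwa [mul_one] at this

theorem CD.artinian (h : CD L P B) [Finite h.Γ] : IsArtinianRing (SB L B) := by
  letI := h.field
  letI : Module L (SB L B) := Module.compHom _ (Subring.inclusion (L_le_SB : L ≤ SB L B))
  haveI : IsScalarTower L (SB L B) (SB L B) := ⟨fun x y z => mul_assoc _ _ _⟩
  let F : (h.Γ →₀ L) →ₗ[L] SB L B :=
    Finsupp.linearCombination L (fun γ => (⟨h.s γ, B_le_SB (h.s_mem γ)⟩ : SB L B))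
  haveI : Module.Finite L (SB L B) := by
    refine Module.Finite.of_surjective F ?_
    rintro ⟨x, hx⟩
    obtain ⟨f, hf⟩ := (h.mem_SB x).mp hx
    refine ⟨f, Subtype.ext ?_⟩
    refine Eq.trans ?_ hf
    simp only [F, Finsupp.linearCombination_apply, Finsupp.sum, AddSubmonoidClass.coe_finset_sum]
    rfl
  have h1 : IsArtinian L (SB L B) := inferInstance
  exact isArtinian_of_tower L h1

theorem CD.fin_comm (h : CD L P B) [Finite h.Γ] (hP : ∀ c ∈ P, (c : R) ∈ SB L B)
    (hF : Subring.center R ≤ L)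
    (a b d : Subring.center R) (hab : a * b = 1) (hd : (a ^ 2 - 1) * d = 1)
    (hs : Group.IsSolvable (SB L B)ˣ) : ∀ x ∈ SB L B, ∀ y ∈ SB L B, x * y = y * x := by
  haveI := h.simple hP (fun c hc => hP _ (P.inv_mem hc))
  haveI := h.artinian
  let i : Subring.center R → Subring.center (SB L B) := fun c =>
    ⟨⟨c, L_le_SB (hF c.2)⟩, Subring.mem_center_iff.mpr fun g => Subtype.ext (Subring.mem_center_iff.mp c.2 g)⟩
  have hab' : (a : R) * b = 1 := congrArg Subtype.val hab
  have hd' : ((a : R) ^ 2 - 1) * d = 1 := congrArg Subtype.val hd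
  intro x hx y hy
  have := U_comm (S := SB L B) (i a) (i b) (i d)
    (by apply Subtype.ext; apply Subtype.ext; exact hab')
    (by apply Subtype.ext; apply Subtype.ext; exact hd') hs ⟨x, hx⟩ ⟨y, hy⟩
  exact congrArg Subtype.val this

end
end SMA

set_option linter.all false
namespace SMA
open scoped commutatorElement
open Module

theorem uniqueProds_of_tf {Γ : Type*} [CommGroup Γ] (htf : ∀ (g : Γ) (n : ℕ), n ≠ 0 → g ^ n = 1 → g = 1) :
    UniqueProds Γ := by
  classical
  refine ⟨fun {A B} hA hB => ?_⟩
  let H : Subgroup Γ := Subgroup.closure ((A ∪ B : Finset Γ) : Set Γ)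
  have hAH : ∀ a ∈ A, a ∈ H := fun a ha => Subgroup.subset_closure (by simp [ha])
  have hBH : ∀ a ∈ B, a ∈ H := fun a ha => Subgroup.subset_closure (by simp [ha])
  haveI : Group.FG H := (Group.fg_iff_subgroup_fg H).mpr ⟨_, rfl⟩
  haveI : Monoid.FG H := Group.fg_iff_monoid_fg.mp inferInstance
  haveI : IsMulTorsionFree H := ⟨fun n hn a b hab => by
    have h1 : ((a : Γ) / b) ^ n = 1 := by
      have : (a : Γ) ^ n = (b : Γ) ^ n := congrArg Subtype.val hab
      rw [div_pow, this, div_self']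
    exact Subtype.ext (div_eq_one.mp (htf _ n hn h1))⟩
  have hu : UniqueProds H := inferInstance
  let A' : Finset H := A.attach.image fun a : A => (⟨a.1, hAH a.1 a.2⟩ : H)
  let B' : Finset H := B.attach.image fun a : B => (⟨a.1, hBH a.1 a.2⟩ : H)
  have memA : ∀ a (ha : a ∈ A), (⟨a, hAH a ha⟩ : H) ∈ A' := fun a ha =>
    Finset.mem_image.mpr ⟨⟨a, ha⟩, Finset.mem_attach _ _, rfl⟩
  have memB : ∀ a (ha : a ∈ B), (⟨a, hBH a ha⟩ : H) ∈ B' := fun a ha =>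
    Finset.mem_image.mpr ⟨⟨a, ha⟩, Finset.mem_attach _ _, rfl⟩
  obtain ⟨a, ha⟩ := hA
  obtain ⟨b, hb⟩ := hB
  obtain ⟨a0, ha0, b0, hb0, h⟩ := hu.uniqueMul_of_nonempty (A := A') (B := B') ⟨_, memA a ha⟩ ⟨_, memB b hb⟩
  obtain ⟨⟨a1, ha1⟩, -, rfl⟩ := Finset.mem_image.mp ha0
  obtain ⟨⟨b1, hb1⟩, -, rfl⟩ := Finset.mem_image.mp hb0
  refine ⟨a1, ha1, b1, hb1, ?_⟩
  intro x y hx hy hxy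
  obtain ⟨h1, h2⟩ := h (memA x hx) (memB y hy) (Subtype.ext hxy)
  exact ⟨congrArg Subtype.val h1, congrArg Subtype.val h2⟩

open scoped Pointwise in
theorem growth {Γ : Type*} [CommGroup Γ] [DecidableEq Γ] (Y : Finset Γ) :
    ∃ X : Finset Γ, (X * Y).card < 2 * X.card := by
  by_contra hcon
  push Not at hcon
  let k := Fintype.card Y
  let X : ℕ → Finset Γ := fun m =>
    (Fintype.piFinset (fun _ : Y => Finset.range (m + 1))).image (fun e => ∏ y : Y, (y : Γ) ^ e y)
  have hsub : ∀ m, X m * Y ⊆ X (m + 1) := by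
    intro m z hz
    obtain ⟨x, hx, y, hy, rfl⟩ := Finset.mem_mul.mp hz
    obtain ⟨e, he, rfl⟩ := Finset.mem_image.mp hx
    rw [Fintype.mem_piFinset] at he
    refine Finset.mem_image.mpr ⟨fun i => e i + if i = ⟨y, hy⟩ then 1 else 0, ?_, ?_⟩
    · rw [Fintype.mem_piFinset]
      intro i
      have := he i
      rw [Finset.mem_range] at this ⊢
      split_ifs <;> omega
    · simp only [pow_add, Finset.prod_mul_distrib]
      congr 1
      rw [Finset.prod_eq_single ⟨y, hy⟩]
      · simp
      · intro b _ hb; simp [hb]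
      · simp
  have hlow : ∀ m, 2 ^ m ≤ (X m).card := by
    intro m
    induction m with
    | zero =>
      have : (X 0).Nonempty := Finset.Nonempty.image ⟨fun _ => 0, by simp⟩ _
      simpa using Finset.card_pos.mpr this
    | succ m ih =>
      have := (hcon (X m)).trans (Finset.card_le_card (hsub m))
      rw [pow_succ]; omega
  have hup : ∀ m, (X m).card ≤ (m + 1) ^ k := by
    intro m
    refine Finset.card_image_le.trans ?_
    rw [Fintype.card_piFinset]; simp [k]
  have ht := tendsto_pow_const_div_const_pow_of_one_lt k (r := (2 : ℝ)) (by norm_num)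
  have ht2 := (ht.eventually (gt_mem_nhds (show (0 : ℝ) < 1 / 2 by norm_num)))
  obtain ⟨n, hn, hn1⟩ := (ht2.and (Filter.eventually_ge_atTop 1)).exists
  obtain ⟨m, rfl⟩ : ∃ m, n = m + 1 := ⟨n - 1, by omega⟩
  have h1 := (hlow m).trans (hup m)
  have h2 : ((2 : ℝ)) ^ m ≤ ((m : ℝ) + 1) ^ k := by exact_mod_cast h1
  rw [div_lt_iff₀ (by positivity)] at hn
  push_cast at hn
  rw [pow_succ] at hn
  linarith

section
variable {R : Type*} [Ring R] [Nontrivial R] {L : Subring R} {P B : Subgroup Rˣ}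

theorem CD.mul_s (h : CD L P B) (α β : h.Γ) (l l' : L) :
    ∃ w : L, (l : R) * h.s α * ((l' : R) * h.s β) = w * h.s (α * β) ∧ (l ≠ 0 → l' ≠ 0 → w ≠ 0) := by
  obtain ⟨k, hk, hk2⟩ := h.eq_s _ (B.mul_mem (h.s_mem α) (h.s_mem β))
  have e : ((⟨h.s α * h.s β, B.mul_mem (h.s_mem α) (h.s_mem β)⟩ : B) : h.Γ) = α * β := by
    have : (⟨h.s α * h.s β, B.mul_mem (h.s_mem α) (h.s_mem β)⟩ : B)
      = ⟨h.s α, h.s_mem α⟩ * ⟨h.s β, h.s_mem β⟩ := rfl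
    rw [this, QuotientGroup.mk_mul, h.mk_s, h.mk_s]
  rw [e] at hk2
  have eq : (l : R) * h.s α * ((l' : R) * h.s β)
      = ((l : R) * ((h.s α : R) * (l' : R) * (((h.s α)⁻¹ : Rˣ) : R)) * k) * h.s (α * β) := by
    rw [mul_assoc (_ * _) k, ← hk2, Units.val_mul]
    simp [mul_assoc]
  refine ⟨⟨_, L.mul_mem (L.mul_mem l.2 (h.conj _ (h.s_mem α) _ l'.2)) hk⟩, eq, ?_⟩
  intro hl hl' h0
  have h0 : ((l : R) * ((h.s α : R) * (l' : R) * (((h.s α)⁻¹ : Rˣ) : R)) * k) = 0 := congrArg Subtype.val h0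
  rw [h0, zero_mul] at eq
  obtain ⟨y, hy, -, h1⟩ := h.inv l l.2 (fun h0 => hl (Subtype.ext h0))
  obtain ⟨y', hy', -, h1'⟩ := h.inv l' l'.2 (fun h0 => hl' (Subtype.ext h0))
  have e1 : ((h.s α : Rˣ) : R) * ((l' : R) * h.s β) = 0 := by
    have := congrArg (fun t => y * t) eq
    simpa [← mul_assoc, h1] using this
  have e2 : (l' : R) * h.s β = 0 := by
    have := congrArg (fun t => (((h.s α)⁻¹ : Rˣ) : R) * t) e1
    simpa using this
  have e3 : (l' : R) = 0 := by
    have := congrArg (fun t => t * (((h.s β)⁻¹ : Rˣ) : R)) e2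
    simpa using this
  exact hl' (Subtype.ext e3)

theorem CD.domain (h : CD L P B) [hu : UniqueProds h.Γ] (x y : R) (hx : x ∈ SB L B) (hy : y ∈ SB L B)
    (hxy : x * y = 0) : x = 0 ∨ y = 0 := by
  classical
  obtain ⟨f, hf⟩ := (h.mem_SB x).mp hx
  obtain ⟨g, hg⟩ := (h.mem_SB y).mp hy
  by_cases hf0 : f = 0
  · left; rw [← hf, hf0, map_zero]
  by_cases hg0 : g = 0
  · right; rw [← hg, hg0, map_zero]
  exfalso
  obtain ⟨α, hα, β, hβ, hun⟩ := hu.uniqueMul_of_nonempty (Finsupp.support_nonempty_iff.mpr hf0)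
    (Finsupp.support_nonempty_iff.mpr hg0)
  have H := fun a b => h.mul_s a b (f a) (g b)
  choose w hw hw0 using H
  let F : h.Γ →₀ L := ∑ a ∈ f.support, ∑ b ∈ g.support, Finsupp.single (a * b) (w a b)
  have hF : Finsupp.linearCombination L (fun γ => (h.s γ : R)) F = 0 := by
    rw [← hxy, ← hf, ← hg]
    simp only [F, map_sum, Finsupp.linearCombination_single]
    rw [Finsupp.linearCombination_apply, Finsupp.linearCombination_apply, Finsupp.sum, Finsupp.sum, Finset.sum_mul]
    apply Finset.sum_congr rfl
    intro a _
    rw [Finset.mul_sum]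
    apply Finset.sum_congr rfl
    intro b _
    exact (hw a b).symm
  have hF0 : F = 0 := linearIndependent_iff.mp h.indep F hF
  have hval : F (α * β) = w α β := by
    simp only [F, Finsupp.finset_sum_apply]
    rw [Finset.sum_eq_single α, Finset.sum_eq_single β]
    · simp
    · intro b hb hne
      rw [Finsupp.single_apply, if_neg]
      intro he; exact hne (hun hα hb he).2
    · intro hb; exact absurd hβ hb
    · intro a ha hne
      apply Finset.sum_eq_zero
      intro b hb
      rw [Finsupp.single_apply, if_neg]
      intro he; exact hne (hun ha hb he).1
    · intro hb; exact absurd hα hb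
  rw [hF0] at hval
  exact hw0 α β (Finsupp.mem_support_iff.mp hα) (Finsupp.mem_support_iff.mp hβ) hval.symm

open scoped Pointwise in
theorem CD.ore (h : CD L P B) (r t : R) (hr : r ∈ SB L B) (ht : t ∈ SB L B) :
    ∃ x ∈ SB L B, ∃ y ∈ SB L B, (x ≠ 0 ∨ y ≠ 0) ∧ x * r = y * t := by
  classical
  letI := h.field
  obtain ⟨f, hf⟩ := (h.mem_SB r).mp hr
  obtain ⟨g, hg⟩ := (h.mem_SB t).mp ht
  let Y := f.support ∪ g.support
  obtain ⟨X, hX⟩ := growth Y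
  let W : Finset h.Γ → Submodule L R := fun X => Submodule.span L (Set.range fun γ : X => (h.s (γ : h.Γ) : R))
  have hWr : ∀ X, finrank L (W X) = X.card := by
    intro X
    have := finrank_span_eq_card (h.indep.comp (Subtype.val : X → h.Γ) Subtype.val_injective)
    rw [Fintype.card_coe] at this
    exact this
  have hWf : ∀ X, Module.Finite L (W X) := fun X => Module.Finite.span_of_finite L (Set.finite_range _)
  have hmem : ∀ (Z : Finset h.Γ) (k : h.Γ →₀ L), k.support ⊆ Z →
      Finsupp.linearCombination L (fun γ => (h.s γ : R)) k ∈ W Z := by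
    intro Z k hk
    rw [Finsupp.linearCombination_apply]
    exact Submodule.sum_mem _ fun γ hγ => Submodule.smul_mem _ _ (Submodule.subset_span ⟨⟨γ, hk hγ⟩, rfl⟩)
  have hrW : r ∈ W Y := hf ▸ hmem Y f Finset.subset_union_left
  have htW : t ∈ W Y := hg ▸ hmem Y g Finset.subset_union_right
  have hWS : ∀ Z, ∀ x ∈ W Z, x ∈ SB L B := by
    intro Z x hx
    induction hx using Submodule.span_induction with
    | mem x hx =>
      obtain ⟨b', rfl⟩ := hx
      exact B_le_SB (h.s_mem _)
    | zero => exact Subring.zero_mem _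
    | add x y _ _ hx hy => exact Subring.add_mem _ hx hy
    | smul a x _ hx => exact Subring.mul_mem _ (L_le_SB a.2) hx
  have hmul : ∀ x ∈ W X, ∀ y ∈ W Y, x * y ∈ W (X * Y) := by
    intro x hx y hy
    induction hx using Submodule.span_induction with
    | mem x hx =>
      obtain ⟨α, rfl⟩ := hx
      induction hy using Submodule.span_induction with
      | mem y hy =>
        obtain ⟨β, rfl⟩ := hy
        obtain ⟨w, hw, -⟩ := h.mul_s α β 1 1
        simp only [Subring.coe_one, one_mul] at hw
        show (h.s (α : h.Γ) : R) * h.s (β : h.Γ) ∈ _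
        rw [hw]
        exact Submodule.smul_mem _ w (Submodule.subset_span ⟨⟨α * β, Finset.mul_mem_mul α.2 β.2⟩, rfl⟩)
      | zero => rw [mul_zero]; exact Submodule.zero_mem _
      | add x y _ _ hx hy => rw [mul_add]; exact Submodule.add_mem _ hx hy
      | smul a x _ hx =>
        have : (h.s (α : h.Γ) : R) * (a • x)
            = ((h.s (α : h.Γ) : R) * a * (((h.s (α : h.Γ))⁻¹ : Rˣ) : R)) * (h.s (α : h.Γ) * x) := by
          show (h.s (α : h.Γ) : R) * ((a : R) * x) = _
          simp [mul_assoc]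
        show (h.s (α : h.Γ) : R) * (a • x) ∈ _
        rw [this]
        exact Submodule.smul_mem _ (⟨_, h.conj _ (h.s_mem _) _ a.2⟩ : L) hx
    | zero => rw [zero_mul]; exact Submodule.zero_mem _
    | add x y _ _ hx hy => rw [add_mul]; exact Submodule.add_mem _ hx hy
    | smul a x _ hx =>
      have : (a • x) * y = a • (x * y) := mul_assoc _ _ _
      rw [this]; exact Submodule.smul_mem _ a hx
  let T : (W X × W X) →ₗ[L] W (X * Y) :=
    { toFun := fun p => ⟨p.1 * r - p.2 * t, Submodule.sub_mem _ (hmul _ p.1.2 _ hrW) (hmul _ p.2.2 _ htW)⟩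
      map_add' := fun p q => Subtype.ext (by
        show ((p.1 : R) + q.1) * r - ((p.2 : R) + q.2) * t = ((p.1 : R) * r - p.2 * t) + (q.1 * r - q.2 * t)
        noncomm_ring)
      map_smul' := fun a p => Subtype.ext (by
        show ((a : R) * p.1) * r - ((a : R) * p.2) * t = (a : R) * ((p.1 : R) * r - p.2 * t)
        noncomm_ring) }
  haveI := hWf X
  haveI := hWf (X * Y)
  have hlt : finrank L (W (X * Y)) < finrank L (W X × W X) := by
    rw [Module.finrank_prod, hWr, hWr]; omega
  have hker := LinearMap.ker_ne_bot_of_finrank_lt (f := T) hlt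
  obtain ⟨⟨x, y⟩, hp, hp0⟩ := Submodule.exists_mem_ne_zero_of_ne_bot hker
  refine ⟨x, hWS _ _ x.2, y, hWS _ _ y.2, ?_, ?_⟩
  · by_contra hcon
    push Not at hcon
    apply hp0
    exact Prod.ext (Subtype.ext hcon.1) (Subtype.ext hcon.2)
  · have : (x : R) * r - y * t = 0 := congrArg Subtype.val (LinearMap.mem_ker.mp hp)
    exact sub_eq_zero.mp this

end
end SMA

set_option linter.all false
namespace SMA
open scoped commutatorElement
open Module

/-- units of a subring, as a subgroup -/
def uS {R : Type*} [Ring R] (S : Subring R) : Subgroup Rˣ where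
  carrier := {u | (u : R) ∈ S ∧ ((u⁻¹ : Rˣ) : R) ∈ S}
  one_mem' := by simp [S.one_mem]
  mul_mem' := by
    rintro a b ⟨ha, ha'⟩ ⟨hb, hb'⟩
    refine ⟨?_, ?_⟩
    · rw [Units.val_mul]; exact S.mul_mem ha hb
    · rw [mul_inv_rev, Units.val_mul]; exact S.mul_mem hb' ha'
  inv_mem' := by
    rintro a ⟨ha, ha'⟩
    exact ⟨ha', by simpa using ha⟩

theorem mem_uS {R : Type*} [Ring R] {S : Subring R} {u : Rˣ} :
    u ∈ uS S ↔ (u : R) ∈ S ∧ ((u⁻¹ : Rˣ) : R) ∈ S := Iff.rfl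

/-- M normalises S -/
def MS {R : Type*} [Ring R] (M : Subgroup Rˣ) (S : Subring R) : Prop :=
  ∀ m ∈ M, ∀ x ∈ S, (m : R) * x * ((m⁻¹ : Rˣ) : R) ∈ S

theorem MS.uS {R : Type*} [Ring R] {M : Subgroup Rˣ} {S : Subring R} (h : MS M S) : MN M (uS S) := by
  intro m hm x hx
  refine ⟨?_, ?_⟩
  · simpa using h m hm _ hx.1
  · simpa [mul_assoc] using h m hm _ hx.2

theorem MS.SB {R : Type*} [Ring R] [Nontrivial R] {M B : Subgroup Rˣ} {L : Subring R} (h : MS M L) (hB : MN M B) :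
    MS M (SB L B) := by
  intro m hm x hx
  induction hx using Subring.closure_induction with
  | mem x hx =>
    rcases hx with hx | ⟨b, hb, rfl⟩
    · exact L_le_SB (h m hm x hx)
    · have := B_le_SB (L := L) (hB m hm b hb)
      simpa using this
  | zero => simp [Subring.zero_mem]
  | one => simp [Subring.one_mem]
  | add x y _ _ hx hy =>
    rw [mul_add, add_mul]; exact Subring.add_mem _ hx hy
  | neg x _ hx =>
    rw [mul_neg, neg_mul]; exact Subring.neg_mem _ hx
  | mul x y _ _ hx hy =>
    have := Subring.mul_mem _ hx hy
    simpa [mul_assoc] using this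

section Transv
variable {D V : Type*} [DivisionRing D] [AddCommGroup V] [Module D V] {G M : Subgroup (End D V)ˣ}

theorem Ctx.sub_E [Module.Finite D V] (c : Ctx G M) (S : Subring (End D V)) (hne : S ≠ ⊤) : ¬ EE D V ≤ uS S :=
  fun h => hne (T5 c.h2 S fun e he => (h he).1)

theorem Ctx.sub_le [Module.Finite D V] (c : Ctx G M) (S : Subring (End D V)) (hM : MS M S) (hne : S ≠ ⊤)
    (u : (End D V)ˣ) (hu : u ∈ uS S) (hunc : (u : End D V) ∉ Subring.center (End D V)) : uS S ⊓ G ≤ M :=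
  le_trans (inf_le_inf_right _ Subgroup.le_normalizer)
    (c.A _ hM.uS (fun h => hunc (h u hu)) (c.sub_E S hne))

theorem Ctx.sub_solv [Module.Finite D V] (c : Ctx G M) (S : Subring (End D V)) (hM : MS M S) (hne : S ≠ ⊤)
    (u : (End D V)ˣ) (hu : u ∈ uS S) (hunc : (u : End D V) ∉ Subring.center (End D V)) : Group.IsSolvable (uS S) :=
  c.solv _ (c.sub_le S hM hne u hu hunc)

theorem solvable_of_uS {R : Type*} [Ring R] {S T : Subring R} (h : Group.IsSolvable (uS S)) (hTS : T ≤ S) :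
    Group.IsSolvable Tˣ :=
  solvable_units T _ h fun u hu hu' => ⟨hTS hu, hTS hu'⟩

theorem Ctx.tf [Module.Finite D V] (c : Ctx G M) {L : Subring (End D V)} {P B : Subgroup (End D V)ˣ}
    [Nontrivial (End D V)] (h : CD L P B) (hML : MS M L) (hMB : MN M B)
    (hP : ∀ x ∈ P, (x : End D V) ∈ SB L B) (hb : ∃ b ∈ B, (b : End D V) ∉ L)
    (hF : Subring.center (End D V) ≤ L)
    (htf : ∀ (g : h.Γ) (n : ℕ), n ≠ 0 → g ^ n = 1 → g = 1) : False := by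
  haveI := uniqueProds_of_tf htf
  set S := SB L B with hS
  have hMS : MS M S := hML.SB hMB
  have dom : ∀ x ∈ S, ∀ y ∈ S, x * y = 0 → x = 0 ∨ y = 0 := fun x hx y hy => h.domain x y hx hy
  have dom' : ∀ x ∈ S, ∀ y ∈ S, x ≠ 0 → y ≠ 0 → x * y ≠ 0 := fun x hx y hy h1 h2 h3 =>
    (dom x hx y hy h3).elim h1 h2
  -- Ore
  have ore : ∀ r ∈ S, ∀ t ∈ S, t ≠ 0 → ∃ x ∈ S, x ≠ 0 ∧ ∃ y ∈ S, x * r = y * t := by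
    intro r hr t ht ht0
    obtain ⟨x, hx, y, hy, hne, e⟩ := h.ore r t hr ht
    refine ⟨x, hx, ?_, y, hy, e⟩
    rintro rfl
    rw [zero_mul] at e
    rcases dom y hy t ht e.symm with h | h
    · simp [h] at hne
    · exact ht0 h
  have conj0 : ∀ m : (End D V)ˣ, ∀ r : End D V, r ≠ 0 → (m : End D V) * r * ((m⁻¹ : (End D V)ˣ) : End D V) ≠ 0 := by
    intro m r hr h0
    apply hr
    have := congrArg (fun t => ((m⁻¹ : (End D V)ˣ) : End D V) * t * (m : End D V)) h0
    simpa [mul_assoc] using this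
  let N : Submodule D V :=
    { carrier := {v | ∃ r ∈ S, r ≠ 0 ∧ r v = 0}
      zero_mem' := ⟨1, S.one_mem, one_ne_zero, by simp⟩
      add_mem' := by
        rintro v w ⟨r, hr, hr0, hv⟩ ⟨t, ht, ht0, hw⟩
        obtain ⟨x, hx, hx0, y, hy, e⟩ := ore r hr t ht ht0
        refine ⟨x * r, S.mul_mem hx hr, dom' x hx r hr hx0 hr0, ?_⟩
        rw [map_add, Module.End.mul_apply, hv, e, Module.End.mul_apply, hw]; simp
      smul_mem' := by
        rintro d v ⟨r, hr, hr0, hv⟩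
        exact ⟨r, hr, hr0, by rw [map_smul, hv, smul_zero]⟩ }
  have hNM : ∀ m ∈ M, ∀ w ∈ N, (m : End D V) w ∈ N := by
    rintro m hm w ⟨r, hr, hr0, hw⟩
    refine ⟨_, hMS m hm r hr, conj0 m r hr0, ?_⟩
    rw [Module.End.mul_apply, unit_inv_apply, Module.End.mul_apply, hw, map_zero]
  have hN : N = ⊥ := by
    by_contra hN0
    have htop := c.irred N hNM hN0
    -- common annihilator of finite sets
    classical
    have fin : ∀ t : Finset V, ∃ r ∈ S, r ≠ 0 ∧ ∀ v ∈ t, r v = 0 := by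
      intro t
      induction t using Finset.induction_on with
      | empty => exact ⟨1, S.one_mem, one_ne_zero, by simp⟩
      | insert a t _ ih =>
        obtain ⟨r, hr, hr0, hv⟩ := ih
        have : a ∈ N := by rw [htop]; trivial
        obtain ⟨q, hq, hq0, ha⟩ := this
        obtain ⟨x, hx, hx0, y, hy, e⟩ := ore r hr q hq hq0
        refine ⟨x * r, S.mul_mem hx hr, dom' x hx r hr hx0 hr0, ?_⟩
        intro v hvt
        rcases Finset.mem_insert.mp hvt with rfl | hvt
        · rw [e, Module.End.mul_apply, ha, map_zero]
        · rw [Module.End.mul_apply, hv v hvt, map_zero]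
    obtain ⟨t, ht⟩ := (Module.Finite.fg_top : (⊤ : Submodule D V).FG)
    obtain ⟨r, hr, hr0, hv⟩ := fin t
    apply hr0
    apply LinearMap.ext_on ht
    intro v hvt
    rw [hv v hvt]; rfl
  have unit : ∀ r ∈ S, r ≠ 0 → IsUnit r := by
    intro r hr hr0
    rw [LinearMap.isUnit_iff_ker_eq_bot, eq_bot_iff]
    intro v hv
    have : v ∈ N := ⟨r, hr, hr0, hv⟩
    rwa [hN] at this
  let Q : Subring (End D V) :=
    { carrier := {x | ∃ r ∈ S, r ≠ 0 ∧ r * x ∈ S}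
      zero_mem' := ⟨1, S.one_mem, one_ne_zero, by simp [S.zero_mem]⟩
      one_mem' := ⟨1, S.one_mem, one_ne_zero, by simp [S.one_mem]⟩
      add_mem' := by
        rintro v w ⟨r, hr, hr0, hv⟩ ⟨t, ht, ht0, hw⟩
        obtain ⟨x, hx, hx0, y, hy, e⟩ := ore r hr t ht ht0
        refine ⟨x * r, S.mul_mem hx hr, dom' x hx r hr hx0 hr0, ?_⟩
        rw [mul_add]
        refine S.add_mem ?_ ?_
        · rw [mul_assoc]; exact S.mul_mem hx hv
        · rw [e, mul_assoc]; exact S.mul_mem hy hw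
      neg_mem' := by
        rintro v ⟨r, hr, hr0, hv⟩
        exact ⟨r, hr, hr0, by rw [mul_neg]; exact S.neg_mem hv⟩
      mul_mem' := by
        rintro v w ⟨r, hr, hr0, hv⟩ ⟨t, ht, ht0, hw⟩
        obtain ⟨x, hx, hx0, y, hy, e⟩ := ore (r * v) hv t ht ht0
        refine ⟨x * r, S.mul_mem hx hr, dom' x hx r hr hx0 hr0, ?_⟩
        have : x * r * (v * w) = y * (t * w) := by
          calc x * r * (v * w) = x * (r * v) * w := by noncomm_ring
            _ = y * (t * w) := by rw [e]; noncomm_ring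
        rw [this]; exact S.mul_mem hy hw }
  have hSQ : S ≤ Q := fun x hx => ⟨1, S.one_mem, one_ne_zero, by simpa using hx⟩
  have hQinv : ∀ r ∈ Q, r ≠ 0 → ∃ r' ∈ Q, r * r' = 1 ∧ r' * r = 1 := by
    rintro x ⟨r, hr, hr0, hx⟩ hx0
    obtain ⟨ru, hru⟩ := unit r hr hr0
    have hu0 : r * x ≠ 0 := by
      intro h0
      apply hx0
      have := congrArg (fun t => ((ru⁻¹ : (End D V)ˣ) : End D V) * t) h0
      rw [← hru] at this
      simpa using this
    obtain ⟨u, hu⟩ := unit _ hx hu0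
    have ex : x = ((ru⁻¹ * u : (End D V)ˣ) : End D V) := by
      rw [Units.val_mul, hu, ← hru]; simp
    refine ⟨(((ru⁻¹ * u)⁻¹ : (End D V)ˣ) : End D V), ⟨r * x, hx, hu0, ?_⟩, ?_, ?_⟩
    · rw [← hu, ← Units.val_mul]; simpa [hru] using hr
    · rw [ex, Units.mul_inv]
    · rw [ex, Units.inv_mul]
  have hMQ : MS M Q := by
    rintro m hm x ⟨r, hr, hr0, hx⟩
    refine ⟨_, hMS m hm r hr, conj0 m r hr0, ?_⟩
    have := hMS m hm _ hx
    simpa [mul_assoc] using this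
  have hQne : Q ≠ ⊤ := by
    intro htop
    obtain ⟨φ₁, φ₂, v₁, v₂, h11, h12, h21, h22⟩ := exists_pair c.h2
    have hq0 : rk φ₁ v₂ ≠ 0 := by
      intro h0
      have := congrArg (fun g : End D V => φ₂ (g v₁)) h0
      simp [h11, h22] at this
    obtain ⟨r', -, h1, -⟩ := hQinv (rk φ₁ v₂) (by rw [htop]; trivial) hq0
    apply hq0
    calc rk φ₁ v₂ = rk φ₁ v₂ * rk φ₁ v₂ * r' := by rw [mul_assoc, h1, mul_one]
      _ = 0 := by rw [rk_mul_rk, h12]; simp [rk_zero_right]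
  obtain ⟨b, hbB, hbL⟩ := hb
  obtain ⟨p, hp, hpb⟩ : ∃ p ∈ P, p * b ≠ b * p := by
    by_contra hcon
    push Not at hcon
    exact hbL (h.cen b hbB hcon)
  have hbQ : b ∈ uS Q := ⟨hSQ (B_le_SB hbB), hSQ (B_le_SB (B.inv_mem hbB))⟩
  have hsol := c.sub_solv Q hMQ hQne b hbQ (fun hc => hbL (hF hc))
  obtain ⟨f, hf, hf0, hf1⟩ := c.exists_f
  have hcomm := comm_of_div Q hQinv f hf (hSQ (L_le_SB (hF hf))) hf0 hf1 (solvable_of_uS hsol le_rfl)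
  exact hpb (Units.ext (hcomm p (hSQ (hP p hp)) b hbQ.1))

end Transv
end SMA

set_option linter.all false
namespace SMA
open scoped commutatorElement
open Module

theorem exists_prime_torsion {Γ : Type*} [Group Γ] (h : ¬ ∀ (g : Γ) (n : ℕ), n ≠ 0 → g ^ n = 1 → g = 1) :
    ∃ (p : ℕ) (g : Γ), p.Prime ∧ g ≠ 1 ∧ g ^ p = 1 := by
  push Not at h
  obtain ⟨g, n, hn, hg, hg1⟩ := h
  have hfin : IsOfFinOrder g := isOfFinOrder_iff_pow_eq_one.mpr ⟨n, Nat.pos_of_ne_zero hn, hg⟩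
  have h1 : orderOf g ≠ 1 := fun h => hg1 (orderOf_eq_one_iff.mp h)
  obtain ⟨p, hp, hpd⟩ := Nat.exists_prime_and_dvd h1
  haveI := Fact.mk hp
  refine ⟨p, g ^ (orderOf g / p), hp, ?_, ?_⟩
  · intro h2
    have := orderOf_dvd_of_pow_eq_one h2
    have hpos := hfin.orderOf_pos
    have hlt : orderOf g / p < orderOf g := Nat.div_lt_self hpos hp.one_lt
    have hp0 : 0 < orderOf g / p := Nat.div_pos (Nat.le_of_dvd hpos hpd) hp.pos
    exact absurd (Nat.le_of_dvd hp0 this) (by omega)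
  · rw [← pow_mul, Nat.div_mul_cancel hpd, pow_orderOf_eq_one]

section
variable {R : Type*} [Ring R] [Nontrivial R] {L : Subring R} {P B B' : Subgroup Rˣ}

theorem CD.mono (h : CD L P B) (hB : B' ≤ B) : CD L P B' where
  comm := h.comm
  inv := h.inv
  conj := fun b hb => h.conj b (hB hb)
  pc := h.pc
  pb := fun c hc b hb => h.pb c hc b (hB hb)
  bb := fun c hc b hb => h.bb c (hB hc) b (hB hb)
  cen := fun b hb => h.cen b (hB hb)

/-- elements of B with p-th power in L -/
noncomputable def CD.Bp (h : CD L P B) (p : ℕ) : Subgroup Rˣ :=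
  (((powMonoidHom p : h.Γ →* h.Γ).ker).comap (QuotientGroup.mk' h.N)).map B.subtype

theorem CD.mem_Bp (h : CD L P B) (p : ℕ) (x : Rˣ) : x ∈ h.Bp p ↔ x ∈ B ∧ ((x ^ p : Rˣ) : R) ∈ L := by
  have key : ∀ y : B, y ∈ ((powMonoidHom p : h.Γ →* h.Γ).ker).comap (QuotientGroup.mk' h.N) ↔
      (((y : Rˣ) ^ p : Rˣ) : R) ∈ L := by
    intro y
    rw [Subgroup.mem_comap, MonoidHom.mem_ker]
    show ((y : h.Γ)) ^ p = 1 ↔ _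
    rw [← QuotientGroup.mk_pow, QuotientGroup.eq_one_iff, CD.mem_N]
    rfl
  constructor
  · rintro ⟨y, hy, rfl⟩
    exact ⟨y.2, (key y).mp hy⟩
  · rintro ⟨hx, hp⟩
    exact ⟨⟨x, hx⟩, (key ⟨x, hx⟩).mpr hp, rfl⟩

theorem CD.Bp_le (h : CD L P B) (p : ℕ) : h.Bp p ≤ B := fun x hx => ((h.mem_Bp p x).mp hx).1

theorem CD.Bp_MN (h : CD L P B) (p : ℕ) {M : Subgroup Rˣ} (hL : MS M L) (hB : MN M B) : MN M (h.Bp p) := by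
  intro m hm x hx
  rw [CD.mem_Bp] at hx ⊢
  refine ⟨hB m hm x hx.1, ?_⟩
  rw [conj_pow]
  simpa using hL m hm _ hx.2

theorem CD.exists_p (h : CD L P B) (htf : ¬ ∀ (g : h.Γ) (n : ℕ), n ≠ 0 → g ^ n = 1 → g = 1) :
    ∃ (p : ℕ) (b : Rˣ), p.Prime ∧ b ∈ h.Bp p ∧ (b : R) ∉ L := by
  obtain ⟨p, g, hp, hg1, hgp⟩ := exists_prime_torsion htf
  refine ⟨p, h.s g, hp, (h.mem_Bp p _).mpr ⟨h.s_mem g, ?_⟩, ?_⟩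
  · rw [← h.mk_s g, ← QuotientGroup.mk_pow, QuotientGroup.eq_one_iff, CD.mem_N] at hgp
    exact hgp
  · intro hL
    apply hg1
    rw [← h.mk_s g, QuotientGroup.eq_one_iff, CD.mem_N]; exact hL

/-- cyclic case -/
theorem CD.cyc_card {b : Rˣ} (h : CD L P (Subgroup.zpowers b)) {p : ℕ} (hp : p.Prime)
    (hbp : ((b ^ p : Rˣ) : R) ∈ L) (hb : (b : R) ∉ L) : Nat.card h.Γ = p := by
  let b' : Subgroup.zpowers b := ⟨b, Subgroup.mem_zpowers b⟩
  let g : h.Γ := (b' : h.Γ)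
  have hg : ∀ x : h.Γ, x ∈ Subgroup.zpowers g := by
    intro x
    induction x using QuotientGroup.induction_on
    rename_i x
    obtain ⟨k, hk⟩ := Subgroup.mem_zpowers_iff.mp x.2
    refine Subgroup.mem_zpowers_iff.mpr ⟨k, ?_⟩
    rw [← QuotientGroup.mk_zpow]
    congr 1
    exact Subtype.ext hk
  have hgp : g ^ p = 1 := by
    rw [← QuotientGroup.mk_pow, QuotientGroup.eq_one_iff, CD.mem_N]; exact hbp
  have hg1 : g ≠ 1 := by
    intro h1
    rw [QuotientGroup.eq_one_iff, CD.mem_N] at h1; exact hb h1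
  haveI := Fact.mk hp
  rw [← orderOf_eq_prime hgp hg1, ← Nat.card_zpowers, (Subgroup.eq_top_iff' _).mpr hg, Subgroup.card_top]

end

section Transv
variable {D V : Type*} [DivisionRing D] [AddCommGroup V] [Module D V] {G M : Subgroup (End D V)ˣ}

/-- dimension count: L[b] cannot be everything -/
theorem Ctx.dim [Module.Finite D V] (c : Ctx G M) {L : Subring (End D V)} {P : Subgroup (End D V)ˣ}
    [Nontrivial (End D V)] {b : (End D V)ˣ} (h : CD L P (Subgroup.zpowers b)) {p : ℕ} (hp : p.Prime)
    (hbp : ((b ^ p : (End D V)ˣ) : End D V) ∈ L) (hb : (b : End D V) ∉ L) : SB L (Subgroup.zpowers b) ≠ ⊤ := by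
  intro htop
  have hcard := h.cyc_card hp hbp hb
  letI := h.field
  let Bs : Basis h.Γ L (End D V) := Basis.mk h.indep (by
    intro x _
    obtain ⟨f, hf⟩ := (h.mem_SB x).mp (by rw [htop]; trivial)
    rw [← hf, Finsupp.linearCombination_apply]
    exact Submodule.sum_mem _ fun γ _ => Submodule.smul_mem _ _ (Submodule.subset_span ⟨γ, rfl⟩))
  have hd : finrank L (End D V) = p := by rw [Module.finrank_eq_nat_card_basis Bs, hcard]
  haveI := c.nontriv
  let bV := Module.finBasis D V
  let T : (End D V) ≃ₗ[L] (Fin (finrank D V) → V) :=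
    LinearEquiv.ofBijective
      { toFun := fun r i => r (bV i)
        map_add' := fun _ _ => rfl
        map_smul' := fun _ _ => rfl }
      ⟨fun r r' hr => bV.ext fun i => congrFun hr i, fun f => ⟨bV.constr ℕ f, funext fun i => by
        show (bV.constr ℕ f) (bV i) = f i
        rw [Basis.constr_basis]⟩⟩
  have hd2 : finrank L (End D V) = finrank D V * finrank L V := by
    rw [T.finrank_eq]
    by_cases hfin : Module.Finite L V
    · rw [Module.finrank_pi_fintype]; simp
    · exfalso
      apply hfin
      haveI : Module.Finite L (End D V) := Module.finite_of_finrank_pos (by rw [hd]; exact hp.pos)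
      have hpos : 0 < finrank D V := Module.finrank_pos
      exact Module.Finite.of_surjective
        ((LinearMap.proj (⟨0, hpos⟩ : Fin (finrank D V)) : (Fin (finrank D V) → V) →ₗ[L] V) ∘ₗ T.toLinearMap)
        (fun v => by
          obtain ⟨r, hr⟩ := T.surjective (fun _ => v)
          exact ⟨r, by simp [hr]⟩)
  have hn1 : finrank D V ≠ 1 := by
    intro h1
    obtain ⟨v, -, hv⟩ := finrank_eq_one_iff'.mp h1
    obtain ⟨z, hz⟩ := c.h2 v
    obtain ⟨a, ha⟩ := hv z
    exact hz (Submodule.mem_span_singleton.mpr ⟨a, ha⟩)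
  have hL1 : finrank L V = 1 := by
    rw [hd] at hd2
    rcases (Nat.dvd_prime hp).mp ⟨_, hd2⟩ with h1 | h1
    · exact absurd h1 hn1
    · rw [h1] at hd2
      have := hp.pos
      nlinarith
  obtain ⟨v, hv0, hv⟩ := finrank_eq_one_iff'.mp hL1
  obtain ⟨x, y, hxy⟩ := c.hnc
  apply hxy
  obtain ⟨l, hl⟩ := hv (x • v)
  obtain ⟨k, hk⟩ := hv (y • v)
  have el : ∀ (l : L) (w : V), l • w = (l : End D V) w := fun _ _ => rfl
  have e1 : (x * y) • v = (y * x) • v := by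
    rw [mul_smul, mul_smul, ← hk, ← hl, el, el, ← map_smul, ← map_smul, ← hk, ← hl, el, el,
      ← Module.End.mul_apply, ← Module.End.mul_apply, h.comm _ k.2 _ l.2]
  by_contra hne
  have : (x * y - y * x) • v = 0 := by rw [sub_smul, e1, sub_self]
  rcases smul_eq_zero.mp this with h0 | h0
  · exact hne (sub_eq_zero.mp h0)
  · exact hv0 h0

theorem Ctx.caseI [Module.Finite D V] (c : Ctx G M) (A : Subgroup (End D V)ˣ) (hA : MN M A) (hAc : ¬ Cen A)
    (hab : ∀ x ∈ A, ∀ y ∈ A, x * y = y * x) : ∀ x ∈ M, ∀ y ∈ M, x * y = y * x := by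
  haveI := c.nontriv
  have hAE : ¬ EE D V ≤ A := c.E_not_le _ (solvable_of_comm' hab)
  set L := CX A with hL
  have Lcomm := c.CX_comm A hA hAc hAE
  have Linv := c.CX_inv A hA hAc hAE
  have hML : MS M L := fun m hm x hx => CX_conj hA hx hm
  have hAL : ∀ a ∈ A, (a : End D V) ∈ L := fun a ha => mem_CX.mpr fun x hx => by
    rw [← Units.val_mul, hab x hx a ha, Units.val_mul]
  have hCL : ∀ r, (∀ x ∈ L, x * r = r * x) → r ∈ L := fun r hr => mem_CX.mpr fun x hx => hr x (hAL x hx)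
  have hFL : Subring.center (End D V) ≤ L := fun x hx => center_le_CX hx
  by_cases hMK : M ≤ uS L
  · intro x hx y hy
    exact Units.ext (Lcomm x (hMK hx).1 y (hMK hy).1)
  exfalso
  obtain ⟨B, hBM, hMB, hBK, hBB⟩ := exists_derived M (uS L) c.hsol hMK
  have h : CD L (uS L) B :=
    { comm := Lcomm
      inv := Linv
      conj := fun b hb x hx => hML b (hBM hb) x hx
      pc := fun x hx y hy => Lcomm x hx.1 y hy
      pb := fun x hx b hb => by
        have h1 := hML b (hBM hb) _ hx.2
        have := L.mul_mem hx.1 h1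
        simpa [mul_assoc] using this
      bb := fun x hx y hy => (hBB x hx y hy).1
      cen := fun b hb hbc => by
        apply hCL
        intro x hx
        by_cases hx0 : x = 0
        · simp [hx0]
        obtain ⟨y, hy, h1, h2⟩ := Linv x hx hx0
        have := hbc ⟨x, y, h1, h2⟩ ⟨hx, hy⟩
        exact congrArg Units.val this }
  have hbne : ∃ b ∈ B, (b : End D V) ∉ L := by
    by_contra hcon
    push Not at hcon
    exact hBK fun b hb => ⟨hcon b hb, hcon _ (B.inv_mem hb)⟩
  have hPS : ∀ B' : Subgroup (End D V)ˣ, ∀ x ∈ uS L, (x : End D V) ∈ SB L B' := fun B' x hx => L_le_SB hx.1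
  by_cases htf : ∀ (g : h.Γ) (n : ℕ), n ≠ 0 → g ^ n = 1 → g = 1
  · exact c.tf h hML hMB (hPS B) hbne hFL htf
  obtain ⟨p, b, hp, hbp, hbL⟩ := h.exists_p htf
  have hbp' := (h.mem_Bp p b).mp hbp
  have hzB : Subgroup.zpowers b ≤ h.Bp p := by rwa [Subgroup.zpowers_le]
  have h1 : CD L (uS L) (Subgroup.zpowers b) := h.mono (hzB.trans (h.Bp_le p))
  have hc1 := h1.cyc_card hp hbp'.2 hbL
  haveI : Finite h1.Γ := Nat.finite_of_card_ne_zero (by rw [hc1]; exact hp.ne_zero)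
  obtain ⟨a', b', d', hab', hd'⟩ := exists_K (V := V) c.hF
  have hbnc : (b : End D V) ∉ Subring.center (End D V) := fun hc => hbL (hFL hc)
  -- key contradiction
  have key : ¬ Group.IsSolvable (SB L (Subgroup.zpowers b))ˣ := by
    intro hs
    have hcm := h1.fin_comm (hPS _) hFL a' b' d' hab' hd' hs
    apply hbL
    apply hCL
    intro x hx
    exact hcm x (L_le_SB hx) b (B_le_SB (Subgroup.mem_zpowers b))
  have hB' : ∀ B' : Subgroup (End D V)ˣ, b ∈ B' → b ∈ uS (SB L B') := fun B' hb =>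
    ⟨B_le_SB hb, B_le_SB (B'.inv_mem hb)⟩
  by_cases hS : SB L (h.Bp p) = ⊤
  · have hmem : ∀ m ∈ M, ∃ b' ∈ h.Bp p, m⁻¹ * b' ∈ uS L := by
      intro m hm
      have h2 : CD L (uS L) (h.Bp p) := h.mono (h.Bp_le p)
      obtain ⟨f, hf⟩ := (h2.mem_SB (m : End D V)).mp (by rw [hS]; trivial)
      let I : AddSubgroup (End D V) :=
        { carrier := {r | ∀ x ∈ L, r * x = ((m : End D V) * x * ((m⁻¹ : (End D V)ˣ) : End D V)) * r}
          zero_mem' := by intro x _; simp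
          add_mem' := by
            intro r r' hr hr' x hx
            rw [add_mul, mul_add, hr x hx, hr' x hx]
          neg_mem' := by
            intro r hr x hx
            rw [neg_mul, mul_neg, hr x hx] }
      obtain ⟨b', hb', hbI⟩ := h2.exists_mem I (by
        intro l hl r hr x hx
        rw [mul_assoc, hr x hx, ← mul_assoc, Lcomm l hl _ (hML m hm x hx), mul_assoc]) (by
        intro u hu r hr x hx
        have e1 := Lcomm _ hu.2 x hx
        have e2 := Lcomm _ hu.1 _ (hML m hm x hx)
        calc (u : End D V) * r * ((u⁻¹ : (End D V)ˣ) : End D V) * x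
            = u * (r * x) * ((u⁻¹ : (End D V)ˣ) : End D V) := by rw [mul_assoc _ _ x, e1]; simp only [mul_assoc]
          _ = u * ((m : End D V) * x * ((m⁻¹ : (End D V)ˣ) : End D V)) * r * ((u⁻¹ : (End D V)ˣ) : End D V) := by
              rw [hr x hx]; simp only [mul_assoc]
          _ = _ := by rw [e2]; simp only [mul_assoc]) f (by
        rintro rfl
        rw [map_zero] at hf
        exact m.ne_zero hf.symm) (by
        rw [hf]
        intro x hx
        simp [mul_assoc])
      have hmb : ((m⁻¹ * b' : (End D V)ˣ) : End D V) ∈ L := by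
        apply hCL
        intro x hx
        have := congrArg (fun t => ((m⁻¹ : (End D V)ˣ) : End D V) * t) (hbI x hx)
        simp [mul_assoc] at this
        simpa [mul_assoc] using this.symm
      exact ⟨b', hb', hmb, h.inv_mem _ hmb⟩
    have hcom : ∀ m ∈ M, m * b * m⁻¹ * b⁻¹ ∈ uS L := by
      intro m hm
      obtain ⟨b', hb', hu⟩ := hmem m hm
      have hb'B := h.Bp_le p hb'
      set u := (m⁻¹ * b')⁻¹ with hu'
      have hu := (uS L).inv_mem hu
      have em : m = b' * u := by rw [hu']; group
      have g1 : u * (b * u⁻¹ * b⁻¹) ∈ uS L :=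
        (uS L).mul_mem hu (hML.uS b (hBM hbp'.1) _ ((uS L).inv_mem hu))
      have g2 := hML.uS b' (hBM hb'B) _ g1
      have g3 := (uS L).mul_mem g2 (hBB b' hb'B b hbp'.1)
      have : m * b * m⁻¹ * b⁻¹ = b' * (u * (b * u⁻¹ * b⁻¹)) * b'⁻¹ * (b' * b * b'⁻¹ * b⁻¹) := by
        rw [em]; group
      rw [this]; exact g3
    have hMS1 : MS M (SB L (Subgroup.zpowers b)) := by
      have hz : ∀ m ∈ M, ∀ x ∈ Subgroup.zpowers b, m * x * m⁻¹ ∈ uS (SB L (Subgroup.zpowers b)) := by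
        intro m hm x hx
        obtain ⟨k, rfl⟩ := Subgroup.mem_zpowers_iff.mp hx
        have e : m * b ^ k * m⁻¹ = ((m * b * m⁻¹ * b⁻¹) * b) ^ k := by
          rw [inv_mul_cancel_right, conj_zpow]
        rw [e]
        apply Subgroup.zpow_mem
        apply Subgroup.mul_mem
        · exact ⟨L_le_SB (hcom m hm).1, L_le_SB (hcom m hm).2⟩
        · exact hB' _ (Subgroup.mem_zpowers b)
      intro m hm x hx
      induction hx using Subring.closure_induction with
      | mem x hx =>
        rcases hx with hx | ⟨b, hb, rfl⟩
        · exact L_le_SB (hML m hm x hx)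
        · have := (hz m hm b hb).1
          simpa using this
      | zero => simp [Subring.zero_mem]
      | one => simp [Subring.one_mem]
      | add x y _ _ hx hy =>
        rw [mul_add, add_mul]; exact Subring.add_mem _ hx hy
      | neg x _ hx =>
        rw [mul_neg, neg_mul]; exact Subring.neg_mem _ hx
      | mul x y _ _ hx hy =>
        have := Subring.mul_mem _ hx hy
        simpa [mul_assoc] using this
    have hs := c.sub_solv _ hMS1 (c.dim h1 hp hbp'.2 hbL) b (hB' _ (Subgroup.mem_zpowers b)) hbnc
    exact key (solvable_of_uS hs le_rfl)
  · have hs := c.sub_solv _ (hML.SB (h.Bp_MN p hML hMB)) hS b (hB' _ hbp) hbnc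
    refine key (solvable_of_uS hs ?_)
    apply Subring.closure_mono
    apply Set.union_subset_union_right
    exact Set.image_mono hzB

end Transv
end SMA

set_option linter.all false
namespace SMA
open scoped commutatorElement
open Module

theorem cc {R : Type*} [Ring R] {u : Rˣ} (h : (u : R) ∈ Subring.center R) (x : Rˣ) : u * x = x * u :=
  Units.ext (by rw [Units.val_mul, Units.val_mul]; exact (Subring.mem_center_iff.mp h x).symm)

theorem cc' {R : Type*} [Ring R] {u : Rˣ} (h : (u : R) ∈ Subring.center R) (x : R) : (u : R) * x = x * u :=
  (Subring.mem_center_iff.mp h x).symm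

theorem mul_cen {R : Type*} [Ring R] {u v : Rˣ} (h : (u : R) ∈ Subring.center R) (h' : (v : R) ∈ Subring.center R) :
    ((u * v : Rˣ) : R) ∈ Subring.center R := by
  rw [Units.val_mul]; exact Subring.mul_mem _ h h'

theorem inv_cen {R : Type*} [Ring R] {u : Rˣ} (h : (u : R) ∈ Subring.center R) :
    ((u⁻¹ : Rˣ) : R) ∈ Subring.center R := by
  rw [Subring.mem_center_iff]
  intro x
  have := cc' h (((u⁻¹ : Rˣ) : R) * x * ((u⁻¹ : Rˣ) : R))
  simpa [mul_assoc] using this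

theorem pow_cen {R : Type*} [Ring R] {u : Rˣ} (h : (u : R) ∈ Subring.center R) (n : ℕ) :
    ((u ^ n : Rˣ) : R) ∈ Subring.center R := by
  rw [Units.val_pow_eq_pow_val]; exact Subring.pow_mem _ h n

theorem zpow_cen {R : Type*} [Ring R] {u : Rˣ} (h : (u : R) ∈ Subring.center R) (n : ℤ) :
    ((u ^ n : Rˣ) : R) ∈ Subring.center R := by
  cases n with
  | ofNat n => simpa using pow_cen h n
  | negSucc n => simpa using inv_cen (pow_cen h (n+1))

theorem one_cen {R : Type*} [Ring R] : ((1 : Rˣ) : R) ∈ Subring.center R := by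
  rw [Units.val_one]; exact Subring.one_mem _

theorem grp_pow {Γ : Type*} [Group Γ] (a b z : Γ) (ha : Commute z a) (hb : Commute z b) (h : b * a = z * a * b)
    (n : ℕ) : (a * b) ^ n = z ^ (n.choose 2) * (a ^ n * b ^ n) := by
  have h1 : ∀ n : ℕ, b ^ n * a = z ^ n * a * b ^ n := by
    intro n
    induction n with
    | zero => simp
    | succ n ih =>
      calc b ^ (n+1) * a = b ^ n * (b * a) := by rw [pow_succ, mul_assoc]
        _ = b ^ n * z * a * b := by rw [h]; simp only [mul_assoc]
        _ = z * b ^ n * a * b := by rw [(hb.pow_right n).eq]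
        _ = z * (b ^ n * a) * b := by simp only [mul_assoc]
        _ = z ^ (n+1) * a * b ^ (n+1) := by rw [ih, pow_succ' z, pow_succ b]; simp only [mul_assoc]
  induction n with
  | zero => simp
  | succ n ih =>
    calc (a * b) ^ (n+1) = z ^ (n.choose 2) * (a ^ n * (b ^ n * a) * b) := by
          rw [pow_succ, ih]; simp only [mul_assoc]
      _ = z ^ (n.choose 2) * ((a ^ n * z ^ n) * a * b ^ n * b) := by rw [h1]; simp only [mul_assoc]
      _ = z ^ (n.choose 2) * (z ^ n * a ^ n * a * b ^ n * b) := by rw [((ha.pow_left n).pow_right n).eq]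
      _ = z ^ (n.choose 2 + n) * (a ^ (n+1) * b ^ (n+1)) := by
          rw [pow_add, pow_succ a, pow_succ b]; simp only [mul_assoc]
      _ = _ := by rw [Nat.choose_succ_succ' n 1, Nat.choose_one_right, add_comm]

theorem dvd_choose (p : ℕ) (hp : p.Prime) : p ∣ (p ^ 2).choose 2 := by
  apply hp.dvd_choose_pow (by norm_num)
  intro h
  have := hp.two_le
  nlinarith

/-- The Case II data : A2 of exponent N with central commutators. -/
structure D2 {R : Type*} [Ring R] (M A : Subgroup Rˣ) (p : ℕ) : Prop where
  hp : p.Prime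
  le : A ≤ M
  mn : MN M A
  com : ∀ x ∈ A, ∀ y ∈ A, ((x * y * x⁻¹ * y⁻¹ : Rˣ) : R) ∈ Subring.center R
  pow : ∀ x ∈ A, ((x ^ p : Rˣ) : R) ∈ Subring.center R
  pow1 : ∀ x ∈ A, x ^ (p ^ 2) = 1
  p0 : (p : R) ≠ 0
  cen : CX A = Subring.center R
  nc : ∃ a ∈ A, ∃ b ∈ A, a * b ≠ b * a

theorem com_pow {R : Type*} [Ring R] {x y : Rˣ} (h : ((x * y * x⁻¹ * y⁻¹ : Rˣ) : R) ∈ Subring.center R) {p : ℕ}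
    (hx : ((y ^ p : Rˣ) : R) ∈ Subring.center R) : (x * y * x⁻¹ * y⁻¹) ^ p = 1 := by
  set z := x * y * x⁻¹ * y⁻¹ with hz
  have e : x * y * x⁻¹ = z * y := by rw [hz]; group
  have := congrArg (· ^ p) e
  simp only [conj_pow] at this
  rw [Commute.mul_pow (cc h y), ← cc hx x, mul_inv_cancel_right] at this
  exact mul_eq_right.mp this.symm

section Transv
variable {D V : Type*} [DivisionRing D] [AddCommGroup V] [Module D V] {G M : Subgroup (End D V)ˣ}

theorem Ctx.CX_eq [Module.Finite D V] (c : Ctx G M)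
    (hab : ∀ A : Subgroup (End D V)ˣ, MN M A → (∀ x ∈ A, ∀ y ∈ A, x * y = y * x) → Cen A)
    (A : Subgroup (End D V)ˣ) (hAM : A ≤ M) (hA : MN M A) (hc : ¬ Cen A) : CX A = Subring.center (End D V) := by
  have hE : ¬ EE D V ≤ A := c.E_not_le A (solvable_of_le hAM c.hsol)
  apply le_antisymm
  · intro x hx
    by_cases hx0 : x = 0
    · rw [hx0]; exact Subring.zero_mem _
    obtain ⟨y, hy, h1, h2⟩ := c.CX_inv A hA hc hE x hx hx0
    have hMS : MS M (CX A) := fun m hm x hx => CX_conj hA hx hm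
    exact hab (uS (CX A)) hMS.uS (fun x hx y hy => Units.ext (c.CX_comm A hA hc hE x hx.1 y hy.1)) ⟨x, y, h1, h2⟩ ⟨hx, hy⟩
  · intro x hx; exact center_le_CX hx

theorem MS_center {R : Type*} [Ring R] (M : Subgroup Rˣ) : MS M (Subring.center R) := by
  intro m hm x hx
  rw [Subring.mem_center_iff.mp hx m, Units.mul_inv_cancel_right]; exact hx

theorem Ctx.exD2 [Module.Finite D V] (c : Ctx G M)
    (hab : ∀ A : Subgroup (End D V)ˣ, MN M A → (∀ x ∈ A, ∀ y ∈ A, x * y = y * x) → Cen A)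
    (hM : ¬ ∀ x ∈ M, ∀ y ∈ M, x * y = y * x) : ∃ A p, D2 M A p := by
  haveI := c.nontriv
  have hMK : ¬ M ≤ uS (Subring.center (End D V)) := fun h => hM fun x hx y hy => cc (h hx).1 y
  obtain ⟨A, hAM, hMA, hAK, hAA⟩ := exists_derived M _ c.hsol hMK
  have hAc : ¬ Cen A := fun h => hAK fun a ha => ⟨h a ha, h _ (A.inv_mem ha)⟩
  have hCX := c.CX_eq hab A hAM hMA hAc
  have h : CD (Subring.center (End D V)) A A :=
    { comm := fun x hx y hy => (Subring.mem_center_iff.mp hx y).symm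
      inv := center_unit
      conj := fun b hb x hx => MS_center A b hb x hx
      pc := fun x hx y hy => Subring.mem_center_iff.mp hy x
      pb := fun x hx y hy => (hAA x hx y hy).1
      bb := fun x hx y hy => (hAA x hx y hy).1
      cen := fun b hb hbc => by
        rw [← hCX, mem_CX]
        intro x hx
        exact congrArg Units.val (hbc x hx) }
  have hne : ∃ b ∈ A, (b : End D V) ∉ Subring.center (End D V) := by
    by_contra hcon; push Not at hcon; exact hAc hcon
  by_cases htf : ∀ (g : h.Γ) (n : ℕ), n ≠ 0 → g ^ n = 1 → g = 1
  · exact (c.tf h (MS_center M) hMA (fun x hx => B_le_SB hx) hne le_rfl htf).elim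
  obtain ⟨p, a, hp, hap, haL⟩ := h.exists_p htf
  have hA1 : MN M (h.Bp p) := h.Bp_MN p (MS_center M) hMA
  set A1 := h.Bp p with hA1d
  have hA1A : A1 ≤ A := h.Bp_le p
  have hA1p : ∀ x ∈ A1, ((x ^ p : (End D V)ˣ) : End D V) ∈ Subring.center (End D V) := fun x hx =>
    ((h.mem_Bp p x).mp hx).2
  let T : Set (End D V)ˣ := {t | ∃ a ∈ A1, ∃ m ∈ M, t = a * (m * a * m⁻¹)⁻¹}
  set A2 := Subgroup.closure T with hA2
  have hA21 : A2 ≤ A1 := by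
    rw [hA2, Subgroup.closure_le]
    rintro _ ⟨a, ha, m, hm, rfl⟩
    exact A1.mul_mem ha (A1.inv_mem (hA1 m hm a ha))
  have hA2M : A2 ≤ M := (hA21.trans hA1A).trans hAM
  have hMN2 : MN M A2 := by
    apply MN_closure
    rintro k hk _ ⟨a, ha, m, hm, rfl⟩
    apply Subgroup.subset_closure
    refine ⟨k * a * k⁻¹, hA1 k hk a ha, k * m * k⁻¹, M.mul_mem (M.mul_mem hk hm) (M.inv_mem hk), by group⟩
  have hA2c : ¬ Cen A2 := by
    intro hc2
    let T' : Set (End D V)ˣ := {u | ((u * a⁻¹ : (End D V)ˣ) : End D V) ∈ Subring.center (End D V)}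
    have haT : a ∈ T' := by
      show ((a * a⁻¹ : (End D V)ˣ) : End D V) ∈ Subring.center (End D V)
      rw [mul_inv_cancel]; exact one_cen
    refine haL (hab (Subgroup.closure T') (MN_closure ?_) (closure_comm ?_) a (Subgroup.subset_closure haT))
    · intro m hm u hu
      apply Subgroup.subset_closure
      have h1 : ((a * (m * a * m⁻¹)⁻¹ : (End D V)ˣ) : End D V) ∈ Subring.center (End D V) :=
        hc2 _ (Subgroup.subset_closure ⟨a, hap, m, hm, rfl⟩)
      have e : m * u * m⁻¹ * a⁻¹ = (u * a⁻¹) * (a * (m * a * m⁻¹)⁻¹)⁻¹ := by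
        have := cc hu m
        calc m * u * m⁻¹ * a⁻¹ = (m * (u * a⁻¹)) * (a * m⁻¹ * a⁻¹) := by group
          _ = _ := by rw [← this]; group
      show ((m * u * m⁻¹ * a⁻¹ : (End D V)ˣ) : End D V) ∈ Subring.center (End D V)
      rw [e]; exact mul_cen hu (inv_cen h1)
    · intro x hx y hy
      have h1 := cc hx
      have h2 := cc hy
      calc x * y = (x * a⁻¹) * (a * (y * a⁻¹)) * a := by group
        _ = (x * a⁻¹) * (y * a⁻¹) * a * a := by rw [← h2]; group
        _ = (y * a⁻¹) * ((x * a⁻¹) * a) * a := by rw [h1]; group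
        _ = (y * a⁻¹) * (a * (x * a⁻¹)) * a := by rw [h1]
        _ = y * x := by group
  have hcom : ∀ x ∈ A, ∀ y ∈ A, ((x * y * x⁻¹ * y⁻¹ : (End D V)ˣ) : End D V) ∈ Subring.center (End D V) :=
    fun x hx y hy => (hAA x hx y hy).1
  have hmulp : ∀ x ∈ A1, ∀ y ∈ A1, (x * y) ^ (p ^ 2) = x ^ (p ^ 2) * y ^ (p ^ 2) := by
    intro x hx y hy
    have h1 := hcom y (hA1A hy) x (hA1A hx)
    rw [grp_pow x y (y * x * y⁻¹ * x⁻¹) (cc h1 x) (cc h1 y) (by group)]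
    obtain ⟨k, hk⟩ := dvd_choose p hp
    rw [hk, pow_mul, com_pow h1 (hA1p x hx), one_pow, one_mul]
  have hcen2 := c.CX_eq hab A2 hA2M hMN2 hA2c
  obtain ⟨x, hx, y, hy, hxy⟩ : ∃ a ∈ A2, ∃ b ∈ A2, a * b ≠ b * a := by
    by_contra hcon
    push Not at hcon
    exact hA2c (hab A2 hMN2 hcon)
  refine ⟨A2, p, hp, hA2M, hMN2, fun x hx y hy => hcom x (hA1A (hA21 hx)) y (hA1A (hA21 hy)),
    fun x hx => hA1p x (hA21 hx), ?_, ?_, hcen2, x, hx, y, hy, hxy⟩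
  · intro x hx
    have : x ∈ A1 ∧ x ^ (p ^ 2) = 1 := by
      induction hx using Subgroup.closure_induction with
      | mem x hx =>
        refine ⟨hA21 (Subgroup.subset_closure hx), ?_⟩
        obtain ⟨a, ha, m, hm, rfl⟩ := hx
        rw [hmulp a ha _ (A1.inv_mem (hA1 m hm a ha)), inv_pow, conj_pow]
        have h1 : ((a ^ (p ^ 2) : (End D V)ˣ) : End D V) ∈ Subring.center (End D V) := by
          rw [pow_two, pow_mul]; exact pow_cen (hA1p a ha) p
        rw [← cc h1 m]; group
      | one => exact ⟨A1.one_mem, one_pow _⟩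
      | mul x y _ _ hx hy => exact ⟨A1.mul_mem hx.1 hy.1, by rw [hmulp x hx.1 y hy.1, hx.2, hy.2, one_mul]⟩
      | inv x _ hx => exact ⟨A1.inv_mem hx.1, by rw [inv_pow, hx.2, inv_one]⟩
    exact this.2
  · intro hp0
    have h1 := hcom x (hA1A (hA21 hx)) y (hA1A (hA21 hy))
    have h2 := com_pow h1 (hA1p y (hA21 hy))
    set z := x * y * x⁻¹ * y⁻¹ with hz
    have hz1 : (z : End D V) - 1 ≠ 0 := by
      intro h0
      have : z = 1 := Units.ext (by rw [Units.val_one]; exact sub_eq_zero.mp h0)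
      apply hxy
      rw [hz, mul_inv_eq_one, mul_inv_eq_iff_eq_mul] at this
      exact this
    haveI : CharP (End D V) p := by
      refine ⟨fun n => ⟨fun hn => ?_, ?_⟩⟩
      · by_contra hnd
        have hcop : Nat.Coprime n p := ((Nat.Prime.coprime_iff_not_dvd hp).mpr hnd).symm
        have := Nat.gcd_eq_gcd_ab n p
        rw [hcop] at this
        have := congrArg (fun k : ℤ => (k : End D V)) this
        push_cast at this
        rw [hn, hp0] at this
        simp at this
      · rintro ⟨k, rfl⟩
        rw [Nat.cast_mul, hp0, zero_mul]
    haveI := Fact.mk hp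
    have e : ((z : End D V) - 1) ^ p = 0 := by
      rw [sub_pow_char_of_commute p (Commute.one_right _), one_pow, ← Units.val_pow_eq_pow_val, h2, Units.val_one, sub_self]
    obtain ⟨w, -, hw, -⟩ := center_unit _ (Subring.sub_mem _ h1 (Subring.one_mem _)) hz1
    have := (IsUnit.of_mul_eq_one w hw).pow p
    rw [e] at this
    exact not_isUnit_zero this

end Transv
end SMA

set_option linter.all false
namespace SMA
open scoped commutatorElement
open Module

theorem two_gen_form {R : Type*} [Ring R] {a b : Rˣ}
    (h : ((b * a * b⁻¹ * a⁻¹ : Rˣ) : R) ∈ Subring.center R) (x : Rˣ) (hx : x ∈ Subgroup.closure {a, b}) :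
    ∃ (z : Rˣ) (i j : ℤ), (z : R) ∈ Subring.center R ∧ x = z * a ^ i * b ^ j := by
  set w := b * a * b⁻¹ * a⁻¹ with hw
  have e : b * a * b⁻¹ = w * a := by rw [hw]; group
  have hb : ∀ i : ℤ, b * a ^ i = w ^ i * a ^ i * b := by
    intro i
    have := congrArg (· ^ i) e
    simp only [conj_zpow] at this
    rw [Commute.mul_zpow (cc h a)] at this
    rw [← this]; group
  have hb' : ∀ i : ℤ, b⁻¹ * a ^ i = w ^ (-i) * a ^ i * b⁻¹ := by
    intro i
    have h1 := cc (zpow_cen h i)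
    calc b⁻¹ * a ^ i = b⁻¹ * (w ^ (-i) * (w ^ i * a ^ i * b)) * b⁻¹ := by group
      _ = b⁻¹ * (w ^ (-i) * b) * a ^ i * b⁻¹ := by rw [← hb]; simp only [mul_assoc]
      _ = _ := by rw [cc (zpow_cen h (-i)) b]; group
  induction hx using Subgroup.closure_induction_left with
  | one => exact ⟨1, 0, 0, one_cen, by simp⟩
  | mul_left x hx y _ ih =>
    obtain ⟨z, i, j, hz, rfl⟩ := ih
    rcases hx with rfl | rfl
    · refine ⟨z, i + 1, j, hz, ?_⟩
      rw [add_comm, zpow_add, zpow_one, ← mul_assoc, ← mul_assoc, ← mul_assoc, cc hz x]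
    · refine ⟨z * w ^ i, i, j + 1, mul_cen hz (zpow_cen h i), ?_⟩
      calc x * (z * a ^ i * x ^ j) = x * z * a ^ i * x ^ j := by group
        _ = z * (x * a ^ i) * x ^ j := by rw [← cc hz x]; group
        _ = _ := by rw [hb]; group
  | inv_mul_cancel x hx y _ ih =>
    obtain ⟨z, i, j, hz, rfl⟩ := ih
    rcases hx with rfl | rfl
    · refine ⟨z, i - 1, j, hz, ?_⟩
      calc x⁻¹ * (z * x ^ i * b ^ j) = (x⁻¹ * z) * x ^ i * b ^ j := by group
        _ = _ := by rw [← cc hz]; group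
    · refine ⟨z * w ^ (-i), i, j - 1, mul_cen hz (zpow_cen h (-i)), ?_⟩
      calc x⁻¹ * (z * a ^ i * x ^ j) = x⁻¹ * z * a ^ i * x ^ j := by group
        _ = z * (x⁻¹ * a ^ i) * x ^ j := by rw [← cc hz]; group
        _ = _ := by rw [hb']; group

/-- if a^i commutes with b, a,b do not commute, then a^i is central -/
theorem zpow_cen_of_comm {R : Type*} [Ring R] {a b : Rˣ} {p : ℕ} (hp : p.Prime)
    (h : ((b * a * b⁻¹ * a⁻¹ : Rˣ) : R) ∈ Subring.center R) (hab : a * b ≠ b * a)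
    (ha : ((a ^ p : Rˣ) : R) ∈ Subring.center R) (i : ℤ) (hi : a ^ i * b = b * a ^ i) :
    ((a ^ i : Rˣ) : R) ∈ Subring.center R := by
  have hwp := com_pow h ha
  set w := b * a * b⁻¹ * a⁻¹ with hw
  have e : b * a * b⁻¹ = w * a := by rw [hw]; group
  have h1 := congrArg (· ^ i) e
  simp only [conj_zpow] at h1
  rw [Commute.mul_zpow (cc h a), ← hi, mul_inv_cancel_right] at h1
  have h2 : w ^ i = 1 := mul_eq_right.mp h1.symm
  have hw1 : w ≠ 1 := by
    intro hw1
    rw [hw, mul_inv_eq_one, mul_inv_eq_iff_eq_mul] at hw1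
    exact hab hw1.symm
  haveI := Fact.mk hp
  have ho := orderOf_eq_prime hwp hw1
  have := orderOf_dvd_iff_zpow_eq_one.mpr h2
  rw [ho] at this
  obtain ⟨k, rfl⟩ := this
  rw [zpow_mul]
  exact zpow_cen (by simpa using ha) k

section Transv
variable {D V : Type*} [DivisionRing D] [AddCommGroup V] [Module D V] {G M : Subgroup (End D V)ˣ}

theorem D2.top [Module.Finite D V] (c : Ctx G M) {A : Subgroup (End D V)ˣ} {p : ℕ} (d : D2 M A p) :
    SB (Subring.center (End D V)) A = ⊤ := by
  haveI := c.nontriv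
  by_contra hS
  obtain ⟨a, ha, b, hb, hab⟩ := d.nc
  have hanc : (a : End D V) ∉ Subring.center (End D V) := fun h => hab (cc h b)
  have hs := c.sub_solv _ ((MS_center M).SB d.mn) hS a ⟨B_le_SB ha, B_le_SB (A.inv_mem ha)⟩ hanc
  set B1 := Subgroup.closure {a, b} with hB1
  have hBA : B1 ≤ A := by
    rw [hB1, Subgroup.closure_le]
    rintro x (rfl | rfl)
    · exact ha
    · exact hb
  have haB : a ∈ B1 := Subgroup.subset_closure (by simp)
  have hbB : b ∈ B1 := Subgroup.subset_closure (by simp)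
  have h : CD (Subring.center (End D V)) B1 B1 :=
    { comm := fun x hx y hy => (Subring.mem_center_iff.mp hx y).symm
      inv := center_unit
      conj := fun b hb x hx => MS_center B1 b hb x hx
      pc := fun x hx y hy => Subring.mem_center_iff.mp hy x
      pb := fun x hx y hy => d.com x (hBA hx) y (hBA hy)
      bb := fun x hx y hy => d.com x (hBA hx) y (hBA hy)
      cen := fun x hx hxc => by
        obtain ⟨z, i, j, hz, rfl⟩ := two_gen_form (d.com b hb a ha) x hx
        have h1 := hxc a haB
        have h2 := hxc b hbB
        have hi : a ^ i * b = b * a ^ i := by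
          have : z * (b * a ^ i) * b ^ j = z * (a ^ i * b) * b ^ j := by
            calc z * (b * a ^ i) * b ^ j = (z * b) * a ^ i * b ^ j := by group
              _ = b * (z * a ^ i * b ^ j) := by rw [cc hz]; group
              _ = _ := by rw [h2]; group
          exact (mul_left_cancel (mul_right_cancel this)).symm
        have hj : b ^ j * a = a * b ^ j := by
          have : z * a ^ i * (b ^ j * a) = z * a ^ i * (a * b ^ j) := by
            calc z * a ^ i * (b ^ j * a) = z * a ^ i * b ^ j * a := by group
              _ = (a * z) * a ^ i * b ^ j := by rw [← h1]; group
              _ = _ := by rw [← cc hz]; group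
          exact mul_left_cancel this
        exact mul_cen (mul_cen hz (zpow_cen_of_comm d.hp (d.com b hb a ha) hab (d.pow a ha) i hi))
          (zpow_cen_of_comm d.hp (d.com a ha b hb) hab.symm (d.pow b hb) j hj) }
  haveI : Group.FG B1 := by
    classical
    exact (Group.fg_iff_subgroup_fg _).mpr ⟨{a, b}, by simp [hB1]⟩
  haveI : Group.FG h.Γ := QuotientGroup.fg h.N
  have htor : Monoid.IsTorsion h.Γ := by
    intro g
    rw [isOfFinOrder_iff_pow_eq_one]
    refine ⟨p, d.hp.pos, ?_⟩
    induction g using QuotientGroup.induction_on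
    rename_i x
    rw [← QuotientGroup.mk_pow, QuotientGroup.eq_one_iff, CD.mem_N]
    exact d.pow x (hBA x.2)
  haveI : Finite h.Γ := CommGroup.finite_of_fg_torsion h.Γ htor
  obtain ⟨a', b', d', hab', hd'⟩ := exists_K (V := V) c.hF
  have hcm := h.fin_comm (fun x hx => B_le_SB hx) le_rfl a' b' d' hab' hd' (solvable_of_uS hs (by
    apply Subring.closure_mono
    apply Set.union_subset_union_right
    exact Set.image_mono hBA))
  exact hab (Units.ext (hcm a (B_le_SB haB) b (B_le_SB hbB)))

end Transv
end SMA

set_option linter.all false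
namespace SMA
open scoped commutatorElement
open Module

section
variable {R : Type*} [Ring R] [Nontrivial R]

theorem SB_mono {L L' : Subring R} {B B' : Subgroup Rˣ} (h : L ≤ L') (h' : B ≤ B') : SB L B ≤ SB L' B' :=
  Subring.closure_mono (Set.union_subset_union h (Set.image_mono h'))

/-- finite support -/
theorem SB_finite {L : Subring R} {B : Subgroup Rˣ} (x : R) (hx : x ∈ SB L B) :
    ∃ (S : Set R) (t : Set Rˣ), S.Finite ∧ t.Finite ∧ S ⊆ L ∧ t ⊆ B ∧
      x ∈ SB (Subring.closure S) (Subgroup.closure t) := by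
  have two : ∀ x y : R, (∃ (S : Set R) (t : Set Rˣ), S.Finite ∧ t.Finite ∧ S ⊆ L ∧ t ⊆ B ∧
      x ∈ SB (Subring.closure S) (Subgroup.closure t)) → (∃ (S : Set R) (t : Set Rˣ), S.Finite ∧ t.Finite ∧ S ⊆ L ∧ t ⊆ B ∧
      y ∈ SB (Subring.closure S) (Subgroup.closure t)) → (∃ (S : Set R) (t : Set Rˣ), S.Finite ∧ t.Finite ∧ S ⊆ L ∧ t ⊆ B ∧
      x ∈ SB (Subring.closure S) (Subgroup.closure t) ∧ y ∈ SB (Subring.closure S) (Subgroup.closure t)) := by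
    rintro x y ⟨S, t, h1, h2, h3, h4, h5⟩ ⟨S', t', h1', h2', h3', h4', h5'⟩
    refine ⟨S ∪ S', t ∪ t', h1.union h1', h2.union h2', Set.union_subset h3 h3', Set.union_subset h4 h4', ?_, ?_⟩
    · exact SB_mono (Subring.closure_mono Set.subset_union_left) (Subgroup.closure_mono Set.subset_union_left) h5
    · exact SB_mono (Subring.closure_mono Set.subset_union_right) (Subgroup.closure_mono Set.subset_union_right) h5'
  induction hx using Subring.closure_induction with
  | mem x hx =>
    rcases hx with hx | ⟨b, hb, rfl⟩
    · exact ⟨{x}, ∅, Set.finite_singleton x, Set.finite_empty, by simpa using hx, by simp,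
        L_le_SB (Subring.subset_closure rfl)⟩
    · exact ⟨∅, {b}, Set.finite_empty, Set.finite_singleton b, by simp, by simpa using hb,
        B_le_SB (Subgroup.subset_closure rfl)⟩
  | zero => exact ⟨∅, ∅, Set.finite_empty, Set.finite_empty, by simp, by simp, Subring.zero_mem _⟩
  | one => exact ⟨∅, ∅, Set.finite_empty, Set.finite_empty, by simp, by simp, Subring.one_mem _⟩
  | add x y _ _ hx hy =>
    obtain ⟨S, t, h1, h2, h3, h4, h5, h6⟩ := two x y hx hy
    exact ⟨S, t, h1, h2, h3, h4, Subring.add_mem _ h5 h6⟩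
  | neg x _ hx =>
    obtain ⟨S, t, h1, h2, h3, h4, h5⟩ := hx
    exact ⟨S, t, h1, h2, h3, h4, Subring.neg_mem _ h5⟩
  | mul x y _ _ hx hy =>
    obtain ⟨S, t, h1, h2, h3, h4, h5, h6⟩ := two x y hx hy
    exact ⟨S, t, h1, h2, h3, h4, Subring.mul_mem _ h5 h6⟩

theorem conj_center {L : Subring R} (h : L ≤ Subring.center R) (b : Rˣ) (x : R) (hx : x ∈ L) :
    (b : R) * x * ((b⁻¹ : Rˣ) : R) ∈ L := by
  rw [Subring.mem_center_iff.mp (h hx) b, Units.mul_inv_cancel_right]; exact hx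

theorem nak {A : Subring R} (hA : A ≤ Subring.center R) {t0 : R} (ht : t0 ∈ A)
    (hj : ∀ f ∈ A, ∃ f' ∈ A, (1 + t0 * f) * f' = 1) (H : Subgroup Rˣ) [Finite H] (x : R) (hx : x ∈ SB A H) :
    ∃ v ∈ SB A H, (1 + t0 * x) * v = 1 := by
  have ms := mem_span_iff_SB (B := H) A (fun b _ x hx => conj_center hA b x hx)
  letI : CommRing A := { (inferInstance : Ring A) with
    mul_comm := fun x y => Subtype.ext (Subring.mem_center_iff.mp (hA y.2) x) }
  set W : Submodule A R := Submodule.span A ((fun b : Rˣ => (b : R)) '' (H : Set Rˣ)) with hW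
  let l : R →ₗ[A] R :=
    { toFun := fun v => (1 + t0 * x) * v
      map_add' := fun v w => mul_add _ _ _
      map_smul' := fun a v => by
        show (1 + t0 * x) * ((a : R) * v) = (a : R) * ((1 + t0 * x) * v)
        rw [← mul_assoc, ← mul_assoc, Subring.mem_center_iff.mp (hA a.2)] }
  have hfg : W.FG := Submodule.fg_span (Set.Finite.image _ (Set.toFinite (H : Set Rˣ)))
  have hle := Submodule.le_of_le_smul_of_le_jacobson_bot (N := W.map l) (N' := W) (I := Ideal.span {(⟨t0, ht⟩ : A)})
    hfg (by
      rw [Ideal.span_le, Set.singleton_subset_iff]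
      refine Ideal.mem_jacobson_bot.mpr fun y => ?_
      obtain ⟨f', hf', e⟩ := hj y y.2
      refine IsUnit.of_mul_eq_one (⟨f', hf'⟩ : A) (Subtype.ext ?_)
      show (t0 * y + 1) * f' = 1
      rw [add_comm]; exact e) (by
      intro w hw
      have e : w = l w + (⟨t0, ht⟩ : A) • (-(x * w)) := by
        show w = (1 + t0 * x) * w + t0 * (-(x * w))
        noncomm_ring
      rw [e]
      refine Submodule.add_mem_sup ⟨w, hw, rfl⟩ (Submodule.smul_mem_smul (Ideal.mem_span_singleton_self _) ?_)
      apply W.neg_mem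
      rw [hW, ← ms] at hw ⊢
      exact Subring.mul_mem _ hx hw)
  obtain ⟨v, hv, e⟩ := hle (show (1 : R) ∈ W by rw [hW, ← ms]; exact Subring.one_mem _)
  exact ⟨v, (ms v).mpr hv, e⟩

theorem nak2 {A : Subring R} (hA : A ≤ Subring.center R) {t0 : R} (ht : t0 ∈ A)
    (hj : ∀ f ∈ A, ∃ f' ∈ A, (1 + t0 * f) * f' = 1) (H : Subgroup Rˣ)
    (hlf : ∀ t : Set Rˣ, t.Finite → t ⊆ H → Finite (Subgroup.closure t)) (x : R) (hx : x ∈ SB A H) :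
    ∃ v ∈ SB A H, (1 + t0 * x) * v = 1 ∧ v * (1 + t0 * x) = 1 := by
  obtain ⟨S, t, h1, h2, h3, h4, h5⟩ := SB_finite x hx
  haveI := hlf t h2 h4
  have hle : SB A (Subgroup.closure t) ≤ SB A H := SB_mono le_rfl ((Subgroup.closure_le _).mpr h4)
  have hx' : x ∈ SB A (Subgroup.closure t) := SB_mono ((Subring.closure_le).mpr h3) le_rfl h5
  obtain ⟨v, hv, e⟩ := nak hA ht hj _ x hx'
  have ev : v = 1 + t0 * (-(x * v)) := by
    have : v = (1 + t0 * x) * v + t0 * (-(x * v)) := by noncomm_ring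
    rw [e] at this; exact this
  obtain ⟨w, hw, e'⟩ := nak hA ht hj _ (-(x * v)) (Subring.neg_mem _ (Subring.mul_mem _ hx' hv))
  rw [← ev] at e'
  have : w = 1 + t0 * x := by
    calc w = ((1 + t0 * x) * v) * w := by rw [e, one_mul]
      _ = 1 + t0 * x := by rw [mul_assoc, e', mul_one]
  rw [this] at e'
  exact ⟨v, hle hv, e, e'⟩

theorem CD.lf {L : Subring R} {P B : Subgroup Rˣ} (h : CD L P B) (n p : ℕ) (hn : n ≠ 0) (hp : p ≠ 0)
    (h1 : ∀ x ∈ B, x ^ n = 1) (h2 : ∀ x ∈ B, ((x ^ p : Rˣ) : R) ∈ L)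
    (t : Set Rˣ) (ht : t.Finite) (htB : t ⊆ B) : Finite (Subgroup.closure t) := by
  have hle : Subgroup.closure t ≤ B := (Subgroup.closure_le _).mpr htB
  have h' := h.mono hle
  haveI : Group.FG (Subgroup.closure t) := (Group.fg_iff_subgroup_fg _).mpr ((Subgroup.fg_iff _).mpr ⟨t, rfl, ht⟩)
  haveI : Group.FG h'.Γ := QuotientGroup.fg h'.N
  have htor : Monoid.IsTorsion h'.Γ := by
    intro g
    rw [isOfFinOrder_iff_pow_eq_one]
    refine ⟨p, Nat.pos_of_ne_zero hp, ?_⟩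
    induction g using QuotientGroup.induction_on
    rename_i x
    rw [← QuotientGroup.mk_pow, QuotientGroup.eq_one_iff, CD.mem_N]
    exact h2 x (hle x.2)
  haveI : Finite h'.Γ := CommGroup.finite_of_fg_torsion h'.Γ htor
  haveI : Finite (Subgroup.closure t ⧸ h'.N) := this
  haveI : Finite h'.N := by
    classical
    letI := h.field
    let f : h'.N → (Polynomial.nthRoots n (1 : L)).toFinset := fun x =>
      ⟨⟨((x : Subgroup.closure t) : Rˣ), x.2⟩, by
        rw [Multiset.mem_toFinset, Polynomial.mem_nthRoots (Nat.pos_of_ne_zero hn)]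
        apply Subtype.ext
        have := h1 _ (hle (x : Subgroup.closure t).2)
        have := congrArg Units.val this
        simpa using this⟩
    apply Finite.of_injective f
    intro x y hxy
    apply Subtype.ext
    apply Subtype.ext
    apply Units.ext
    exact congrArg (fun z => ((z : L) : R)) (congrArg Subtype.val hxy)
  exact Finite.of_equiv _ (Subgroup.groupEquivQuotientProdSubgroup (s := h'.N)).symm

end
end SMA

set_option linter.all false
namespace SMA
open scoped commutatorElement
open Module

theorem exists_local {C : Type*} [CommRing C] (hf : ∀ x : C, x ≠ 0 → ∃ y, x * y = 1) (t0 : C)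
    (ht : ∀ z ∈ Subring.closure {t0}, t0 * z ≠ 1) :
    ∃ F1 : Subring C, t0 ∈ F1 ∧ ∀ f ∈ F1, ∃ f' ∈ F1, (1 + t0 * f) * f' = 1 := by
  set A := Subring.closure {t0} with hA
  have htA : t0 ∈ A := Subring.subset_closure rfl
  let F1 : Subring C :=
    { carrier := {x | ∃ y ∈ A, ∃ z ∈ A, (1 + t0 * z) * x = y}
      zero_mem' := ⟨0, A.zero_mem, 0, A.zero_mem, by simp⟩
      one_mem' := ⟨1, A.one_mem, 0, A.zero_mem, by simp⟩
      neg_mem' := by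
        rintro x ⟨y, hy, z, hz, e⟩
        exact ⟨-y, A.neg_mem hy, z, hz, by rw [← e]; ring⟩
      add_mem' := by
        rintro x x' ⟨y, hy, z, hz, e⟩ ⟨y', hy', z', hz', e'⟩
        refine ⟨(1 + t0 * z') * y + (1 + t0 * z) * y', ?_, z + z' + t0 * z * z', ?_, by rw [← e, ← e']; ring⟩
        · exact A.add_mem (A.mul_mem (A.add_mem A.one_mem (A.mul_mem htA hz')) hy)
            (A.mul_mem (A.add_mem A.one_mem (A.mul_mem htA hz)) hy')
        · exact A.add_mem (A.add_mem hz hz') (A.mul_mem (A.mul_mem htA hz) hz')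
      mul_mem' := by
        rintro x x' ⟨y, hy, z, hz, e⟩ ⟨y', hy', z', hz', e'⟩
        refine ⟨y * y', A.mul_mem hy hy', z + z' + t0 * z * z', ?_, by rw [← e, ← e']; ring⟩
        exact A.add_mem (A.add_mem hz hz') (A.mul_mem (A.mul_mem htA hz) hz') }
  refine ⟨F1, ⟨t0, htA, 0, A.zero_mem, by simp⟩, ?_⟩
  rintro f ⟨y, hy, z, hz, e⟩
  have hne : 1 + t0 * (z + y) ≠ 0 := by
    intro h0
    apply ht (-(z + y)) (A.neg_mem (A.add_mem hz hy))
    linear_combination -h0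
  obtain ⟨w, hw⟩ := hf _ hne
  refine ⟨(1 + t0 * z) * w, ⟨1 + t0 * z, A.add_mem A.one_mem (A.mul_mem htA hz), z + y, A.add_mem hz hy, ?_⟩, ?_⟩
  · linear_combination (1 + t0 * z) * hw
  · have : (1 + t0 * f) * ((1 + t0 * z) * w) = (1 + t0 * (z + y)) * w := by rw [← e]; ring
    rw [this, hw]

theorem one_add_pow {R : Type*} [Ring R] (O : Subring R) (y : R) (hy : y ∈ O) (n : ℕ) :
    ∃ q ∈ O, (1 + y) ^ n = 1 + n * y + y * (y * q) := by
  induction n with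
  | zero => exact ⟨0, O.zero_mem, by simp⟩
  | succ n ih =>
    obtain ⟨q, hq, e⟩ := ih
    refine ⟨n + q + y * q, O.add_mem (O.add_mem (natCast_mem O n) hq) (O.mul_mem hy hq), ?_⟩
    rw [pow_succ', e]
    push_cast
    have : y * ((n : R) * y) = (n : R) * (y * y) := by
      rw [← mul_assoc, ← Nat.cast_comm n y, mul_assoc]
    have h2 : y * (y * (n : R)) = (n : R) * (y * y) := by
      rw [← Nat.cast_comm n y, this]
    have h3 : (1 + y) * (1 + ↑n * y + y * (y * q)) = 1 + (↑n + 1) * y + y * ((n : R) * y) + y * (y * q) + y * (y * (y * q)) := by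
      noncomm_ring
    rw [h3, this, mul_add, mul_add, mul_add, mul_add, h2]
    noncomm_ring

section Transv
variable {D V : Type*} [DivisionRing D] [AddCommGroup V] [Module D V] {G M : Subgroup (End D V)ˣ}

theorem D2.cd [Module.Finite D V] (c : Ctx G M) {A : Subgroup (End D V)ˣ} {p : ℕ} (d : D2 M A p) :
    CD (Subring.center (End D V)) A A :=
  { comm := fun x hx y hy => (Subring.mem_center_iff.mp hx y).symm
    inv := center_unit
    conj := fun b hb x hx => MS_center A b hb x hx
    pc := fun x hx y hy => Subring.mem_center_iff.mp hy x
    pb := d.com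
    bb := d.com
    cen := fun b hb hbc => by
      rw [← d.cen, mem_CX]
      intro x hx
      exact congrArg Units.val (hbc x hx) }

theorem D2.caseI [Module.Finite D V] (c : Ctx G M) {A : Subgroup (End D V)ˣ} {p : ℕ} (d : D2 M A p)
    (t0 : End D V) (ht0 : t0 ∈ Subring.center (End D V)) (htne : t0 ≠ 0)
    (ht : ∀ z ∈ Subring.closure {t0}, t0 * z ≠ 1) : False := by
  haveI := c.nontriv
  set C := Subring.center (End D V) with hC
  have cm : ∀ x ∈ C, ∀ y, x * y = y * x := fun x hx y => (Subring.mem_center_iff.mp hx y).symm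
  -- the local subring
  obtain ⟨F1, hF1C, htF1, hj⟩ : ∃ F1 : Subring (End D V), F1 ≤ C ∧ t0 ∈ F1 ∧ ∀ f ∈ F1, ∃ f' ∈ F1, (1 + t0 * f) * f' = 1 := by
    obtain ⟨F, h1, h2⟩ := exists_local (C := C) (fun x hx => by
        obtain ⟨y, hy, e, -⟩ := center_unit x.1 x.2 (fun h0 => hx (Subtype.ext h0))
        exact ⟨⟨y, hy⟩, Subtype.ext e⟩) ⟨t0, ht0⟩ (by
        intro z hz e
        refine ht z.1 ?_ (congrArg Subtype.val e)
        have : C.subtype z ∈ (Subring.closure {(⟨t0, ht0⟩ : C)}).map C.subtype := ⟨z, hz, rfl⟩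
        rw [RingHom.map_closure] at this
        simpa using this)
    refine ⟨F.map C.subtype, ?_, ⟨_, h1, rfl⟩, ?_⟩
    · rintro _ ⟨x, -, rfl⟩; exact x.2
    · rintro _ ⟨x, hx, rfl⟩
      obtain ⟨f', hf', e⟩ := h2 x hx
      exact ⟨_, ⟨f', hf', rfl⟩, congrArg Subtype.val e⟩
  have hp2 : p ^ 2 ≠ 0 := pow_ne_zero _ d.hp.ne_zero
  have hlf := (d.cd c).lf (p ^ 2) p hp2 d.hp.ne_zero d.pow1 d.pow
  set O := SB F1 A with hO
  have hinv : ∀ x ∈ O, ∃ v ∈ O, (1 + t0 * x) * v = 1 ∧ v * (1 + t0 * x) = 1 :=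
    nak2 hF1C htF1 hj A hlf
  have htO : t0 ∈ O := L_le_SB htF1
  have hAO : ∀ a ∈ A, a ∈ uS O := fun a ha => ⟨B_le_SB ha, B_le_SB (A.inv_mem ha)⟩
  obtain ⟨ti, htiC, hti, hti'⟩ := center_unit t0 ht0 htne
  have hne : O ≠ ⊤ := by
    intro htop
    obtain ⟨v, -, e, -⟩ := hinv (-ti) (by rw [htop]; trivial)
    rw [mul_neg, hti, add_neg_cancel, zero_mul] at e
    exact zero_ne_one e
  have hMS : MS M O := MS.SB (fun m hm x hx => conj_center hF1C m x hx) d.mn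
  obtain ⟨a, ha, b, hb, hab⟩ := d.nc
  have hanc : (a : End D V) ∉ C := fun h => hab (cc h b)
  have hle : uS O ⊓ G ≤ M := c.sub_le O hMS hne a (hAO a ha) hanc
  set N : ℕ := p ^ 2 with hN
  have hN0 : (N : End D V) ≠ 0 := by
    obtain ⟨w, -, e, -⟩ := center_unit (p : End D V) (natCast_mem _ p) d.p0
    intro h0
    rw [hN] at h0
    push_cast at h0
    have := (IsUnit.of_mul_eq_one w e).pow 2
    rw [h0] at this
    exact not_isUnit_zero this
  obtain ⟨Ni, hNiC, hNi, hNi'⟩ := center_unit (N : End D V) (natCast_mem _ N) hN0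
  have hNC : (N : End D V) ∈ C := natCast_mem _ N
  have hNO : (N : End D V) ∈ O := natCast_mem _ N
  -- torsion elements congruent to one are trivial
  have htriv : ∀ h ∈ A, ∀ x ∈ O, (h : End D V) = 1 + t0 * (N * x) → h = 1 := by
    intro h hh x hx e
    have h1 := d.pow1 h hh
    have h2 : (h : End D V) ^ N = 1 := by rw [← Units.val_pow_eq_pow_val, h1, Units.val_one]
    set y := t0 * (N * x) with hy
    have hyO : y ∈ O := O.mul_mem htO (O.mul_mem hNO hx)
    obtain ⟨q, hq, eq⟩ := one_add_pow O y hyO N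
    rw [← e, h2] at eq
    have eq2 : (N : End D V) * (y * (1 + t0 * (x * q))) = 0 := by
      have e1 : y * (y * q) = (N : End D V) * (y * (t0 * (x * q))) := by
        have : y * q = N * (t0 * (x * q)) := by
          rw [hy, ← mul_assoc t0, cm t0 ht0 N]; simp only [mul_assoc]
        rw [this, ← mul_assoc, ← cm _ hNC, mul_assoc]
      rw [mul_add, mul_one, mul_add, ← e1]
      have : (1 : End D V) = 1 + (N * y + y * (y * q)) := by rw [← add_assoc]; exact eq
      exact (left_eq_add.mp this)
    obtain ⟨v, hv, ev, -⟩ := hinv (x * q) (O.mul_mem hx hq)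
    have hy0 : y = 0 := by
      calc y = Ni * (N * (y * (1 + t0 * (x * q)))) * v := by
            rw [← mul_assoc Ni, hNi', one_mul, mul_assoc y, ev, mul_one]
        _ = 0 := by rw [eq2]; simp
    rw [hy0, add_zero] at e
    exact Units.ext (by rw [e, Units.val_one])
  -- the unit u
  have haO : (a : End D V) ∈ O := (hAO a ha).1
  set t : End D V := t0 * N with htd
  have htC : t ∈ C := C.mul_mem ht0 hNC
  obtain ⟨v, hv, e1, e2⟩ := hinv (N * a) (O.mul_mem hNO haO)
  let u : (End D V)ˣ := ⟨1 + t * a, v, by rw [htd, mul_assoc]; exact e1, by rw [htd, mul_assoc]; exact e2⟩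
  have huv : (u : End D V) = 1 + t * a := rfl
  have huO : u ∈ uS O := ⟨O.add_mem O.one_mem (O.mul_mem (O.mul_mem htO hNO) haO), hv⟩
  set ζ := b * a * b⁻¹ * a⁻¹ with hζ
  have hζC : (ζ : End D V) ∈ C := d.com b hb a ha
  have eba : b * a * b⁻¹ = ζ * a := by rw [hζ]; group
  have ebaV : (b : End D V) * a * ((b⁻¹ : (End D V)ˣ) : End D V) = ζ * a := by
    rw [← Units.val_mul, ← Units.val_mul, eba, Units.val_mul]
  -- conjugation by b
  have hconj : ∀ z ∈ C, (b : End D V) * (1 + z * a) * ((b⁻¹ : (End D V)ˣ) : End D V) = 1 + z * ζ * a := by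
    intro z hz
    have : (b : End D V) * (1 + z * a) * ((b⁻¹ : (End D V)ˣ) : End D V) = b * ((b⁻¹ : (End D V)ˣ) : End D V)
        + (b * z) * a * ((b⁻¹ : (End D V)ˣ) : End D V) := by noncomm_ring
    rw [this, Units.mul_inv, ← cm z hz, mul_assoc z, mul_assoc z, ebaV, mul_assoc]
  set u1 := b * u * b⁻¹ with hu1
  set u2 := b * u1 * b⁻¹ with hu2
  have hu1v : (u1 : End D V) = 1 + t * ζ * a := by
    rw [hu1, Units.val_mul, Units.val_mul, huv, hconj t htC]
  have hu2v : (u2 : End D V) = 1 + t * ζ * ζ * a := by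
    rw [hu2, Units.val_mul, Units.val_mul, hu1v, hconj _ (C.mul_mem htC hζC)]
  have hu1O : u1 ∈ uS O := (uS O).mul_mem ((uS O).mul_mem (hAO b hb) huO) ((uS O).inv_mem (hAO b hb))
  set g := u1 * u⁻¹ with hg
  have hgE : g ∈ EE D V := by
    have := T3 c.h2 b u
    rwa [← hu1] at this
  have hgO : g ∈ uS O := (uS O).mul_mem hu1O ((uS O).inv_mem huO)
  have hgM : g ∈ M := hle ⟨hgO, c.hE hgE⟩
  have hζO : (ζ : End D V) ∈ O := (hAO _ (A.mul_mem (A.mul_mem (A.mul_mem hb ha) (A.inv_mem hb)) (A.inv_mem ha))).1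
  have hgv : (g : End D V) = 1 + t * ((ζ - 1) * a * ((u⁻¹ : (End D V)ˣ) : End D V)) := by
    have : (u1 : End D V) = u + t * ((ζ - 1) * a) := by rw [hu1v, huv]; noncomm_ring
    rw [hg, Units.val_mul, this, add_mul, Units.mul_inv, mul_assoc]
  set y := ((ζ : End D V) - 1) * a * ((u⁻¹ : (End D V)ˣ) : End D V) with hy
  have hyO : y ∈ O := O.mul_mem (O.mul_mem (O.sub_mem hζO O.one_mem) haO) huO.2
  have hcomm : g * b * g⁻¹ * b⁻¹ = 1 := by
    refine htriv _ (A.mul_mem (d.mn g hgM b hb) (A.inv_mem hb))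
      ((y * b - b * y) * ((g⁻¹ * b⁻¹ : (End D V)ˣ) : End D V)) ?_ ?_
    · refine O.mul_mem (O.sub_mem (O.mul_mem hyO (hAO b hb).1) (O.mul_mem (hAO b hb).1 hyO)) ?_
      exact ((uS O).mul_mem ((uS O).inv_mem hgO) ((uS O).inv_mem (hAO b hb))).1
    · have e3 : (g : End D V) * b = b * g + t * (y * b - b * y) := by
        have : (b : End D V) * (t * y) = t * (b * y) := by rw [← mul_assoc, ← cm t htC, mul_assoc]
        rw [hgv, add_mul, mul_add, this]; noncomm_ring
      rw [mul_assoc (g * b), Units.val_mul, Units.val_mul, e3, add_mul, ← Units.val_mul, ← Units.val_mul,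
        show b * g * (g⁻¹ * b⁻¹) = 1 by group, Units.val_one, htd]
      simp only [mul_assoc]
  have hgb : b * g * b⁻¹ = g := by
    rw [mul_inv_eq_one, mul_inv_eq_iff_eq_mul] at hcomm
    rw [mul_inv_eq_iff_eq_mul, hcomm]
  have hgb2 : u2 * u1⁻¹ = u1 * u⁻¹ := by
    have : b * g * b⁻¹ = u2 * u1⁻¹ := by rw [hg, hu2, hu1]; group
    rw [← this, hgb]
  have hcu : u1 * u = u * u1 := by
    apply Units.ext
    rw [Units.val_mul u1 u, Units.val_mul u u1, hu1v, huv]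
    have : ((t * ζ * a) * (t * a) : End D V) = (t * a) * (t * ζ * a) := by
      have h1 := cm ζ hζC
      have h2 := cm t htC
      calc ((t * ζ * a) * (t * a) : End D V) = t * (ζ * (a * (t * a))) := by simp only [mul_assoc]
        _ = t * (a * (t * (ζ * a))) := by rw [h1]; simp only [mul_assoc]; rw [h1]
        _ = _ := by simp only [mul_assoc]
    have e3 : (1 + t * ζ * a) * (1 + t * a) = 1 + t * a + t * ζ * a + (t * ζ * a) * (t * a) := by noncomm_ring
    have e4 : (1 + t * a) * (1 + t * ζ * a) = 1 + t * a + t * ζ * a + (t * a) * (t * ζ * a) := by noncomm_ring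
    rw [e3, e4, this]
  have hfin : u1 * u1 = u2 * u := by
    have : u2 = u1 * u⁻¹ * u1 := by rw [← hgb2]; group
    calc u1 * u1 = u1 * u⁻¹ * (u * u1) := by group
      _ = u1 * u⁻¹ * (u1 * u) := by rw [hcu]
      _ = (u1 * u⁻¹ * u1) * u := by group
      _ = u2 * u := by rw [← this]
  have hfinv := congrArg Units.val hfin
  rw [Units.val_mul u1 u1, Units.val_mul u2 u, hu1v, hu2v, huv] at hfinv
  have hz1 : (ζ : End D V) - 1 ≠ 0 := by
    intro h0
    have : ζ = 1 := Units.ext (by rw [Units.val_one]; exact sub_eq_zero.mp h0)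
    apply hab
    rw [hζ, mul_inv_eq_one, mul_inv_eq_iff_eq_mul] at this
    exact this.symm
  obtain ⟨zi, -, ez, -⟩ := center_unit _ (C.sub_mem hζC C.one_mem) hz1
  have hfin2 : t * (((ζ : End D V) - 1) * (ζ - 1)) * a = 0 := by
    have e3 : (1 + t * ζ * a) * (1 + t * ζ * a) = 1 + t * ζ * a + t * ζ * a + (t * ζ * a) * (t * ζ * a) := by noncomm_ring
    have e4 : (1 + t * ζ * ζ * a) * (1 + t * a) = 1 + t * a + t * ζ * ζ * a + (t * ζ * ζ * a) * (t * a) := by noncomm_ring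
    have e5 : (t * ζ * a) * (t * ζ * a) = (t * ζ * ζ * a) * (t * a) := by
      have h1 := cm ζ hζC
      calc (t * ζ * a) * (t * ζ * a) = t * ζ * ((a * t) * ζ) * a := by simp only [mul_assoc]
        _ = _ := by rw [← h1 (a * t)]; simp only [mul_assoc]
    rw [e3, e4, e5] at hfinv
    have hfinv := add_right_cancel hfinv
    have e6 : t * (((ζ : End D V) - 1) * (ζ - 1)) * a = (1 + t * a + t * ζ * ζ * a) - (1 + t * ζ * a + t * ζ * a) := by noncomm_ring
    rw [e6, hfinv, sub_self]
  have hu_t : IsUnit t := (IsUnit.of_mul_eq_one ti hti).mul (IsUnit.of_mul_eq_one Ni hNi)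
  have hu_z : IsUnit ((ζ : End D V) - 1) := IsUnit.of_mul_eq_one zi ez
  have := (hu_t.mul (hu_z.mul hu_z)).mul a.isUnit
  rw [hfin2] at this
  exact not_isUnit_zero this

end Transv
end SMA

set_option linter.all false
namespace SMA
open scoped commutatorElement
open Module

theorem finite_closure {C : Type*} [CommRing C] [IsDomain C]
    (hC : ∀ t : C, t ≠ 0 → ∃ z ∈ Subring.closure {t}, t * z = 1) (S : Set C) (hS : S.Finite) :
    Finite (Subring.closure S) := by
  obtain ⟨q, hq⟩ := CharP.exists C
  have hq0 : q ≠ 0 := by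
    rintro rfl
    haveI : CharZero C := CharP.charP_to_charZero C
    obtain ⟨z, hz, e⟩ := hC 2 two_ne_zero
    have hle : Subring.closure {(2 : C)} ≤ (Int.castRingHom C).range := by
      rw [Subring.closure_le, Set.singleton_subset_iff]
      exact ⟨2, by simp⟩
    obtain ⟨k, rfl⟩ := hle hz
    have : (2 * k : ℤ) = 1 := by
      have : ((2 * k : ℤ) : C) = ((1 : ℤ) : C) := by push_cast; simpa using e
      exact Int.cast_injective this
    omega
  have hqp : q.Prime := (CharP.char_is_prime_or_zero C q).resolve_right hq0
  haveI := Fact.mk hqp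
  letI : Algebra (ZMod q) C := ZMod.algebra C q
  have hIntegral : ∀ t : C, IsIntegral (ZMod q) t := by
    intro t
    by_cases ht : t = 0
    · rw [ht]; exact isIntegral_zero
    obtain ⟨z, hz, e⟩ := hC t ht
    have hz' : z ∈ Algebra.adjoin (ZMod q) {t} := by
      have : Subring.closure {t} ≤ (Algebra.adjoin (ZMod q) {t}).toSubring := by
        rw [Subring.closure_le]
        exact Algebra.subset_adjoin
      exact this hz
    rw [Algebra.adjoin_singleton_eq_range_aeval] at hz'
    obtain ⟨P, rfl⟩ := hz'
    rw [← isAlgebraic_iff_isIntegral]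
    refine ⟨Polynomial.X * P - 1, ?_, ?_⟩
    · intro h0
      have := congrArg (Polynomial.eval 0) h0
      simp at this
    · simpa [sub_eq_zero] using e
  have hfg := fg_adjoin_of_finite hS (fun x _ => hIntegral x)
  haveI : Module.Finite (ZMod q) (Algebra.adjoin (ZMod q) S) := Module.Finite.iff_fg.mpr hfg
  haveI : Finite (Algebra.adjoin (ZMod q) S) := Module.finite_of_finite (ZMod q)
  have hle : Subring.closure S ≤ (Algebra.adjoin (ZMod q) S).toSubring := by
    rw [Subring.closure_le]
    exact Algebra.subset_adjoin
  exact Finite.of_injective (fun x : Subring.closure S => (⟨x, hle x.2⟩ : Algebra.adjoin (ZMod q) S))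
    (fun x y h => Subtype.ext (congrArg (fun z : Algebra.adjoin (ZMod q) S => (z : C)) h))

section Transv
variable {D V : Type*} [DivisionRing D] [AddCommGroup V] [Module D V] {G M : Subgroup (End D V)ˣ}

theorem D2.caseII [Module.Finite D V] (c : Ctx G M) {A : Subgroup (End D V)ˣ} {p : ℕ} (d : D2 M A p)
    (ht : ∀ t0 ∈ Subring.center (End D V), t0 ≠ 0 → ∃ z ∈ Subring.closure {t0}, t0 * z = 1) : False := by
  haveI := c.nontriv
  set C := Subring.center (End D V) with hC
  haveI : IsDomain C := by
    haveI : NoZeroDivisors C := ⟨by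
      intro x y hxy
      by_contra hcon
      push Not at hcon
      obtain ⟨w, hw, e, e'⟩ := center_unit x.1 x.2 (fun h0 => hcon.1 (Subtype.ext h0))
      apply hcon.2
      apply Subtype.ext
      have : (x : End D V) * y = 0 := congrArg Subtype.val hxy
      calc (y : End D V) = w * (x * y) := by rw [← mul_assoc, e', one_mul]
        _ = 0 := by rw [this, mul_zero]⟩
    exact NoZeroDivisors.to_isDomain C
  have hfin : ∀ S : Set (End D V), S.Finite → S ⊆ C → Finite (Subring.closure S) := by
    intro S hS hSC
    have h1 := finite_closure (C := C) (by
      intro t ht0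
      obtain ⟨z, hz, e⟩ := ht t t.2 (fun h0 => ht0 (Subtype.ext h0))
      have h2 : (Subring.closure {t}).map C.subtype = Subring.closure {(t : End D V)} := by
        rw [RingHom.map_closure]; simp
      rw [← h2] at hz
      obtain ⟨z', hz', rfl⟩ := hz
      exact ⟨z', hz', Subtype.ext e⟩) (C.subtype ⁻¹' S) (hS.preimage Subtype.val_injective.injOn)
    have h2 : (Subring.closure (C.subtype ⁻¹' S)).map C.subtype = Subring.closure S := by
      rw [RingHom.map_closure, Set.image_preimage_eq_of_subset]
      intro x hx
      exact ⟨⟨x, hSC hx⟩, rfl⟩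
    rw [← h2]
    exact (Set.Finite.image _ (Set.toFinite ((Subring.closure (C.subtype ⁻¹' S) : Subring C) : Set C))).to_subtype
  have hp2 : p ^ 2 ≠ 0 := pow_ne_zero _ d.hp.ne_zero
  have hlf := (d.cd c).lf (p ^ 2) p hp2 d.hp.ne_zero d.pow1 d.pow
  have htop := d.top c
  have hSBfin : ∀ (S : Set (End D V)) (t : Set (End D V)ˣ), S.Finite → t.Finite → S ⊆ C → t ⊆ A →
      ((SB (Subring.closure S) (Subgroup.closure t) : Subring (End D V)) : Set (End D V)).Finite := by
    intro S t hS ht hSC htA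
    haveI := hfin S hS hSC
    haveI := hlf t ht htA
    have hle : Subring.closure S ≤ C := Subring.closure_le.mpr hSC
    have ms := mem_span_iff_SB (B := Subgroup.closure t) (Subring.closure S) (fun b _ x hx => conj_center hle b x hx)
    set W := Submodule.span (Subring.closure S) ((fun b : (End D V)ˣ => (b : End D V)) '' (Subgroup.closure t : Set (End D V)ˣ)) with hW
    have hfg : W.FG := Submodule.fg_span (Set.Finite.image _ (Set.toFinite (Subgroup.closure t : Set (End D V)ˣ)))
    haveI : Module.Finite (Subring.closure S) W := Module.Finite.iff_fg.mpr hfg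
    haveI : Finite W := Module.finite_of_finite (Subring.closure S)
    have : (SB (Subring.closure S) (Subgroup.closure t) : Set (End D V)) = (W : Set (End D V)) := by
      ext x; exact ms x
    rw [this]
    exact Set.toFinite _
  obtain ⟨d1, d2, hd⟩ := c.hnc
  obtain ⟨φ, -, v, -, hφ, -, -, -⟩ := exists_pair c.h2
  have hv : v ≠ 0 := by rintro rfl; simp at hφ
  let x : D → End D V := fun d => rk φ (d • v)
  have hx : ∀ d, ∃ (S : Set (End D V)) (t : Set (End D V)ˣ), S.Finite ∧ t.Finite ∧ S ⊆ C ∧ t ⊆ A ∧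
      x d ∈ SB (Subring.closure S) (Subgroup.closure t) := fun d => SB_finite _ (by rw [htop]; trivial)
  obtain ⟨S0, t0, a0, b0, c0, e0, f0⟩ := hx 1
  obtain ⟨S1, t1, a1, b1, c1, e1, f1⟩ := hx d1
  obtain ⟨S2, t2, a2, b2, c2, e2, f2⟩ := hx d2
  set T := SB (Subring.closure (S0 ∪ S1 ∪ S2)) (Subgroup.closure (t0 ∪ t1 ∪ t2)) with hT
  have hTf : (T : Set (End D V)).Finite := hSBfin _ _ ((a0.union a1).union a2) ((b0.union b1).union b2)
    (Set.union_subset (Set.union_subset c0 c1) c2) (Set.union_subset (Set.union_subset e0 e1) e2)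
  have g0 : x 1 ∈ T := SB_mono (Subring.closure_mono (Set.subset_union_left.trans Set.subset_union_left))
    (Subgroup.closure_mono (Set.subset_union_left.trans Set.subset_union_left)) f0
  have g1 : x d1 ∈ T := SB_mono (Subring.closure_mono (Set.subset_union_right.trans Set.subset_union_left))
    (Subgroup.closure_mono (Set.subset_union_right.trans Set.subset_union_left)) f1
  have g2 : x d2 ∈ T := SB_mono (Subring.closure_mono Set.subset_union_right)
    (Subgroup.closure_mono Set.subset_union_right) f2
  have hxadd : ∀ a b, x (a + b) = x a + x b := by
    intro a b; ext w; simp [x, add_smul, smul_add]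
  have hxneg : ∀ a, x (-a) = - x a := by
    intro a; ext w; simp [x]
  have hxmul : ∀ a b, x (a * b) = x b * x a := by
    intro a b
    show rk φ _ = rk φ _ * rk φ _
    rw [rk_mul_rk, map_smul, hφ, smul_eq_mul, mul_one, mul_smul]
  have hx0 : x 0 = 0 := by ext w; simp [x]
  have hxinj : Function.Injective x := by
    intro a b hab
    have := congrArg (fun f : End D V => φ (f v)) hab
    simpa [x, hφ] using this
  let E : Subring D :=
    { carrier := {d | x d ∈ T}
      zero_mem' := by show x 0 ∈ T; rw [hx0]; exact T.zero_mem
      one_mem' := g0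
      add_mem' := by intro a b ha hb; show x (a + b) ∈ T; rw [hxadd]; exact T.add_mem ha hb
      neg_mem' := by intro a ha; show x (-a) ∈ T; rw [hxneg]; exact T.neg_mem ha
      mul_mem' := by intro a b ha hb; show x (a * b) ∈ T; rw [hxmul]; exact T.mul_mem hb ha }
  haveI : Finite E := (hTf.preimage hxinj.injOn).to_subtype
  have hF := Finite.isDomain_to_isField E
  exact hd (congrArg Subtype.val (hF.mul_comm ⟨d1, g1⟩ ⟨d2, g2⟩))

theorem Ctx.main [Module.Finite D V] (c : Ctx G M) : ∀ x ∈ M, ∀ y ∈ M, x * y = y * x := by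
  by_contra hM
  have hab : ∀ A : Subgroup (End D V)ˣ, MN M A → (∀ x ∈ A, ∀ y ∈ A, x * y = y * x) → Cen A := by
    intro A hA hcomm
    by_contra hc
    exact hM (c.caseI A hA hc hcomm)
  obtain ⟨A, p, d⟩ := c.exD2 hab hM
  refine d.caseII c fun t0 ht0 hne => ?_
  by_contra hcon
  push Not at hcon
  exact d.caseI c t0 ht0 hne hcon

end Transv
end SMA

namespace SMA
open scoped commutatorElement
open Module

noncomputable def psi (D : Type*) [DivisionRing D] (n : ℕ) :
    (Matrix (Fin n) (Fin n) D)ˣ ≃* (End D (Fin n → D))ˣ :=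
  ((Units.mapEquiv (matrixRingEquivEndVecMulOpposite (ι := Fin n) (A := D)).toMulEquiv).trans Units.opEquiv).trans
    (MulEquiv.inv' _).symm

theorem subnormal_dich {Γ R : Type*} [Group Γ] [Ring R] (Ψ : Γ ≃* Rˣ) (E : Subgroup Rˣ)
    (hT : ∀ H : Subgroup Rˣ, (∀ e ∈ E, ∀ x ∈ H, e * x * e⁻¹ ∈ H) → (∀ h ∈ H, (h : R) ∈ Subring.center R) ∨ E ≤ H)
    (s : ℕ → Subgroup Γ) (k : ℕ) (hk : s k = ⊤)
    (hs : ∀ i < k, s i ≤ s (i + 1) ∧ ((s i).subgroupOf (s (i + 1))).Normal) (j : ℕ) :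
    ∀ i, i + j = k → (∀ h ∈ (s i).map Ψ.toMonoidHom, (h : R) ∈ Subring.center R) ∨ E ≤ (s i).map Ψ.toMonoidHom := by
  induction j with
  | zero =>
    rintro i rfl
    right
    intro e _
    rw [add_zero] at hk
    rw [hk]
    exact ⟨Ψ.symm e, trivial, by simp⟩
  | succ j ih =>
    intro i hi
    obtain ⟨hle, hn⟩ := hs i (by omega)
    rcases ih (i + 1) (by omega) with h | h
    · left
      intro x hx
      exact h x (Subgroup.map_mono hle hx)
    · apply hT
      rintro e he _ ⟨x, hx, rfl⟩
      obtain ⟨y, hy, rfl⟩ := h he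
      refine ⟨y * x * y⁻¹, ?_, by simp⟩
      exact hn.conj_mem (⟨x, hle hx⟩ : s (i + 1)) hx ⟨y, hy⟩

theorem final {D : Type*} [DivisionRing D]
    (hnc : ∃ a b : D, a * b ≠ b * a)
    (hcard : ∃ s : Finset D, (s : Set D) ⊆ (Subring.center D : Set D) ∧ 5 ≤ s.card)
    (n : ℕ) (hn : 2 ≤ n)
    (G : Subgroup (Matrix (Fin n) (Fin n) D)ˣ) (hG : IsSubnormal G)
    (M : Subgroup (Matrix (Fin n) (Fin n) D)ˣ)
    (hmax : M < G ∧ ∀ H : Subgroup (Matrix (Fin n) (Fin n) D)ˣ, M ≤ H → H ≤ G → H = M ∨ H = G)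
    (hsol : Group.IsSolvable ↥M) :
    ∀ x ∈ M, ∀ y ∈ M, x * y = y * x := by
  classical
  let Ψ := psi D n
  have h2 : ∀ x : Fin n → D, ∃ z, z ∉ D ∙ x := by
    intro x
    by_contra hcon
    push Not at hcon
    have htop : (D ∙ x) = ⊤ := by rw [eq_top_iff]; intro z _; exact hcon z
    have h1 : Module.finrank D (D ∙ x) ≤ 1 := by
      simpa using finrank_span_le_card (R := D) ({x} : Set (Fin n → D))
    rw [htop, finrank_top, Module.finrank_fin_fun] at h1
    omega
  have hF : ∃ f ∈ Subring.center D, f ≠ 0 ∧ f * f ≠ 1 := by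
    obtain ⟨s, hs, h5⟩ := hcard
    by_contra hcon
    push Not at hcon
    have : s ⊆ {0, 1, -1} := by
      intro f hf
      by_cases h0 : f = 0
      · simp [h0]
      · have := mul_self_eq_one_iff.mp (hcon f (hs hf) h0)
        rcases this with h | h <;> simp [h]
    have := (Finset.card_le_card this).trans Finset.card_le_three
    omega
  obtain ⟨k, s, hs0, hsk, hs⟩ := hG
  have inj : ∀ H K : Subgroup (Matrix (Fin n) (Fin n) D)ˣ, H.map Ψ.toMonoidHom ≤ K.map Ψ.toMonoidHom ↔ H ≤ K :=
    fun H K => Subgroup.map_le_map_iff_of_injective Ψ.injective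
  have key : ∀ x ∈ M.map Ψ.toMonoidHom, ∀ y ∈ M.map Ψ.toMonoidHom, x * y = y * x := by
    rcases subnormal_dich Ψ (EE D (Fin n → D)) (fun H hH => T4 h2 (exists_K hF) H hH) s k hsk hs k 0 (by omega) with h | h
    · intro x hx y hy
      rw [hs0] at h
      exact cc (h x (Subgroup.map_mono hmax.1.le hx)) y
    · rw [hs0] at h
      have c : Ctx (G.map Ψ.toMonoidHom) (M.map Ψ.toMonoidHom) :=
        { h2 := h2
          hF := hF
          hnc := hnc
          hE := h
          hlt := by
            rw [lt_iff_le_not_ge, inj, inj]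
            exact lt_iff_le_not_ge.mp hmax.1
          hmax := by
            intro H h1 h2
            have hH : (H.comap Ψ.toMonoidHom).map Ψ.toMonoidHom = H :=
              Subgroup.map_comap_eq_self_of_surjective Ψ.surjective H
            rw [← hH, inj] at h1 h2
            rcases hmax.2 _ h1 h2 with h | h
            · left; rw [← hH, h]
            · right; rw [← hH, h]
          hsol := by
            haveI := hsol
            exact Group.isSolvable_of_isSolvable_injective (f := (M.equivMapOfInjective Ψ.toMonoidHom Ψ.injective).symm.toMonoidHom)
              (M.equivMapOfInjective Ψ.toMonoidHom Ψ.injective).symm.injective }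
      exact c.main
  intro x hx y hy
  apply Ψ.injective
  rw [map_mul, map_mul]
  exact key _ ⟨x, hx, rfl⟩ _ ⟨y, hy, rfl⟩

end SMA

/-- Let `D` be a non-commutative division ring whose center contains at least five
elements, and `G` a subnormal subgroup of `GL_n(D)` with `n ≥ 2`.  Then every solvable
maximal subgroup of `G` is abelian. -/
theorem solvable_maximal_abelian {D : Type*} [DivisionRing D]
    (hnc : ∃ a b : D, a * b ≠ b * a)
    (hcard : ∃ s : Finset D, (s : Set D) ⊆ (Subring.center D : Set D) ∧ 5 ≤ s.card)
    (n : ℕ) (hn : 2 ≤ n)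
    (G : Subgroup (Matrix (Fin n) (Fin n) D)ˣ) (hG : IsSubnormal G)
    (M : Subgroup (Matrix (Fin n) (Fin n) D)ˣ)
    (hmax : M < G ∧ ∀ H : Subgroup (Matrix (Fin n) (Fin n) D)ˣ, M ≤ H → H ≤ G → H = M ∨ H = G)
    (hsol : IsSolvable ↥M) :
    ∀ x ∈ M, ∀ y ∈ M, x * y = y * x := by
  exact SMA.final hnc hcard n hn G hG M hmax hsol
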